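/- Let K_1,…,K_r be finite cyclic Galois extensions of ℚ and let c_1,…,c_r ∈ ℚ^×. Suppose that for every completion ℚ_v of ℚ (ℚ_v = ℝ or ℚ_p for a prime p) there exist a nonzero s ∈ ℚ_v and elements x_i ∈ K_i ⊗_ℚ ℚ_v with N_{(K_i⊗ℚ_v)/ℚ_v}(x_i) = c_i s ≠ 0 for all i = 1,…,r. Then there exist a nonzero s ∈ ℚ and elements x_i ∈ K_i with N_{K_i/ℚ}(x_i) = c_i s for all i = 1,…,r; equivalently, the variety N_{K_1/ℚ}(x_1)/c_1 = … = N_{K_r/ℚ}(x_r)/c_r ≠ 0 satisfies the Hasse principle. -/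

import Mathlib

open scoped TensorProduct

namespace MN
set_option linter.unusedSectionVars false
open Subgroup

section herbrand
variable {A : Type*} [CommGroup A]

/-- Herbrand index. -/
noncomputable def hb (f g : A →* A) (B : Subgroup A) : ℕ := (B.map g).relIndex (B ⊓ f.ker)

lemma idx_split (f : A →* A) {B C : Subgroup A} (h : B ≤ C) :
    B.relIndex C = (B.map f).relIndex (C.map f) * (B ⊓ f.ker).relIndex (C ⊓ f.ker) := by
  have h1 : (B.map f).relIndex (C.map f) = (B ⊔ (C ⊓ f.ker)).relIndex C := by
    rw [relIndex_map_map]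
    have e1 : C ⊔ f.ker = C ⊔ (B ⊔ f.ker) := by
      rw [← sup_assoc, sup_eq_left.mpr h]
    rw [e1, relIndex_sup_right, ← inf_relIndex_right]
    congr 1
    rw [sup_inf_assoc_of_le _ h, inf_comm]
  have h2 : (B ⊓ f.ker).relIndex (C ⊓ f.ker) = B.relIndex (B ⊔ (C ⊓ f.ker)) := by
    rw [relIndex_sup_left, ← inf_relIndex_right B]
    congr 1
    rw [← inf_assoc, inf_eq_left.mpr h]
  rw [h1, h2, mul_comm, relIndex_mul_relIndex _ _ _ le_sup_left (sup_le h inf_le_left)]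

lemma map_le_ker {f g : A →* A} (h : ∀ x, f (g x) = 1) (B : Subgroup A) : B.map g ≤ f.ker := by
  rintro _ ⟨x, -, rfl⟩
  exact h x

lemma hb_aux {f g : A →* A} (hfg : ∀ x, f (g x) = 1)
    {B C : Subgroup A} (hBC : B ≤ C) (hBg : B.map g ≤ B) (hCg : C.map g ≤ C) :
    hb f g C * (B.map g).relIndex (C.map g) = hb f g B * (B ⊓ f.ker).relIndex (C ⊓ f.ker) := by
  unfold hb
  rw [mul_comm, relIndex_mul_relIndex _ _ _ (map_mono hBC) (le_inf hCg (map_le_ker hfg _)),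
    relIndex_mul_relIndex _ _ _ (le_inf hBg (map_le_ker hfg _)) (inf_le_inf_right _ hBC)]

lemma hb_ne_zero {f g : A →* A} (hfg : ∀ x, f (g x) = 1)
    {B C : Subgroup A} (hBC : B ≤ C) (hBg : B.map g ≤ B) (hCg : C.map g ≤ C)
    (hfin : B.relIndex C ≠ 0) (h : hb f g B ≠ 0) : hb f g C ≠ 0 := by
  have := hb_aux hfg hBC hBg hCg
  intro h0
  rw [h0, zero_mul, eq_comm, mul_eq_zero] at this
  rcases this with h1 | h1
  · exact h h1
  · rw [idx_split f hBC, h1, mul_zero] at hfin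
    exact hfin rfl

/-- Herbrand's lemma. -/
lemma hb_lemma {f g : A →* A} (hfg : ∀ x, f (g x) = 1) (hgf : ∀ x, g (f x) = 1)
    {B C : Subgroup A} (hBC : B ≤ C) (hBf : B.map f ≤ B) (hBg : B.map g ≤ B)
    (hCf : C.map f ≤ C) (hCg : C.map g ≤ C) (hfin : B.relIndex C ≠ 0) :
    hb f g C * hb g f B = hb f g B * hb g f C := by
  have h1 := hb_aux hfg hBC hBg hCg
  have h2 := hb_aux hgf hBC hBf hCf
  have h3 := idx_split f hBC
  have h4 := idx_split g hBC
  apply Nat.eq_of_mul_eq_mul_right (Nat.pos_of_ne_zero hfin)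
  generalize B.relIndex C = k at *
  calc hb f g C * hb g f B * k
      = (hb f g C * (B.map g).relIndex (C.map g)) *
          (hb g f B * (B ⊓ g.ker).relIndex (C ⊓ g.ker)) := by rw [h4]; ring
    _ = hb f g B * hb g f C * k := by rw [h1, ← h2, h3]; ring

lemma relIndex_sup_sup {B₁ B₂ C₁ C₂ : Subgroup A} (hB : B₂ ≤ B₁) (hC : C₂ ≤ C₁)
    (hd : Disjoint B₁ C₁) :
    (B₂ ⊔ C₂).relIndex (B₁ ⊔ C₁) = B₂.relIndex B₁ * C₂.relIndex C₁ := by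
  have key : ∀ {B C₁ C₂ : Subgroup A}, C₂ ≤ C₁ → Disjoint B C₁ →
      (B ⊔ C₂).relIndex (B ⊔ C₁) = C₂.relIndex C₁ := by
    intro B C₁ C₂ hC hd
    have : B ⊔ C₁ = (B ⊔ C₂) ⊔ C₁ := by rw [sup_assoc, sup_eq_right.mpr hC]
    rw [this, relIndex_sup_left, ← inf_relIndex_right]
    congr 1
    rw [sup_comm, sup_inf_assoc_of_le _ hC, hd.eq_bot, sup_bot_eq]
  rw [← relIndex_mul_relIndex (B₂ ⊔ C₂) (B₁ ⊔ C₂) (B₁ ⊔ C₁) (sup_le_sup_right hB _)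
    (sup_le_sup_left hC _), key hC hd]
  congr 1
  rw [sup_comm, sup_comm B₁]
  exact key hB (hd.symm.mono_left hC)

lemma hb_sup (f g : A →* A) {B C : Subgroup A} (hfg : ∀ x, f (g x) = 1)
    (hBf : B.map f ≤ B) (hBg : B.map g ≤ B)
    (hCf : C.map f ≤ C) (hCg : C.map g ≤ C) (hd : Disjoint B C) :
    hb f g (B ⊔ C) = hb f g B * hb f g C := by
  unfold hb
  have : (B ⊔ C) ⊓ f.ker = (B ⊓ f.ker) ⊔ (C ⊓ f.ker) := by
    apply le_antisymm
    · rintro x ⟨hx, hk⟩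
      obtain ⟨b, hb, c, hc, rfl⟩ := mem_sup.mp hx
      have hk' : f b * f c = 1 := by rw [← map_mul]; exact hk
      have h1 : f b ∈ B := hBf ⟨b, hb, rfl⟩
      have h2 : f c ∈ C := hCf ⟨c, hc, rfl⟩
      have h3 : f b = 1 := by
        have : f b ∈ B ⊓ C := ⟨h1, by rw [eq_inv_of_mul_eq_one_left hk']; exact C.inv_mem h2⟩
        rwa [hd.eq_bot, mem_bot] at this
      have h4 : f c = 1 := by rwa [h3, one_mul] at hk'
      exact mul_mem_sup ⟨hb, h3⟩ ⟨hc, h4⟩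
    · exact sup_le (inf_le_inf_right _ le_sup_left) (inf_le_inf_right _ le_sup_right)
  rw [this, Subgroup.map_sup, relIndex_sup_sup (le_inf hBg (map_le_ker hfg _))
    (le_inf hCg (map_le_ker hfg _)) (hd.mono inf_le_left inf_le_left)]

lemma map_sup_le {f : A →* A} {B C : Subgroup A} (hB : B.map f ≤ B) (hC : C.map f ≤ C) :
    (B ⊔ C).map f ≤ B ⊔ C := by
  rw [Subgroup.map_sup]; exact sup_le_sup hB hC

end herbrand

section cyc

lemma prod_zpow_sum {A ι : Type*} [CommGroup A] (s : Finset ι) (x : A) (a : ι → ℤ) :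
    ∏ i ∈ s, x ^ a i = x ^ ∑ i ∈ s, a i := by
  classical
  induction s using Finset.induction_on with
  | empty => simp
  | insert i s hi ih => rw [Finset.prod_insert hi, Finset.sum_insert hi, ih, zpow_add]

variable {A : Type*} [CommGroup A] (σ : A →* A)

/-- `σ - 1` -/
def Dl : A →* A := σ / MonoidHom.id A
/-- norm -/
def Nm (n : ℕ) : A →* A where
  toFun x := ∏ i ∈ Finset.range n, σ^[i] x
  map_one' := by simp
  map_mul' x y := by simp [Finset.prod_mul_distrib]

lemma Dl_apply (x : A) : Dl σ x = σ x / x := rfl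
lemma Nm_apply (n : ℕ) (x : A) : Nm σ n x = ∏ i ∈ Finset.range n, σ^[i] x := rfl

lemma Nm_sigma {n : ℕ} (hn : ∀ x, σ^[n] x = x) (x : A) : Nm σ n (σ x) = Nm σ n x := by
  have h1 := Finset.prod_range_succ (fun i => σ^[i] x) n
  have h2 := Finset.prod_range_succ' (fun i => σ^[i] x) n
  rw [h1, hn] at h2
  simp only [Function.iterate_zero, id, Function.iterate_succ_apply] at h2
  rw [Nm_apply, Nm_apply]
  exact (mul_right_cancel h2).symm

lemma sigma_Nm {n : ℕ} (hn : ∀ x, σ^[n] x = x) (x : A) : σ (Nm σ n x) = Nm σ n x := by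
  conv_rhs => rw [← Nm_sigma σ hn]
  rw [Nm_apply, Nm_apply, map_prod]
  exact Finset.prod_congr rfl fun i _ => by
    rw [← Function.iterate_succ_apply, Function.iterate_succ_apply']

lemma Dl_Nm {n : ℕ} (hn : ∀ x, σ^[n] x = x) (x : A) : Dl σ (Nm σ n x) = 1 := by
  rw [Dl_apply, sigma_Nm σ hn, div_self']

lemma Nm_Dl {n : ℕ} (hn : ∀ x, σ^[n] x = x) (x : A) : Nm σ n (Dl σ x) = 1 := by
  rw [Dl_apply, map_div, Nm_sigma σ hn, div_self']

lemma stable_Dl {B : Subgroup A} (h : ∀ x ∈ B, σ x ∈ B) : B.map (Dl σ) ≤ B := by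
  rintro _ ⟨x, hx, rfl⟩
  exact B.div_mem (h x hx) hx

lemma stable_Nm {B : Subgroup A} (h : ∀ x ∈ B, σ x ∈ B) (n : ℕ) : B.map (Nm σ n) ≤ B := by
  rintro _ ⟨x, hx, rfl⟩
  rw [Nm_apply]
  refine B.prod_mem fun i hi => ?_
  clear hi
  induction i with
  | zero => exact hx
  | succ k ih => rw [Function.iterate_succ_apply']; exact h _ ih

variable {g : ℕ} [NeZero g] (w : ZMod g → A)

/-- the lattice hom -/
def phi : Multiplicative (ZMod g → ℤ) →* A where
  toFun a := ∏ i, w i ^ (a.toAdd i)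
  map_one' := by simp
  map_mul' a b := by simp [zpow_add, Finset.prod_mul_distrib]

lemma phi_apply (a : ZMod g → ℤ) : phi w (Multiplicative.ofAdd a) = ∏ i, w i ^ a i := rfl

lemma phi_single (i : ZMod g) : phi w (Multiplicative.ofAdd (Pi.single i 1)) = w i := by
  rw [phi_apply, Finset.prod_eq_single i]
  · simp
  · intro j _ hj; simp [hj]
  · simp

variable {σ w} (hw : ∀ i, σ (w i) = w (i + 1))
include hw

lemma sigma_phi (a : ZMod g → ℤ) :
    σ (phi w (Multiplicative.ofAdd a)) = phi w (Multiplicative.ofAdd fun i => a (i - 1)) := by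
  rw [phi_apply, phi_apply, map_prod]
  rw [← Equiv.prod_comp (Equiv.addRight (1 : ZMod g)) (fun i => w i ^ a (i - 1))]
  exact Finset.prod_congr rfl fun i _ => by simp [map_zpow, hw]

lemma stable_phi : ∀ x ∈ (phi w).range, σ x ∈ (phi w).range := by
  rintro _ ⟨a, rfl⟩
  exact ⟨_, (sigma_phi hw a.toAdd).symm⟩

lemma sigma_iter (i : ZMod g) (k : ℕ) : σ^[k] (w i) = w (i + k) := by
  induction k with
  | zero => simp
  | succ k ih => rw [Function.iterate_succ_apply', ih, hw]; push_cast; rw [add_assoc]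

omit hw in
lemma prod_range_zmod (i : ZMod g) : ∏ k ∈ Finset.range g, w (i + (k : ZMod g)) = ∏ j, w j := by
  refine Finset.prod_bij (fun k _ => i + (k : ZMod g)) (by simp) ?_ ?_ (by simp)
  · intro a ha b hb h
    have h' := add_left_cancel h
    rw [ZMod.natCast_eq_natCast_iff] at h'
    exact Nat.ModEq.eq_of_lt_of_lt h' (Finset.mem_range.mp ha) (Finset.mem_range.mp hb)
  · intro j _
    exact ⟨(j - i).val, Finset.mem_range.mpr (ZMod.val_lt _), by simp⟩

lemma Nm_w (d : ℕ) (i : ZMod g) : Nm σ (g * d) (w i) = (∏ j, w j) ^ d := by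
  rw [Nm_apply]
  simp_rw [sigma_iter hw]
  induction d with
  | zero => simp
  | succ d ih =>
    rw [Nat.mul_succ, Finset.prod_range_add, ih, pow_succ]
    congr 1
    have := prod_range_zmod (w := w) i
    simpa using this

lemma Nm_phi (d : ℕ) (a : ZMod g → ℤ) :
    Nm σ (g * d) (phi w (Multiplicative.ofAdd a)) = ((∏ j, w j) ^ d) ^ (∑ i, a i) := by
  rw [phi_apply, map_prod]
  simp_rw [map_zpow, Nm_w hw]
  rw [prod_zpow_sum]

omit [NeZero g] in
lemma w_mod_aux (B : Subgroup A) (hB : ∀ i, w (i + 1) / w i ∈ B) (k : ℕ) :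
    w k / w 0 ∈ B := by
  induction k with
  | zero => simp
  | succ k ih =>
    have := B.mul_mem (hB k) ih
    push_cast
    simpa using this

lemma phi_mem_of_sum_zero (a : ZMod g → ℤ) (ha : ∑ i, a i = 0) :
    phi w (Multiplicative.ofAdd a) ∈ (phi w).range.map (Dl σ) := by
  set B := (phi w).range.map (Dl σ)
  have hB : ∀ i, w (i + 1) / w i ∈ B := fun i => ⟨w i, ⟨_, phi_single w i⟩, by rw [Dl_apply, hw]⟩
  have h0 : ∀ i, w i / w 0 ∈ B := fun i => by
    have := w_mod_aux hw B hB i.val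
    rwa [ZMod.natCast_zmod_val] at this
  have : phi w (Multiplicative.ofAdd a) = ∏ i, (w i / w 0) ^ a i := by
    simp_rw [div_zpow]
    rw [Finset.prod_div_distrib, prod_zpow_sum, ha, zpow_zero, div_one, phi_apply]
  rw [this]
  exact B.prod_mem fun i _ => B.zpow_mem (h0 i) _

omit [NeZero g] hw in
lemma const_of_shift {a : ZMod g → ℤ} [NeZero g] (h : ∀ i, a (i - 1) = a i) (i : ZMod g) : a i = a 0 := by
  have : ∀ k : ℕ, a (k : ZMod g) = a 0 := by
    intro k
    induction k with
    | zero => simp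
    | succ k ih => rw [← ih, ← h]; congr 1; push_cast; ring
  rw [← this i.val, ZMod.natCast_zmod_val]

lemma hbE (hind : ∀ a : ZMod g → ℤ, phi w (Multiplicative.ofAdd a) = 1 → a = 0)
    (d : ℕ) (hd : d ≠ 0) :
    hb (Dl σ) (Nm σ (g * d)) (phi w).range = d ∧ hb (Nm σ (g * d)) (Dl σ) (phi w).range = 1 := by
  set W := ∏ j, w j with hW
  have hconst : ∀ c : ℤ, phi w (Multiplicative.ofAdd fun _ => c) = W ^ c := fun c => by
    rw [phi_apply, Finset.prod_zpow]
  have hWinj : ∀ c : ℤ, W ^ c = 1 → c = 0 := fun c hc => by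
    have := hind (fun _ => c) (by rw [hconst, hc])
    exact congrFun this 0
  constructor
  · unfold hb
    have h1 : (phi w).range ⊓ (Dl σ).ker = (zpowersHom A W).range := by
      apply le_antisymm
      · rintro _ ⟨⟨a, rfl⟩, hk⟩
        have hk' : Dl σ (phi w a) = 1 := hk
        rw [Dl_apply, ← ofAdd_toAdd a, sigma_phi hw, ← map_div, ← ofAdd_sub] at hk'
        have h2 := hind _ hk'
        have h3 := const_of_shift (a := a.toAdd) fun i => sub_eq_zero.mp (congrFun h2 i)
        refine ⟨Multiplicative.ofAdd (a.toAdd 0), ?_⟩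
        rw [zpowersHom_apply, toAdd_ofAdd, ← hconst]
        congr 1
        ext i
        exact (h3 i).symm
      · rintro _ ⟨c, rfl⟩
        rw [zpowersHom_apply, ← hconst]
        refine ⟨⟨_, rfl⟩, ?_⟩
        change Dl σ _ = 1
        rw [Dl_apply, sigma_phi hw, div_self']
    have h2 : (phi w).range.map (Nm σ (g * d)) =
        (AddSubgroup.toSubgroup (AddSubgroup.zmultiples (d : ℤ))).map (zpowersHom A W) := by
      apply le_antisymm
      · rintro _ ⟨_, ⟨a, rfl⟩, rfl⟩
        rw [← ofAdd_toAdd a, Nm_phi hw]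
        refine ⟨Multiplicative.ofAdd (d * ∑ i, a.toAdd i), ?_, ?_⟩
        · exact Int.mem_zmultiples_iff.mpr ⟨∑ i, a.toAdd i, rfl⟩
        · rw [zpowersHom_apply, toAdd_ofAdd, zpow_mul, zpow_natCast]
      · rintro _ ⟨c, hc, rfl⟩
        obtain ⟨k, hk⟩ := Int.mem_zmultiples_iff.mp (show c.toAdd ∈ AddSubgroup.zmultiples (d : ℤ) from hc)
        refine ⟨phi w (Multiplicative.ofAdd (Pi.single 0 k)), ⟨_, rfl⟩, ?_⟩
        rw [Nm_phi hw, zpowersHom_apply, Finset.sum_pi_single', if_pos (Finset.mem_univ _)]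
        rw [hk, zpow_mul, zpow_natCast]
    have hinj : Function.Injective (zpowersHom A W) := by
      rw [injective_iff_map_eq_one]
      intro c hc
      exact hWinj _ hc
    rw [h1, h2, MonoidHom.range_eq_map, relIndex_map_map_of_injective _ _ hinj, relIndex_top_right]
    have := Int.index_zmultiples (d : ℤ)
    simpa using this
  · unfold hb
    rw [relIndex_eq_one]
    rintro _ ⟨⟨a, rfl⟩, hk⟩
    have hk' : Nm σ (g * d) (phi w a) = 1 := hk
    rw [← ofAdd_toAdd a, Nm_phi hw, ← zpow_natCast, ← zpow_mul] at hk'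
    have := hWinj _ hk'
    rw [mul_eq_zero] at this
    exact phi_mem_of_sum_zero hw _ (this.resolve_left (by exact_mod_cast hd))

lemma hbF (hW : ∏ j, w j = 1)
    (hind : ∀ a : ZMod g → ℤ, phi w (Multiplicative.ofAdd a) = 1 → ∀ i, a i = a 0)
    (d : ℕ) :
    hb (Dl σ) (Nm σ (g * d)) (phi w).range = 1 ∧ hb (Nm σ (g * d)) (Dl σ) (phi w).range = g := by
  have hconst : ∀ c : ℤ, phi w (Multiplicative.ofAdd fun _ => c) = 1 := fun c => by
    rw [phi_apply, Finset.prod_zpow, hW, one_zpow]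
  have hg : (g : ℤ) ≠ 0 := by exact_mod_cast NeZero.ne g
  constructor
  · unfold hb
    rw [relIndex_eq_one]
    rintro _ ⟨⟨a, rfl⟩, hk⟩
    have hk' : Dl σ (phi w a) = 1 := hk
    rw [Dl_apply, ← ofAdd_toAdd a, sigma_phi hw, ← map_div, ← ofAdd_sub] at hk'
    have h2 := hind _ hk'
    set c := a.toAdd (0 - 1) - a.toAdd 0
    have h3 : ∀ i, a.toAdd (i - 1) - a.toAdd i = c := h2
    have h4 : ∑ i : ZMod g, (a.toAdd (i - 1) - a.toAdd i) = 0 := by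
      rw [Finset.sum_sub_distrib, sub_eq_zero]
      exact Equiv.sum_comp (Equiv.subRight (1 : ZMod g)) a.toAdd
    simp_rw [h3] at h4
    simp only [Finset.sum_const, Finset.card_univ, ZMod.card, nsmul_eq_mul, mul_eq_zero] at h4
    have hc := h4.resolve_left hg
    have h5 := const_of_shift (a := a.toAdd) fun i => sub_eq_zero.mp ((h3 i).trans hc)
    have : a = Multiplicative.ofAdd (fun _ => a.toAdd 0) := by
      apply Multiplicative.toAdd.injective
      ext i; exact h5 i
    rw [this, hconst]
    exact one_mem _
  · unfold hb
    have h1 : (phi w).range ⊓ (Nm σ (g * d)).ker = (phi w).range := by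
      rw [inf_eq_left]
      rintro _ ⟨a, rfl⟩
      rw [MonoidHom.mem_ker, ← ofAdd_toAdd a, Nm_phi hw, hW, one_pow, one_zpow]
    rw [h1, ← index_comap]
    let s : Multiplicative (ZMod g → ℤ) →* Multiplicative (ZMod g) :=
      AddMonoidHom.toMultiplicative ((Int.castAddHom (ZMod g)).comp
        { toFun := fun a : ZMod g → ℤ => ∑ i, a i
          map_zero' := by simp
          map_add' := fun a b => by simp [Finset.sum_add_distrib] })
    have hs : ∀ a : ZMod g → ℤ, s (Multiplicative.ofAdd a) = Multiplicative.ofAdd (((∑ i, a i : ℤ)) : ZMod g) :=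
      fun a => rfl
    have h2 : ((phi w).range.map (Dl σ)).comap (phi w) = s.ker := by
      ext a
      induction a using Multiplicative.rec with | _ a
      rw [mem_comap, MonoidHom.mem_ker, hs]
      constructor
      · rintro ⟨_, ⟨b, rfl⟩, h⟩
        rw [Dl_apply, ← ofAdd_toAdd b, sigma_phi hw, div_eq_iff_eq_mul, ← map_mul, ← ofAdd_add,
          ← div_eq_one, ← map_div, ← ofAdd_sub] at h
        have h6 := hind _ h
        obtain ⟨c, hc⟩ : ∃ c, c = ((fun i => Multiplicative.toAdd b (i - 1)) -
          (a + Multiplicative.toAdd b)) 0 := ⟨_, rfl⟩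
        rw [← hc] at h6
        replace h6 : ∀ i, b.toAdd (i - 1) - (a i + b.toAdd i) = c := h6
        have h7 : ∑ i : ZMod g, (b.toAdd (i - 1) - (a i + b.toAdd i)) = g * c := by
          rw [Finset.sum_congr rfl fun i _ => h6 i]; simp
        have h8 : ∑ i : ZMod g, b.toAdd (i - 1) = ∑ i, b.toAdd i :=
          Equiv.sum_comp (Equiv.subRight (1 : ZMod g)) b.toAdd
        rw [Finset.sum_sub_distrib, Finset.sum_add_distrib, h8] at h7
        have h9 : ∑ i, a i = g * (-c) := by linarith
        rw [h9]; simp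
      · intro h
        have h' : ((∑ i, a i : ℤ) : ZMod g) = 0 := h
        rw [ZMod.intCast_zmod_eq_zero_iff_dvd] at h'
        obtain ⟨c, hc⟩ := h'
        have := phi_mem_of_sum_zero hw (fun i => a i - c) (by
          rw [Finset.sum_sub_distrib, hc]; simp)
        have e : phi w (Multiplicative.ofAdd fun i => a i - c) = phi w (Multiplicative.ofAdd a) := by
          rw [show (fun i => a i - c) = a - fun _ => c from rfl, ofAdd_sub, map_div, hconst, div_one]
        rwa [e] at this
    rw [h2, index_ker]
    have h3 : s.range = ⊤ := by
      rw [MonoidHom.range_eq_top]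
      intro x
      obtain ⟨k, hk⟩ := ZMod.intCast_surjective x.toAdd
      refine ⟨Multiplicative.ofAdd (Pi.single 0 k), ?_⟩
      rw [hs, Finset.sum_pi_single', if_pos (Finset.mem_univ _), hk, ofAdd_toAdd]
    rw [h3, card_top]
    exact Nat.card_zmod g

end cyc
end MN

namespace MN
set_option linter.unusedSectionVars false
set_option linter.unusedSimpArgs false
open scoped TensorProduct
section normformula
variable (F K : Type*) [Field F] [Algebra ℚ F] [Field K] [Algebra ℚ K] [FiniteDimensional ℚ K]

/-- the action on the tensor product -/
noncomputable def act (τ : K ≃ₐ[ℚ] K) : (F ⊗[ℚ] K) ≃ₐ[F] (F ⊗[ℚ] K) :=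
  Algebra.TensorProduct.congr AlgEquiv.refl τ

variable {F K}
lemma act_tmul (τ : K ≃ₐ[ℚ] K) (a : F) (b : K) : act F K τ (a ⊗ₜ b) = a ⊗ₜ τ b := by
  simp [act]

variable [IsGalois ℚ K]

open MvPolynomial in
lemma norm_tensor (x : F ⊗[ℚ] K) :
    algebraMap F (F ⊗[ℚ] K) (Algebra.norm F x) = ∏ τ : K ≃ₐ[ℚ] K, act F K τ x := by
  classical
  let b := Module.finBasis ℚ K
  let B := Algebra.TensorProduct.basis F b
  let P1 : MvPolynomial (Fin (Module.finrank ℚ K)) K :=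
    (∑ i, (X i : MvPolynomial _ K) • (Algebra.leftMulMatrix b (b i)).map
      (fun q => C (algebraMap ℚ K q))).det
  let P2 : MvPolynomial (Fin (Module.finrank ℚ K)) K :=
    ∏ τ : K ≃ₐ[ℚ] K, ∑ i, C (τ (b i)) * X i
  have hP : P1 = P2 := by
    refine MvPolynomial.funext_set (fun _ => Set.range (algebraMap ℚ K))
      (fun _ => Set.infinite_range_of_injective (algebraMap ℚ K).injective) fun y hy => ?_
    choose c hc using fun i => hy i (Set.mem_univ i)
    have e1 : eval y P1 = algebraMap ℚ K (Algebra.norm ℚ (∑ i, c i • b i)) := by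
      rw [Algebra.norm_eq_matrix_det b, map_sum, RingHom.map_det, RingHom.map_det]
      congr 1
      ext j k
      simp [Matrix.sum_apply, ← hc]
      exact Finset.sum_congr rfl fun i _ => by
        haveI := algebraRat.charZero K
        push_cast; rfl
    have e2 : eval y P2 = ∏ τ : K ≃ₐ[ℚ] K, τ (∑ i, c i • b i) := by
      simp only [P2, map_prod, map_sum, map_mul, eval_C, eval_X, map_smul, ← hc]
      refine Finset.prod_congr rfl fun τ _ => Finset.sum_congr rfl fun i _ => ?_
      rw [Algebra.smul_def, mul_comm]
    rw [e1, e2, Algebra.norm_eq_prod_automorphisms]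
  let c := B.repr x
  have hx : x = ∑ i, c i ⊗ₜ b i := by
    conv_lhs => rw [← B.sum_repr x]
    refine Finset.sum_congr rfl fun i _ => ?_
    simp [B, c, TensorProduct.smul_tmul']
  let ψ : MvPolynomial (Fin (Module.finrank ℚ K)) K →+* F ⊗[ℚ] K :=
    eval₂Hom (Algebra.TensorProduct.includeRight : K →ₐ[ℚ] F ⊗[ℚ] K).toRingHom
      (fun i => algebraMap F (F ⊗[ℚ] K) (c i))
  have e1 : ψ P1 = algebraMap F (F ⊗[ℚ] K) (Algebra.norm F x) := by
    rw [Algebra.norm_eq_matrix_det B, RingHom.map_det, RingHom.map_det]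
    congr 1
    have hL : Algebra.leftMulMatrix B x =
        ∑ i, c i • (Algebra.leftMulMatrix b (b i)).map (algebraMap ℚ F) := by
      have : x = ∑ i, c i • ((1 : F) ⊗ₜ b i : F ⊗[ℚ] K) := by
        rw [hx]; exact Finset.sum_congr rfl fun i _ => by simp [TensorProduct.smul_tmul']
      rw [this, map_sum]
      refine Finset.sum_congr rfl fun i _ => ?_
      rw [map_smul]
      congr 1
      ext j k
      rw [Algebra.leftMulMatrix_eq_repr_mul, Matrix.map_apply, Algebra.leftMulMatrix_eq_repr_mul]
      simp [B, Algebra.TensorProduct.basis_repr_tmul, Algebra.smul_def]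
    rw [hL]
    ext j k
    simp [Matrix.sum_apply, ψ]
    refine Finset.sum_congr rfl fun i _ => ?_
    generalize (Algebra.leftMulMatrix b) (b i) j k = q
    rw [show (q : K) = q • (1 : K) by rw [Algebra.smul_def, mul_one, eq_ratCast],
      ← TensorProduct.smul_tmul, Algebra.smul_def, mul_comm, eq_ratCast]
  have e2 : ψ P2 = ∏ τ : K ≃ₐ[ℚ] K, act F K τ x := by
    simp only [P2, map_prod, map_sum, map_mul, ψ]
    refine Finset.prod_congr rfl fun τ _ => ?_
    rw [hx, map_sum]
    refine Finset.sum_congr rfl fun i _ => ?_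
    rw [act_tmul]
    simp [Algebra.TensorProduct.algebraMap_apply]
  rw [← e1, ← e2, hP]

/-- product over a cyclic group -/
lemma prod_cyc {G M : Type*} [Group G] [Fintype G] [CommMonoid M] {s : G}
    (hs : ∀ x, x ∈ Subgroup.zpowers s) (φ : G → M) :
    ∏ t, φ t = ∏ i ∈ Finset.range (Fintype.card G), φ (s ^ i) := by
  classical
  rw [← IsCyclic.image_range_card (a := s) (by simpa [Subgroup.eq_top_iff'] using hs), Finset.prod_image]
  · simp
  · intro i hi j hj h
    have : orderOf s = Fintype.card G := by
      rw [← Nat.card_eq_fintype_card]; exact orderOf_eq_card_of_forall_mem_zpowers hs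
    simp only [Finset.coe_range, Set.mem_Iio, Nat.card_eq_fintype_card] at hi hj
    exact pow_injOn_Iio_orderOf (by simpa [this] using hi) (by simpa [this] using hj) h

variable (F) in
/-- action on units -/
noncomputable def uact (τ : K ≃ₐ[ℚ] K) : (F ⊗[ℚ] K)ˣ →* (F ⊗[ℚ] K)ˣ :=
  Units.map (act F K τ : (F ⊗[ℚ] K) →* (F ⊗[ℚ] K))

lemma uact_iter (τ : K ≃ₐ[ℚ] K) (i : ℕ) (x : (F ⊗[ℚ] K)ˣ) :
    (((uact F τ)^[i] x : (F ⊗[ℚ] K)ˣ) : F ⊗[ℚ] K) = act F K (τ ^ i) x := by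
  induction i with
  | zero =>
    simp only [Function.iterate_zero, id, pow_zero]
    induction (x : F ⊗[ℚ] K) using TensorProduct.induction_on with
    | zero => simp
    | tmul a b => simp [act_tmul]
    | add a b ha hb => rw [map_add, ← ha, ← hb]
  | succ i ih =>
    rw [Function.iterate_succ_apply']
    change act F K τ (((uact F τ)^[i] x : (F ⊗[ℚ] K)ˣ) : F ⊗[ℚ] K) = _
    rw [ih]
    induction (x : F ⊗[ℚ] K) using TensorProduct.induction_on with
    | zero => simp
    | tmul a b => simp [act_tmul, pow_succ']
    | add a b ha hb => rw [map_add, map_add, map_add, ha, hb]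

/-- iterating the generator -/
lemma uact_n {τ : K ≃ₐ[ℚ] K} {n : ℕ} (hn : τ ^ n = 1) (x : (F ⊗[ℚ] K)ˣ) :
    (uact F τ)^[n] x = x := by
  apply Units.ext
  rw [uact_iter, hn, ← pow_zero τ, ← uact_iter]
  rfl

lemma Nm_uact {τ : K ≃ₐ[ℚ] K} (hs : ∀ x, x ∈ Subgroup.zpowers τ) {n : ℕ}
    (hn : n = Module.finrank ℚ K) (x : (F ⊗[ℚ] K)ˣ) :
    ((Nm (uact F τ) n x : (F ⊗[ℚ] K)ˣ) : F ⊗[ℚ] K) =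
      algebraMap F (F ⊗[ℚ] K) (Algebra.norm F (x : F ⊗[ℚ] K)) := by
  rw [norm_tensor, prod_cyc hs, Nm_apply, Units.coe_prod, hn, ← IsGalois.card_aut_eq_finrank ℚ K,
    Nat.card_eq_fintype_card]
  exact Finset.prod_congr rfl fun i _ => uact_iter _ _ _

end normformula
end MN

namespace MN
set_option linter.unusedSectionVars false
set_option linter.unusedSimpArgs false

/-- successive approximation -/
lemma approx {A : Type*} [CommGroup A] (V : ℕ → Subgroup A)
    (hcomp : ∀ y : ℕ → A, y 0 ∈ V 0 → (∀ m, y (m + 1) / y m ∈ V m) →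
      ∃ z ∈ V 0, ∀ m, z / y m ∈ V m)
    (hsep : ∀ x, (∀ m, x ∈ V m) → x = 1) (D D' : A →* A) (hDD : ∀ x, D (D' x) = 1)
    (hD' : ∀ m, ∀ x ∈ V m, D' x ∈ V m)
    (step : ∀ m, ∀ u ∈ V m, D u = 1 → ∃ y ∈ V m, u / D' y ∈ V (m + 1))
    (u : A) (hu : u ∈ V 0) (hDu : D u = 1) : ∃ y ∈ V 0, D' y = u := by
  choose! s hs1 hs2 using step
  let Y : ℕ → A := fun m => Nat.rec 1 (fun m y => y * s m (u / D' y)) m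
  have hY : ∀ m, Y (m + 1) = Y m * s m (u / D' (Y m)) := fun m => rfl
  have hD1 : ∀ y, D (u / D' y) = 1 := fun y => by rw [map_div, hDu, hDD, div_one]
  have key : ∀ m, u / D' (Y m) ∈ V m := by
    intro m
    induction m with
    | zero => simpa [Y] using hu
    | succ m ih =>
      have := hs2 m _ ih (hD1 _)
      rwa [div_div, ← map_mul, ← hY] at this
  obtain ⟨z, hz, hz'⟩ := hcomp Y (one_mem _) fun m => by
    rw [hY, mul_div_cancel_left]; exact hs1 m _ (key m) (hD1 _)
  refine ⟨z, hz, ?_⟩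
  have : D' z / u = 1 := by
    apply hsep
    intro m
    have h1 := (V m).div_mem (hD' m _ (hz' m)) (key m)
    rwa [map_div, div_div_div_cancel_right] at h1
  exact div_eq_one.mp this

/-- an abstract complete ultrametric ring -/
structure UN {T : Type*} [CommRing T] (ν : T → ℝ) (C : ℝ) : Prop where
  nonneg : ∀ x : T, 0 ≤ ν x
  eq_zero : ∀ x : T, ν x = 0 → x = 0
  zero : ν 0 = 0
  add : ∀ x y : T, ν (x + y) ≤ max (ν x) (ν y)
  neg : ∀ x : T, ν (-x) = ν x
  mul : ∀ x y : T, ν (x * y) ≤ C * ν x * ν y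
  one_le : 1 ≤ C
  unit : ∀ x : T, (∀ y : T, x * y = 0 → y = 0) → IsUnit x
  complete : ∀ (y : ℕ → T) (r : ℝ), (∀ m, ν (y (m + 1) - y m) ≤ r / 2 ^ m) →
    ∃ z, ∀ m, ν (z - y m) ≤ r / 2 ^ m

namespace UN
variable {T : Type*} [CommRing T] {ν : T → ℝ} {C : ℝ} (h : UN ν C)
include h

lemma add_le {x y : T} {r : ℝ} (hx : ν x ≤ r) (hy : ν y ≤ r) : ν (x + y) ≤ r :=
  (h.add x y).trans (max_le hx hy)

lemma sub_le {x y : T} {r : ℝ} (hx : ν x ≤ r) (hy : ν y ≤ r) : ν (x - y) ≤ r := by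
  rw [sub_eq_add_neg]; exact h.add_le hx (by rwa [h.neg])

lemma sum_le {ι : Type*} (s : Finset ι) {x : ι → T} {r : ℝ} (hr : 0 ≤ r)
    (hx : ∀ i ∈ s, ν (x i) ≤ r) : ν (∑ i ∈ s, x i) ≤ r := by
  classical
  induction s using Finset.induction_on with
  | empty => simpa [h.zero] using hr
  | insert i s hi ih =>
    rw [Finset.sum_insert hi]
    exact h.add_le (hx i (Finset.mem_insert_self _ _))
      (ih fun j hj => hx j (Finset.mem_insert_of_mem hj))

lemma mul_le {x y : T} {a b : ℝ} (hx : ν x ≤ a) (hy : ν y ≤ b) : ν (x * y) ≤ C * a * b := by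
  have hC := h.one_le
  have h1 := h.nonneg x
  have h2 := h.nonneg y
  refine (h.mul x y).trans ?_
  have : 0 ≤ C := by linarith
  have ha : 0 ≤ a := h1.trans hx
  gcongr

lemma mul_half {x y : T} {a b : ℝ} (hx : ν x ≤ a) (hy : ν y ≤ b) (ha : C * a ≤ 1 / 2) :
    ν (x * y) ≤ b / 2 := by
  have h2 := (h.nonneg y).trans hy
  refine (h.mul_le hx hy).trans ?_
  nlinarith

lemma mul_one_add {x y : T} {a b : ℝ} (hx : ν (x - 1) ≤ a) (hy : ν y ≤ b) (ha : C * a ≤ 1 / 2) :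
    ν (x * y) ≤ b := by
  have h2 := (h.nonneg y).trans hy
  have : x * y = y + (x - 1) * y := by ring
  rw [this]
  exact h.add_le hy ((h.mul_half hx hy ha).trans (by linarith))

lemma isUnit {x : T} {a : ℝ} (hx : ν (x - 1) ≤ a) (ha : C * a ≤ 1 / 2) : IsUnit x := by
  refine h.unit x fun y hy => h.eq_zero y ?_
  have : y = - ((x - 1) * y) := by linear_combination hy
  have h1 := h.mul_half hx le_rfl ha (y := y)
  rw [this, h.neg] at *
  have := h.nonneg ((x - 1) * -((x - 1) * y))
  have := h.nonneg ((x - 1) * y)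
  have e : (x - 1) * -((x - 1) * y) = (x - 1) * y := by
    linear_combination (- (x - 1)) * hy
  rw [e] at h1
  linarith

/-- unit groups -/
def V (ρ : ℝ) (h0 : 0 ≤ ρ) (hρ : C * ρ ≤ 1 / 2) : Subgroup Tˣ where
  carrier := {u | ν ((u : T) - 1) ≤ ρ}
  one_mem' := by simpa [h.zero] using h0
  mul_mem' {a b} ha hb := by
    change ν ((a * b : Tˣ) - 1 : T) ≤ ρ
    have e : ((a * b : Tˣ) - 1 : T) = a * ((b : T) - 1) + ((a : T) - 1) := by push_cast; ring
    rw [e]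
    exact h.add_le (h.mul_one_add ha hb hρ) ha
  inv_mem' {u} hu := by
    change ν ((u⁻¹ : Tˣ) - 1 : T) ≤ ρ
    have hu' : ν ((u : T) - 1) ≤ ρ := hu
    have e : ((u⁻¹ : Tˣ) - 1 : T) = -(((u : T) - 1) + ((u : T) - 1) * ((u⁻¹ : Tˣ) - 1 : T)) := by
      have : (u : T) * (u⁻¹ : Tˣ) = 1 := by simp
      linear_combination this
    have h1 := h.mul_half hu' (le_refl (ν ((u⁻¹ : Tˣ) - 1 : T))) hρ
    have h2 := h.add ((u : T) - 1) (((u : T) - 1) * ((u⁻¹ : Tˣ) - 1 : T))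
    rw [← h.neg, ← e] at h2
    rcases le_max_iff.mp h2 with h3 | h3
    · exact h3.trans hu'
    · linarith

variable {ρ : ℝ} (h0 : 0 ≤ ρ) (hρ : C * ρ ≤ 1 / 2)

lemma mem_V {u : Tˣ} : u ∈ h.V ρ h0 hρ ↔ ν ((u : T) - 1) ≤ ρ := Iff.rfl

lemma div_mem_V {u v : Tˣ} (hv : v ∈ h.V ρ h0 hρ) {b : ℝ} :
    ν ((u / v : Tˣ) - 1 : T) ≤ b ↔ ν ((u : T) - v) ≤ b := by
  have e1 : (u : T) - v = v * ((u / v : Tˣ) - 1 : T) := by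
    rw [div_eq_mul_inv, Units.val_mul, mul_sub, mul_comm (u : T), Units.mul_inv_cancel_left, mul_one]
  have e2 : ((u / v : Tˣ) - 1 : T) = (v⁻¹ : Tˣ) * ((u : T) - v) := by
    rw [e1, Units.inv_mul_cancel_left]
  constructor
  · intro hh; rw [e1]; exact h.mul_one_add hv hh hρ
  · intro hh; rw [e2]; exact h.mul_one_add ((h.V ρ h0 hρ).inv_mem hv) hh hρ

lemma half_ok (hρ : C * ρ ≤ 1 / 2) (h0 : 0 ≤ ρ) (m : ℕ) : C * (ρ / 2 ^ m) ≤ 1 / 2 := by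
  have hC := h.one_le
  have : ρ / 2 ^ m ≤ ρ := div_le_self h0 (one_le_pow₀ (by norm_num))
  nlinarith

/-- filtration -/
noncomputable def Vm (m : ℕ) : Subgroup Tˣ := h.V (ρ / 2 ^ m) (by positivity) (h.half_ok hρ h0 m)

lemma mem_Vm {m : ℕ} {u : Tˣ} : u ∈ h.Vm h0 hρ m ↔ ν ((u : T) - 1) ≤ ρ / 2 ^ m := Iff.rfl

lemma Vm_zero : h.Vm h0 hρ 0 = h.V ρ h0 hρ := by
  ext u; simp [mem_Vm, mem_V]

include h0 hρ in
lemma prod_one_add (s : ℕ) (x : ℕ → T) (hx : ∀ i, ν (x i) ≤ ρ) :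
    ν (∏ i ∈ Finset.range s, (1 + x i) - 1 - ∑ i ∈ Finset.range s, x i) ≤ ρ / 2 := by
  induction s with
  | zero => simpa [h.zero] using by linarith
  | succ s ih =>
    set P := ∏ i ∈ Finset.range s, (1 + x i)
    set S := ∑ i ∈ Finset.range s, x i
    have hS : ν S ≤ ρ := h.sum_le _ h0 fun i _ => hx i
    have e : ∏ i ∈ Finset.range (s + 1), (1 + x i) - 1 - ∑ i ∈ Finset.range (s + 1), x i
        = (P - 1 - S) + (S * x s + x s * (P - 1 - S)) := by
      rw [Finset.prod_range_succ, Finset.sum_range_succ]; ring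
    rw [e]
    refine h.add_le ih (h.add_le (h.mul_half hS (hx s) hρ) ?_)
    exact (h.mul_half (hx s) ih hρ).trans (by linarith)

variable (s : T ≃+* T) (hs : ∀ x, ν (s x) = ν x) (n : ℕ) (hn : ∀ x, s^[n] x = x)
  (hA : ∀ (x : T) (r : ℝ), ν x ≤ r → ∃ y z, x = s y - y + z ∧ ν y ≤ r ∧
    ν z ≤ ν (∑ i ∈ Finset.range n, s^[i] x))
  (hB : ∀ (x : T) (r : ℝ), ν x ≤ r → s x = x → ∃ y, ν y ≤ r ∧ ∑ i ∈ Finset.range n, s^[i] y = x)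

/-- units action -/
def us : Tˣ →* Tˣ := Units.map (s : T →* T)

omit h in
lemma us_val (u : Tˣ) : ((us s u : Tˣ) : T) = s u := rfl

omit h in
lemma us_iter (i : ℕ) (u : Tˣ) : (((us s)^[i] u : Tˣ) : T) = s^[i] u := by
  induction i with
  | zero => rfl
  | succ i ih => rw [Function.iterate_succ_apply', Function.iterate_succ_apply', us_val, ih]

include hs in
lemma stabV : ∀ x ∈ h.V ρ h0 hρ, us s x ∈ h.V ρ h0 hρ := by
  intro x hx
  rw [mem_V] at *
  rw [us_val, ← map_one s, ← map_sub, hs]; exact hx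

include hs in
lemma iter_nu (i : ℕ) (x : T) : ν (s^[i] x) = ν x := by
  induction i with
  | zero => rfl
  | succ i ih => rw [Function.iterate_succ_apply', hs, ih]

include hs in
lemma Nm_approx (u : Tˣ) (hu : u ∈ h.V ρ h0 hρ) :
    ν ((Nm (us s) n u : Tˣ) - 1 - ∑ i ∈ Finset.range n, s^[i] ((u : T) - 1)) ≤ ρ / 2 := by
  have := h.prod_one_add h0 hρ n (fun i => s^[i] ((u : T) - 1))
    (fun i => by rw [h.iter_nu s hs]; exact hu)
  convert this using 4
  rw [Nm_apply, Units.coe_prod]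
  refine Finset.prod_congr rfl fun i _ => ?_
  rw [us_iter, iterate_map_sub, iterate_map_one]; ring

include hs hA in
lemma stepA (u : Tˣ) (hu : u ∈ h.V ρ h0 hρ) (hN : Nm (us s) n u = 1) :
    ∃ y ∈ h.V ρ h0 hρ, ν ((u / Dl (us s) y : Tˣ) - 1 : T) ≤ ρ / 2 := by
  have h1 := h.Nm_approx h0 hρ s hs n u hu
  rw [hN, Units.val_one, sub_self, zero_sub, h.neg] at h1
  obtain ⟨y, z, hx, hy, hz⟩ := hA _ ρ ((h.mem_V h0 hρ).mp hu)
  obtain ⟨v, hv⟩ := h.isUnit (x := 1 + y) (a := ρ) (by simpa using hy) hρ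
  have hvV : v ∈ h.V ρ h0 hρ := by rw [mem_V, hv]; simpa using hy
  have hD : Dl (us s) v ∈ h.V ρ h0 hρ := (h.V ρ h0 hρ).div_mem (h.stabV h0 hρ s hs v hvV) hvV
  refine ⟨v, hvV, (h.div_mem_V h0 hρ hD).mpr ?_⟩
  have e : (Dl (us s) v : T) = 1 + (v⁻¹ : Tˣ) * (s y - y) := by
    rw [Dl_apply, div_eq_mul_inv, Units.val_mul, us_val, hv, map_add, map_one]
    have : (v : T) * (v⁻¹ : Tˣ) = 1 := by simp
    rw [hv] at this
    linear_combination this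
  have e2 : (u : T) - Dl (us s) v = z - ((v⁻¹ : Tˣ) - 1 : T) * (s y - y) := by
    rw [e]; linear_combination hx
  rw [e2]
  refine h.sub_le (hz.trans h1) (h.mul_half ((h.V ρ h0 hρ).inv_mem hvV) (h.sub_le ?_ hy) hρ)
  rwa [hs]

include hs hB in
lemma stepB (u : Tˣ) (hu : u ∈ h.V ρ h0 hρ) (hN : Dl (us s) u = 1) :
    ∃ y ∈ h.V ρ h0 hρ, ν ((u / Nm (us s) n y : Tˣ) - 1 : T) ≤ ρ / 2 := by
  have hsu : s u = u := by
    rw [Dl_apply, div_eq_one] at hN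
    exact congrArg Units.val hN
  obtain ⟨y, hy, hyx⟩ := hB _ ρ ((h.mem_V h0 hρ).mp hu) (by rw [map_sub, hsu, map_one])
  obtain ⟨v, hv⟩ := h.isUnit (x := 1 + y) (a := ρ) (by simpa using hy) hρ
  have hvV : v ∈ h.V ρ h0 hρ := by rw [mem_V, hv]; simpa using hy
  have hD : Nm (us s) n v ∈ h.V ρ h0 hρ :=
    stable_Nm (us s) (h.stabV h0 hρ s hs) n ⟨v, hvV, rfl⟩
  refine ⟨v, hvV, (h.div_mem_V h0 hρ hD).mpr ?_⟩
  have h1 := h.Nm_approx h0 hρ s hs n v hvV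
  rw [hv, add_sub_cancel_left, hyx] at h1
  rw [← h.neg]
  convert h1 using 2
  ring

lemma complV (y : ℕ → Tˣ) (hy0 : y 0 ∈ h.Vm h0 hρ 0) (hy : ∀ m, y (m + 1) / y m ∈ h.Vm h0 hρ m) :
    ∃ z ∈ h.Vm h0 hρ 0, ∀ m, z / y m ∈ h.Vm h0 hρ m := by
  have hanti : ∀ m, h.Vm h0 hρ m ≤ h.V ρ h0 hρ := fun m u hu =>
    ((h.mem_Vm h0 hρ).mp hu).trans (div_le_self h0 (one_le_pow₀ (by norm_num)))
  have hyV : ∀ m, y m ∈ h.V ρ h0 hρ := by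
    intro m
    induction m with
    | zero => rwa [Vm_zero] at hy0
    | succ m ih =>
      have := (h.V ρ h0 hρ).mul_mem (hanti m (hy m)) ih
      rwa [div_mul_cancel] at this
  obtain ⟨z, hz⟩ := h.complete (fun m => (y m : T)) ρ fun m =>
    (h.div_mem_V h0 hρ (hyV m)).mp (hy m)
  have hz1 : ν (z - 1) ≤ ρ := by
    have : z - 1 = (z - y 0) + ((y 0 : T) - 1) := by ring
    rw [this]
    refine h.add_le ((hz 0).trans (by simp)) (hyV 0)
  obtain ⟨v, rfl⟩ := h.isUnit hz1 hρ
  refine ⟨v, by rw [Vm_zero]; exact hz1, fun m => ?_⟩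
  exact (h.div_mem_V h0 hρ (hyV m)).mpr (hz m)

include hs hn hA hB in
lemma hbV : hb (Dl (us s)) (Nm (us s) n) (h.V ρ h0 hρ) = 1 ∧
    hb (Nm (us s) n) (Dl (us s)) (h.V ρ h0 hρ) = 1 := by
  have hn' : ∀ x, (us s)^[n] x = x := fun x => Units.ext (by rw [us_iter, hn])
  have hanti : ∀ m, h.Vm h0 hρ (m + 1) ≤ h.Vm h0 hρ m := fun m u hu => by
    refine ((h.mem_Vm h0 hρ).mp hu).trans ?_
    rw [pow_succ, ← div_div]
    exact div_le_self (by positivity) (by norm_num)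
  have hsep : ∀ x, (∀ m, x ∈ h.Vm h0 hρ m) → x = 1 := by
    intro x hx
    apply Units.ext
    rw [Units.val_one, ← sub_eq_zero]
    apply h.eq_zero
    apply le_antisymm _ (h.nonneg _)
    have : Filter.Tendsto (fun m : ℕ => ρ / 2 ^ m) Filter.atTop (nhds 0) := by
      have := (tendsto_pow_atTop_nhds_zero_of_lt_one (r := (1 / 2 : ℝ)) (by norm_num)
        (by norm_num)).const_mul ρ
      simpa [div_eq_mul_inv] using this
    exact ge_of_tendsto' this hx
  have eq2 : ∀ m : ℕ, ρ / 2 ^ (m + 1) = ρ / 2 ^ m / 2 := fun m => by rw [pow_succ, div_div]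
  constructor
  · unfold hb
    rw [Subgroup.relIndex_eq_one]
    rintro u ⟨hu, hD⟩
    rw [← Vm_zero] at *
    obtain ⟨y, hy, hy'⟩ := approx (h.Vm h0 hρ) (h.complV h0 hρ) hsep _ _
      (Dl_Nm (us s) hn')
      (fun m x hx => stable_Nm (us s) (h.stabV _ (h.half_ok hρ h0 m) s hs) n ⟨x, hx, rfl⟩)
      (fun m u hu hD => by
        obtain ⟨y, hy, hy'⟩ := h.stepB (ρ := ρ / 2 ^ m) _ (h.half_ok hρ h0 m) s hs n hB u hu hD
        exact ⟨y, hy, by rw [mem_Vm, eq2]; exact hy'⟩) u hu hD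
    exact ⟨y, hy, hy'⟩
  · unfold hb
    rw [Subgroup.relIndex_eq_one]
    rintro u ⟨hu, hD⟩
    rw [← Vm_zero] at *
    obtain ⟨y, hy, hy'⟩ := approx (h.Vm h0 hρ) (h.complV h0 hρ) hsep _ _
      (Nm_Dl (us s) hn')
      (fun m x hx => stable_Dl (us s) (h.stabV _ (h.half_ok hρ h0 m) s hs) ⟨x, hx, rfl⟩)
      (fun m u hu hD => by
        obtain ⟨y, hy, hy'⟩ := h.stepA (ρ := ρ / 2 ^ m) _ (h.half_ok hρ h0 m) s hs n hA u hu hD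
        exact ⟨y, hy, by rw [mem_Vm, eq2]; exact hy'⟩) u hu hD
    exact ⟨y, hy, hy'⟩

end UN
end MN

namespace MN
set_option linter.unusedSectionVars false
set_option linter.unusedSimpArgs false
open scoped TensorProduct

section loc
variable (K : Type) [Field K] [Algebra ℚ K] [FiniteDimensional ℚ K] [IsGalois ℚ K]
  (q : ℕ) [Fact q.Prime]

/-- base changed normal basis -/
noncomputable def bs : Module.Basis (K ≃ₐ[ℚ] K) ℚ_[q] (ℚ_[q] ⊗[ℚ] K) :=
  Algebra.TensorProduct.basis ℚ_[q] (IsGalois.normalBasis ℚ K)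

/-- sup norm -/
noncomputable def nu (x : ℚ_[q] ⊗[ℚ] K) : ℝ := ‖(bs K q).equivFun x‖

variable {K q}

lemma nu_le {x : ℚ_[q] ⊗[ℚ] K} {r : ℝ} (hr : 0 ≤ r) :
    nu K q x ≤ r ↔ ∀ i, ‖(bs K q).repr x i‖ ≤ r := by
  unfold nu
  rw [pi_norm_le_iff_of_nonneg hr]
  rfl

lemma nu_nonneg (x : ℚ_[q] ⊗[ℚ] K) : 0 ≤ nu K q x := norm_nonneg _

lemma nu_coord (x : ℚ_[q] ⊗[ℚ] K) (i) : ‖(bs K q).repr x i‖ ≤ nu K q x :=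
  (nu_le (norm_nonneg _)).mp le_rfl i

lemma nu_smul (c : ℚ_[q]) (x : ℚ_[q] ⊗[ℚ] K) : nu K q (c • x) = ‖c‖ * nu K q x := by
  unfold nu; rw [map_smul, norm_smul]

lemma act_bs (σ g : K ≃ₐ[ℚ] K) : act ℚ_[q] K σ (bs K q g) = bs K q (σ * g) := by
  unfold bs
  rw [Algebra.TensorProduct.basis_apply, Algebra.TensorProduct.basis_apply, act_tmul,
    IsGalois.normalBasis_apply, IsGalois.normalBasis_apply (σ * g)]
  rfl

lemma repr_act (σ g : K ≃ₐ[ℚ] K) (x : ℚ_[q] ⊗[ℚ] K) :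
    (bs K q).repr (act ℚ_[q] K σ x) (σ * g) = (bs K q).repr x g := by
  classical
  conv_lhs => rw [← (bs K q).sum_repr x]
  simp only [map_sum, map_smul, act_bs, Module.Basis.repr_self, Finsupp.coe_finsetSum, Finset.sum_apply,
    Finsupp.smul_apply, Finsupp.single_apply, mul_right_inj]
  simp

lemma nu_act (σ : K ≃ₐ[ℚ] K) (x : ℚ_[q] ⊗[ℚ] K) : nu K q (act ℚ_[q] K σ x) = nu K q x := by
  apply le_antisymm
  · rw [nu_le (nu_nonneg _)]
    intro g
    have := repr_act σ (σ⁻¹ * g) x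
    rw [mul_inv_cancel_left] at this
    rw [this]; exact nu_coord _ _
  · rw [nu_le (nu_nonneg _)]
    intro g
    rw [← repr_act σ]; exact nu_coord _ _

lemma nu_bs (g : K ≃ₐ[ℚ] K) : nu K q (bs K q g) = 1 := by
  classical
  apply le_antisymm
  · rw [nu_le zero_le_one]
    intro i
    rw [Module.Basis.repr_self, Finsupp.single_apply]
    split_ifs <;> simp
  · have := nu_coord (bs K q g) g
    simpa using this

variable (K q) in
lemma exists_UN : ∃ C, UN (nu K q) C := by
  classical
  have hadd : ∀ x y : ℚ_[q] ⊗[ℚ] K, nu K q (x + y) ≤ max (nu K q x) (nu K q y) := by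
    intro x y
    rw [nu_le (le_max_of_le_left (nu_nonneg _))]
    intro i
    rw [map_add, Finsupp.add_apply]
    exact (Padic.nonarchimedean _ _).trans (max_le_max (nu_coord _ _) (nu_coord _ _))
  refine ⟨1 + ∑ i, ∑ j, nu K q (bs K q i * bs K q j), fun x => norm_nonneg _, ?_, ?_, hadd, ?_, ?_, ?_, ?_, ?_⟩
  · intro x hx
    simpa [nu] using hx
  · simp [nu]
  · intro x; simp [nu]
  · intro x y
    have e : x * y = ∑ i, ∑ j, ((bs K q).repr x i * (bs K q).repr y j) • (bs K q i * bs K q j) := by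
      conv_lhs => rw [← (bs K q).sum_repr x, ← (bs K q).sum_repr y]
      rw [Finset.sum_mul_sum]
      refine Finset.sum_congr rfl fun i _ => Finset.sum_congr rfl fun j _ => ?_
      rw [smul_mul_smul_comm]
    have h1 : nu K q (x * y) ≤ ∑ i, ∑ j, nu K q (((bs K q).repr x i * (bs K q).repr y j) • (bs K q i * bs K q j)) := by
      rw [e]
      unfold nu
      rw [map_sum]
      refine (norm_sum_le _ _).trans (Finset.sum_le_sum fun i _ => ?_)
      rw [map_sum]
      exact norm_sum_le _ _
    have h2 : nu K q (x * y) ≤ ∑ i, ∑ j, (nu K q x * nu K q y) * nu K q (bs K q i * bs K q j) := by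
      refine h1.trans (Finset.sum_le_sum fun i _ => Finset.sum_le_sum fun j _ => ?_)
      rw [nu_smul, norm_mul]
      exact mul_le_mul_of_nonneg_right (mul_le_mul (nu_coord _ _) (nu_coord _ _) (norm_nonneg _)
        (norm_nonneg _)) (norm_nonneg _)
    simp only [← Finset.mul_sum] at h2
    have hx : 0 ≤ nu K q x := norm_nonneg _
    have hy : 0 ≤ nu K q y := norm_nonneg _
    nlinarith [mul_nonneg hx hy]
  · have : 0 ≤ ∑ i, ∑ j, nu K q (bs K q i * bs K q j) :=
      Finset.sum_nonneg fun i _ => Finset.sum_nonneg fun j _ => norm_nonneg _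
    linarith
  · intro x hx
    have hinj : Function.Injective (LinearMap.mulLeft ℚ_[q] x) := by
      rw [injective_iff_map_eq_zero]
      exact hx
    have : FiniteDimensional ℚ_[q] (ℚ_[q] ⊗[ℚ] K) := (bs K q).finiteDimensional_of_finite
    obtain ⟨y, hy⟩ := LinearMap.surjective_of_injective hinj 1
    exact IsUnit.of_mul_eq_one y hy
  · intro y r hy
    have hr : 0 ≤ r := by simpa using (norm_nonneg _).trans (hy 0)
    have hsub : ∀ a b, nu K q (a - b) = dist ((bs K q).equivFun a) ((bs K q).equivFun b) := by
      intro a b; rw [dist_eq_norm, ← map_sub]; rfl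
    have hc : CauchySeq fun m => (bs K q).equivFun (y m) := by
      refine cauchySeq_of_le_geometric (1/2) r (by norm_num) fun m => ?_
      rw [dist_comm, ← hsub]
      refine (hy m).trans (le_of_eq ?_)
      rw [one_div, inv_pow]; rfl
    obtain ⟨z, hz⟩ := cauchySeq_tendsto_of_complete hc
    refine ⟨(bs K q).equivFun.symm z, fun m => ?_⟩
    have hk : ∀ k, nu K q (y (m + k) - y m) ≤ r / 2 ^ m := by
      intro k
      induction k with
      | zero => simp [nu]; positivity
      | succ k ih =>
        have : y (m + (k + 1)) - y m = (y (m + k + 1) - y (m + k)) + (y (m + k) - y m) := by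
          rw [← add_assoc]; ring
        rw [this]
        refine (hadd _ _).trans (max_le ((hy (m + k)).trans ?_) ih)
        gcongr
        · norm_num
        · omega
    rw [hsub, LinearEquiv.apply_symm_apply]
    have ht : Filter.Tendsto (fun k => dist ((bs K q).equivFun (y (m + k))) ((bs K q).equivFun (y m)))
        Filter.atTop (nhds (dist z ((bs K q).equivFun (y m)))) := by
      refine Filter.Tendsto.dist ?_ tendsto_const_nhds
      have := hz.comp (Filter.tendsto_add_atTop_nat m)
      simpa [Function.comp_def, add_comm] using this
    exact le_of_tendsto' ht fun k => by rw [← hsub]; exact hk k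

lemma act_iter (σ : K ≃ₐ[ℚ] K) (i : ℕ) (x : ℚ_[q] ⊗[ℚ] K) :
    (act ℚ_[q] K σ).toRingEquiv^[i] x = act ℚ_[q] K (σ ^ i) x := by
  induction i with
  | zero =>
    have : (act ℚ_[q] K (1 : K ≃ₐ[ℚ] K)) x = x := by
      induction x with
      | zero => simp
      | tmul a b => simp [act_tmul]
      | add a b ha hb => rw [map_add, ha, hb]
    simp [this]
  | succ i ih =>
    rw [Function.iterate_succ_apply', ih]
    change act ℚ_[q] K σ _ = _
    clear ih
    induction x with
    | zero => simp
    | tmul a b => simp [act_tmul, pow_succ']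
    | add a b ha hb => rw [map_add, map_add, ha, hb, map_add]

lemma sum_cyc {G M : Type*} [Group G] [Fintype G] [AddCommMonoid M] {s : G}
    (hs : ∀ x, x ∈ Subgroup.zpowers s) (φ : G → M) :
    ∑ t, φ t = ∑ i ∈ Finset.range (Fintype.card G), φ (s ^ i) :=
  prod_cyc (M := Multiplicative M) hs φ

variable {σ : K ≃ₐ[ℚ] K} (hσ : ∀ x, x ∈ Subgroup.zpowers σ)
include hσ

lemma fix_bs {x : ℚ_[q] ⊗[ℚ] K} (hx : act ℚ_[q] K σ x = x) :
    x = (bs K q).repr x 1 • ∑ g, bs K q g := by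
  have h1 : ∀ g, (bs K q).repr x (σ * g) = (bs K q).repr x g := fun g => by
    conv_lhs => rw [← hx]
    exact repr_act _ _ _
  have h2 : ∀ i : ℕ, (bs K q).repr x (σ ^ i) = (bs K q).repr x 1 := fun i => by
    induction i with
    | zero => simp
    | succ i ih => rw [pow_succ', h1, ih]
  have h3 : ∀ g, (bs K q).repr x g = (bs K q).repr x 1 := fun g => by
    obtain ⟨k, rfl⟩ := (mem_powers_iff_mem_zpowers (x := σ)).mpr (hσ g)
    exact h2 k
  conv_lhs => rw [← (bs K q).sum_repr x]
  rw [Finset.smul_sum]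
  exact Finset.sum_congr rfl fun g _ => by rw [h3]

lemma fix_alg {x : ℚ_[q] ⊗[ℚ] K} (hx : act ℚ_[q] K σ x = x) : ∃ c : ℚ_[q], x = algebraMap _ _ c := by
  have h1 := fix_bs hσ hx
  have h2 := fix_bs (q := q) (K := K) hσ (x := 1) (map_one _)
  set c1 := (bs K q).repr 1 1
  set c := (bs K q).repr x 1
  have hc1 : c1 ≠ 0 := by
    intro h0
    rw [h0, zero_smul] at h2
    exact one_ne_zero h2
  refine ⟨c / c1, ?_⟩
  rw [Algebra.algebraMap_eq_smul_one, h2, smul_smul, div_mul_cancel₀ _ hc1, ← h1]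

variable {n : ℕ} (hn : n = Module.finrank ℚ K)
include hn

lemma card_n : Fintype.card (K ≃ₐ[ℚ] K) = n := by
  rw [hn, ← IsGalois.card_aut_eq_finrank ℚ K, Nat.card_eq_fintype_card]

lemma locA (x : ℚ_[q] ⊗[ℚ] K) (r : ℝ) (hx : nu K q x ≤ r) : ∃ y z,
    x = (act ℚ_[q] K σ).toRingEquiv y - y + z ∧ nu K q y ≤ r ∧
    nu K q z ≤ nu K q (∑ i ∈ Finset.range n, (act ℚ_[q] K σ).toRingEquiv^[i] x) := by
  obtain ⟨C, hU⟩ := exists_UN K q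
  have hc := card_n hσ hn
  set B := bs K q with hB
  have hr : 0 ≤ r := (nu_nonneg _).trans hx
  have hx' : x = ∑ i ∈ Finset.range n, B.repr x (σ ^ i) • B (σ ^ i) := by
    conv_lhs => rw [← B.sum_repr x, sum_cyc hσ, hc]
  set t := ∑ i ∈ Finset.range n, B.repr x (σ ^ i) with ht
  refine ⟨∑ i ∈ Finset.range n, B.repr x (σ ^ i) • ∑ j ∈ Finset.range i, B (σ ^ j), t • B 1, ?_, ?_, ?_⟩
  · change x = act ℚ_[q] K σ _ - _ + _
    rw [map_sum, ← Finset.sum_sub_distrib, ht, Finset.sum_smul, ← Finset.sum_add_distrib]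
    conv_lhs => rw [hx']
    refine Finset.sum_congr rfl fun i _ => ?_
    rw [map_smul, ← smul_sub, ← smul_add, map_sum]
    congr 1
    simp only [hB, act_bs, ← pow_succ']
    rw [← Finset.sum_sub_distrib, Finset.sum_range_sub (fun j => bs K q (σ ^ j))]
    simp
  · refine hU.sum_le _ hr fun i _ => ?_
    rw [nu_smul]
    have h1 : nu K q (∑ j ∈ Finset.range i, B (σ ^ j)) ≤ 1 :=
      hU.sum_le _ zero_le_one fun j _ => (nu_bs _).le
    have h2 := (nu_coord x (σ ^ i)).trans hx
    have := mul_le_mul h2 h1 (nu_nonneg _) hr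
    rwa [mul_one] at this
  · rw [nu_smul, nu_bs, mul_one]
    refine le_trans (le_of_eq ?_) (nu_coord _ 1)
    congr 1
    rw [ht, ← hc, ← sum_cyc hσ (fun g => B.repr x g), map_sum]
    simp only [act_iter]
    rw [← sum_cyc hσ (fun g => (bs K q).repr (act ℚ_[q] K g x)), Finsupp.coe_finsetSum, Finset.sum_apply,
      ← Equiv.sum_comp (Equiv.inv _)]
    refine Finset.sum_congr rfl fun g _ => ?_
    rw [← repr_act g, Equiv.inv_apply, mul_inv_cancel]

lemma locB (x : ℚ_[q] ⊗[ℚ] K) (r : ℝ) (hx : nu K q x ≤ r) (hs : (act ℚ_[q] K σ).toRingEquiv x = x) :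
    ∃ y, nu K q y ≤ r ∧ ∑ i ∈ Finset.range n, (act ℚ_[q] K σ).toRingEquiv^[i] y = x := by
  refine ⟨(bs K q).repr x 1 • bs K q 1, ?_, ?_⟩
  · rw [nu_smul, nu_bs, mul_one]
    exact (nu_coord _ _).trans hx
  · simp only [act_iter]
    rw [← card_n hσ hn, ← sum_cyc hσ (fun g => act ℚ_[q] K g _)]
    conv_rhs => rw [fix_bs hσ hs, Finset.smul_sum]
    refine Finset.sum_congr rfl fun g _ => ?_
    rw [map_smul, act_bs, mul_one]

end loc
end MN

namespace MN
set_option linter.unusedSectionVars false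
set_option linter.unusedSimpArgs false
open scoped TensorProduct

/-- local norm group -/
noncomputable def NG (F K : Type) [Field F] [Algebra ℚ F] [Field K] [Algebra ℚ K] : Subgroup Fˣ :=
  (Units.map (Algebra.norm F : (F ⊗[ℚ] K) →* F)).range

lemma den_of_norm (q : ℕ) [Fact q.Prime] {c : ℚ} (h : ‖(c : ℚ_[q])‖ ≤ 1) : ¬ q ∣ c.den := by
  intro hd
  have h1 : ‖((c.den : ℕ) : ℚ_[q])‖ < 1 := by
    have := (Padic.norm_intCast_lt_one_iff (p := q) (k := c.den)).mpr (by exact_mod_cast hd)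
    simpa using this
  have h2 : ¬ ((q : ℤ) ∣ c.num) := by
    intro h3
    have := Nat.dvd_gcd (Int.natCast_dvd.mp h3) hd
    rw [c.reduced] at this
    exact (Fact.out : q.Prime).one_lt.ne' (Nat.dvd_one.mp this)
  rw [← Padic.norm_intCast_lt_one_iff] at h2
  apply h2
  have e : ((c.num : ℤ) : ℚ_[q]) = (c : ℚ_[q]) * ((c.den : ℕ) : ℚ_[q]) := by
    have := Rat.mul_den_eq_num c
    exact_mod_cast this.symm
  rw [e, norm_mul]
  calc _ ≤ 1 * ‖((c.den : ℕ) : ℚ_[q])‖ := by gcongr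
    _ < 1 := by rwa [one_mul]

section
variable (K : Type) [Field K] [NumberField K] (q : ℕ) [hq : Fact q.Prime]

/-- q-integral elements -/
def Rq : Subring K where
  carrier := {z | ∃ b : ℕ, ¬ q ∣ b ∧ IsIntegral ℤ ((b : K) * z)}
  mul_mem' := by
    rintro x y ⟨a, ha, hx⟩ ⟨b, hb, hy⟩
    refine ⟨a * b, fun h => (hq.out.dvd_mul.mp h).elim ha hb, ?_⟩
    have := hx.mul hy
    have e : ((a * b : ℕ) : K) * (x * y) = (a * x) * (b * y) := by push_cast; ring
    rwa [e]
  one_mem' := ⟨1, hq.out.not_dvd_one, by simpa using isIntegral_one⟩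
  add_mem' := by
    rintro x y ⟨a, ha, hx⟩ ⟨b, hb, hy⟩
    refine ⟨a * b, fun h => (hq.out.dvd_mul.mp h).elim ha hb, ?_⟩
    have hn : ∀ n : ℕ, IsIntegral ℤ (n : K) := fun n => by
      simpa using (isIntegral_algebraMap (R := ℤ) (A := K) (x := n))
    have := ((hn b).mul hx).add ((hn a).mul hy)
    have e : ((a * b : ℕ) : K) * (x + y) = b * (a * x) + a * (b * y) := by push_cast; ring
    rwa [e]
  zero_mem' := ⟨1, hq.out.not_dvd_one, by simpa using isIntegral_zero⟩
  neg_mem' := by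
    rintro x ⟨a, ha, hx⟩
    exact ⟨a, ha, by simpa using hx.neg⟩

variable {K q}
lemma Rq_int {z : K} (hz : IsIntegral ℤ z) : z ∈ Rq K q :=
  ⟨1, hq.out.not_dvd_one, by simpa using hz⟩

lemma Rq_rat {z : K} (hz : z ∈ Rq K q) {c : ℚ} (hc : ¬ q ∣ c.den) : (c : K) * z ∈ Rq K q := by
  refine (Rq K q).mul_mem ⟨c.den, hc, ?_⟩ hz
  have : ((c.den : ℕ) : K) * (c : K) = ((c.num : ℤ) : K) := by
    have := Rat.den_mul_eq_num c
    exact_mod_cast this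
  rw [this]
  simpa using (isIntegral_algebraMap (R := ℤ) (A := K) (x := c.num))

variable [IsGalois ℚ K]

lemma nu_one_ratmul (c : ℚ) (z : K) :
    nu K q (1 ⊗ₜ ((c : K) * z)) = ‖(c : ℚ_[q])‖ * nu K q (1 ⊗ₜ z) := by
  rw [← nu_smul]
  congr 1
  have : (c : K) * z = c • z := by rw [Algebra.smul_def]; simp
  rw [this, ← TensorProduct.smul_tmul, TensorProduct.smul_tmul']
  congr 1

variable (K q) in
lemma L1 : ∃ C0 : ℝ, 0 < C0 ∧ ∀ z ∈ Rq K q, nu K q (1 ⊗ₜ z) ≤ C0 := by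
  obtain ⟨C, hU⟩ := exists_UN K q
  let b := NumberField.RingOfIntegers.basis K
  refine ⟨1 + ∑ i, nu K q (1 ⊗ₜ (b i : K)), ?_, ?_⟩
  · have : 0 ≤ ∑ i, nu K q (1 ⊗ₜ (b i : K)) := Finset.sum_nonneg fun i _ => nu_nonneg _
    linarith
  · rintro z ⟨m, hm, hz⟩
    have h1 := nu_one_ratmul (q := q) (m : ℚ) z
    have hm1 : ‖((m : ℚ) : ℚ_[q])‖ = 1 := by
      rw [Rat.cast_natCast, Padic.norm_natCast_eq_one_iff]
      exact (hq.out.coprime_iff_not_dvd).mpr hm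
    rw [hm1, one_mul] at h1
    rw [← h1]
    simp only [Rat.cast_natCast]
    let y : NumberField.RingOfIntegers K := ⟨(m : K) * z, hz⟩
    have hy : (m : K) * z = ∑ i, ((b.repr y i : ℚ) : K) * (b i : K) := by
      have : (y : K) = ((∑ i, b.repr y i • b i : NumberField.RingOfIntegers K) : K) := by
        rw [b.sum_repr]
      change (y : K) = _
      rw [this]
      simp
    have hnn : ∀ i, 0 ≤ nu K q (1 ⊗ₜ (b i : K)) := fun i => nu_nonneg _
    rw [hy, TensorProduct.tmul_sum]
    refine hU.sum_le _ (by have := Finset.sum_nonneg (s := Finset.univ) fun i _ => hnn i; linarith) fun i _ => ?_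
    rw [nu_one_ratmul]
    have h2 : ‖(((b.repr y i : ℤ) : ℚ) : ℚ_[q])‖ ≤ 1 := by
      rw [Rat.cast_intCast]; exact Padic.norm_int_le_one _
    have h3 := Finset.single_le_sum (fun i _ => hnn i) (Finset.mem_univ i)
    nlinarith [hnn i]

variable (K q) in
lemma L2 : ∃ r : ℝ, 0 < r ∧ ∀ z : K, nu K q (1 ⊗ₜ z) ≤ r → z ∈ Rq K q := by
  classical
  let b := IsGalois.normalBasis ℚ K
  obtain ⟨N, hN, hint⟩ := exists_integral_multiples ℤ ℚ (Finset.univ.image b)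
  have hN' : (N : ℚ_[q]) ≠ 0 := by exact_mod_cast hN
  refine ⟨‖(N : ℚ_[q])‖, norm_pos_iff.mpr hN', fun z hz => ?_⟩
  rw [← b.sum_repr z]
  refine (Rq K q).sum_mem fun g _ => ?_
  have h1 : ‖((b.repr z g : ℚ) : ℚ_[q])‖ ≤ ‖(N : ℚ_[q])‖ := by
    refine le_trans (le_of_eq ?_) ((nu_coord _ g).trans hz)
    unfold bs
    rw [Algebra.TensorProduct.basis_repr_tmul]
    simp [b]
  have h2 : b.repr z g • b g = ((b.repr z g / N : ℚ) : K) * (N • b g) := by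
    rw [Algebra.smul_def, zsmul_eq_mul]
    have : (N : K) ≠ 0 := by exact_mod_cast hN
    simp; field_simp
  rw [h2]
  refine Rq_rat (Rq_int (hint _ (by simp))) (den_of_norm q ?_)
  rw [Rat.cast_div, norm_div, Rat.cast_intCast]
  exact div_le_one_of_le₀ h1 (norm_nonneg _)

lemma dens (x : ℚ_[q] ⊗[ℚ] K) {ε : ℝ} (hε : 0 < ε) : ∃ κ : K, nu K q (1 ⊗ₜ κ - x) ≤ ε := by
  let b := IsGalois.normalBasis ℚ K
  choose c hc using fun g => Padic.rat_dense q ((bs K q).repr x g) hε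
  refine ⟨∑ g, c g • b g, ?_⟩
  rw [nu_le hε.le]
  intro g
  rw [map_sub, Finsupp.sub_apply, norm_sub_rev]
  refine le_trans (le_of_eq ?_) (hc g).le
  congr 2
  unfold bs
  rw [Algebra.TensorProduct.basis_repr_tmul]
  have : b.repr (∑ g, c g • b g) g = c g := by
    rw [← b.equivFun_apply, ← b.equivFun_symm_apply, LinearEquiv.apply_symm_apply]
  change (1 : ℚ_[q]) * algebraMap ℚ ℚ_[q] (b.repr (∑ g, c g • b g) g) = _
  rw [this]
  simp

variable (K q) in
/-- units of K into local units -/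
noncomputable def iot : Kˣ →* (ℚ_[q] ⊗[ℚ] K)ˣ :=
  Units.map (Algebra.TensorProduct.includeRight : K →ₐ[ℚ] ℚ_[q] ⊗[ℚ] K)

lemma iot_val (x : Kˣ) : (iot K q x : ℚ_[q] ⊗[ℚ] K) = 1 ⊗ₜ (x : K) := rfl

variable {σ : K ≃ₐ[ℚ] K} (hσ : ∀ x, x ∈ Subgroup.zpowers σ)
include hσ

lemma sig_pow {n : ℕ} (hn : n = Module.finrank ℚ K) : σ ^ n = 1 := by
  rw [← card_n hσ hn]; exact pow_card_eq_one

lemma hbV_loc {n : ℕ} (hn : n = Module.finrank ℚ K) {C : ℝ} (hU : UN (nu K q) C) {ρ : ℝ} (h0 : 0 ≤ ρ)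
    (hρ : C * ρ ≤ 1 / 2) :
    (∀ x ∈ hU.V ρ h0 hρ, uact ℚ_[q] σ x ∈ hU.V ρ h0 hρ) ∧
    hb (Dl (uact ℚ_[q] σ)) (Nm (uact ℚ_[q] σ) n) (hU.V ρ h0 hρ) = 1 ∧
    hb (Nm (uact ℚ_[q] σ) n) (Dl (uact ℚ_[q] σ)) (hU.V ρ h0 hρ) = 1 := by
  refine ⟨hU.stabV h0 hρ (act ℚ_[q] K σ).toRingEquiv (nu_act σ), ?_⟩
  refine hU.hbV h0 hρ (act ℚ_[q] K σ).toRingEquiv (nu_act σ) n ?_ (locA hσ hn) (locB hσ hn)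
  intro x
  rw [act_iter, sig_pow hσ hn]
  exact (act_iter 1 0 x).symm

/-- fixed points of local units -/
lemma ker_Dl : (Dl (uact ℚ_[q] σ)).ker =
    (Units.map (algebraMap ℚ_[q] (ℚ_[q] ⊗[ℚ] K) : ℚ_[q] →* ℚ_[q] ⊗[ℚ] K)).range := by
  ext u
  rw [MonoidHom.mem_ker, Dl_apply, div_eq_one]
  constructor
  · intro h
    have h1 : act ℚ_[q] K σ u = u := congrArg Units.val h
    obtain ⟨c, hc⟩ := fix_alg hσ h1
    have hc0 : c ≠ 0 := by
      rintro rfl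
      rw [map_zero] at hc
      exact u.ne_zero hc
    exact ⟨Units.mk0 c hc0, Units.ext hc.symm⟩
  · rintro ⟨c, rfl⟩
    apply Units.ext
    change act ℚ_[q] K σ (algebraMap _ _ _) = algebraMap _ _ _
    rw [AlgEquiv.commutes]

lemma Nm_range {n : ℕ} (hn : n = Module.finrank ℚ K) : (Nm (uact ℚ_[q] σ) n).range =
    (NG ℚ_[q] K).map (Units.map (algebraMap ℚ_[q] (ℚ_[q] ⊗[ℚ] K) : ℚ_[q] →* ℚ_[q] ⊗[ℚ] K)) := by
  have : Nm (uact ℚ_[q] σ) n = (Units.map (algebraMap ℚ_[q] (ℚ_[q] ⊗[ℚ] K) : ℚ_[q] →* ℚ_[q] ⊗[ℚ] K)).comp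
      (Units.map (Algebra.norm ℚ_[q] : (ℚ_[q] ⊗[ℚ] K) →* ℚ_[q])) := by
    ext x
    exact Nm_uact hσ hn x
  rw [this, MonoidHom.range_comp]
  rfl

omit hσ in
lemma algMap_inj : Function.Injective
    (Units.map (algebraMap ℚ_[q] (ℚ_[q] ⊗[ℚ] K) : ℚ_[q] →* ℚ_[q] ⊗[ℚ] K)) :=
  Units.map_injective (algebraMap ℚ_[q] (ℚ_[q] ⊗[ℚ] K)).injective

lemma NG_open : ∃ ρ : ℝ, 0 < ρ ∧ ∀ u : ℚ_[q]ˣ, ‖(u : ℚ_[q]) - 1‖ ≤ ρ → u ∈ NG ℚ_[q] K := by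
  obtain ⟨C, hU⟩ := exists_UN K q
  have hC := hU.one_le
  set ρ := 1 / (2 * C)
  have h0 : 0 < ρ := by positivity
  have hρ : C * ρ ≤ 1 / 2 := by simp only [ρ]; field_simp; exact le_rfl
  obtain ⟨-, h1, -⟩ := hbV_loc hσ rfl hU h0.le hρ
  have hnu : 0 ≤ nu K q 1 := nu_nonneg _
  refine ⟨ρ / (1 + nu K q 1), by positivity, fun u hu => ?_⟩
  unfold hb at h1
  rw [Subgroup.relIndex_eq_one] at h1
  set A := Units.map (algebraMap ℚ_[q] (ℚ_[q] ⊗[ℚ] K) : ℚ_[q] →* ℚ_[q] ⊗[ℚ] K)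
  have h2 : A u ∈ hU.V ρ h0.le hρ := by
    rw [hU.mem_V]
    change nu K q (algebraMap _ _ (u : ℚ_[q]) - 1) ≤ ρ
    rw [← map_one (algebraMap ℚ_[q] (ℚ_[q] ⊗[ℚ] K)), ← map_sub, Algebra.algebraMap_eq_smul_one, nu_smul]
    calc _ ≤ ρ / (1 + nu K q 1) * (1 + nu K q 1) := by gcongr; linarith
      _ = ρ := by field_simp
  obtain ⟨x, -, hx⟩ := h1 ⟨h2, by rw [SetLike.mem_coe, ker_Dl hσ]; exact ⟨u, rfl⟩⟩
  have h3 : A u ∈ (Nm (uact ℚ_[q] σ) (Module.finrank ℚ K)).range := ⟨x, hx⟩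
  rw [Nm_range hσ rfl] at h3
  obtain ⟨v, hv, hvu⟩ := h3
  rwa [← algMap_inj hvu]

omit hσ in
lemma rep_one {C ρ : ℝ} (hU : UN (nu K q) C) (h0 : 0 < ρ) (hρ : C * ρ ≤ 1 / 2)
    (x : (ℚ_[q] ⊗[ℚ] K)ˣ) : ∃ κ : Kˣ, x⁻¹ * iot K q κ ∈ hU.V ρ h0.le hρ := by
  have hCp : 0 < C := by linarith [hU.one_le]
  obtain ⟨y, hy⟩ : ∃ y : ℚ_[q] ⊗[ℚ] K, y = (x⁻¹ : (ℚ_[q] ⊗[ℚ] K)ˣ) := ⟨_, rfl⟩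
  set δ := ρ / (C * (1 + nu K q y)) with hδ'
  have hx0 : 0 ≤ nu K q y := nu_nonneg _
  have hδ : 0 < δ := by positivity
  obtain ⟨κ, hκ⟩ := dens (x : ℚ_[q] ⊗[ℚ] K) hδ
  have hκ1 : nu K q (y * (1 ⊗ₜ κ : ℚ_[q] ⊗[ℚ] K) - 1) ≤ ρ := by
    have e : y * (1 ⊗ₜ κ : ℚ_[q] ⊗[ℚ] K) - 1 =
        y * ((1 ⊗ₜ κ : ℚ_[q] ⊗[ℚ] K) - x) := by rw [mul_sub, hy, Units.inv_mul]
    rw [e]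
    refine (hU.mul_le le_rfl hκ).trans ?_
    calc _ ≤ C * (1 + nu K q y) * δ := by gcongr; linarith
      _ = ρ := by rw [hδ']; field_simp
  have hκ0 : κ ≠ 0 := by
    rintro rfl
    have := hU.isUnit hκ1 hρ
    rw [TensorProduct.tmul_zero, mul_zero] at this
    exact not_isUnit_zero this
  refine ⟨Units.mk0 κ hκ0, ?_⟩
  rw [hy] at hκ1
  exact hκ1

omit hσ in
lemma rep_two (E : Subgroup Kˣ) (m : ℕ)
    (hb : ∀ κ : Kˣ, ∃ a ∈ E, ((a * κ : Kˣ) : K) ∈ Rq K q ∧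
      (q : K) ^ m * (((a * κ)⁻¹ : Kˣ) : K) ∈ Rq K q) :
    ∃ C0 : ℝ, 0 < C0 ∧ ∀ κ : Kˣ, ∃ a ∈ E, nu K q (iot K q (a * κ)) ≤ C0 ∧
      nu K q ((iot K q (a * κ))⁻¹ : (ℚ_[q] ⊗[ℚ] K)ˣ) ≤ C0 := by
  obtain ⟨C0, hC0, hL⟩ := L1 K q
  have hq0 : (q : ℚ_[q]) ≠ 0 := by exact_mod_cast hq.out.ne_zero
  have hqp : 0 < ‖(q : ℚ_[q])‖ ^ m := pow_pos (norm_pos_iff.mpr hq0) m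
  refine ⟨max C0 (C0 / ‖(q : ℚ_[q])‖ ^ m), lt_max_of_lt_left hC0, fun κ => ?_⟩
  obtain ⟨a, ha, h1, h2⟩ := hb κ
  refine ⟨a, ha, le_max_of_le_left (hL _ h1), le_max_of_le_right ?_⟩
  have := hL _ h2
  have e : (q : K) ^ m = (((q : ℚ) ^ m : ℚ) : K) := by simp
  rw [e, nu_one_ratmul] at this
  rw [le_div_iff₀ hqp, ← map_inv, iot_val, mul_comm]
  simpa using this

omit hσ in
lemma fin_idx {C ρ : ℝ} (hU : UN (nu K q) C) (h0 : 0 < ρ) (hρ : C * ρ ≤ 1 / 2)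
    (E : Subgroup Kˣ) (m : ℕ)
    (hb : ∀ κ : Kˣ, ∃ a ∈ E, ((a * κ : Kˣ) : K) ∈ Rq K q ∧
      (q : K) ^ m * (((a * κ)⁻¹ : Kˣ) : K) ∈ Rq K q) :
    (E.map (iot K q) ⊔ hU.V ρ h0.le hρ).index ≠ 0 := by
  obtain ⟨C0, hC0, hrep2⟩ := rep_two E m hb
  have hCp : 0 < C := by linarith [hU.one_le]
  set ε := ρ / (C * C0) with hε
  have hεp : 0 < ε := by positivity
  set H := E.map (iot K q) ⊔ hU.V ρ h0.le hρ with hH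
  have hrep : ∀ x : (ℚ_[q] ⊗[ℚ] K)ˣ, ∃ y : (ℚ_[q] ⊗[ℚ] K)ˣ, x⁻¹ * y ∈ H ∧
      nu K q y ≤ C0 ∧ nu K q (y⁻¹ : (ℚ_[q] ⊗[ℚ] K)ˣ) ≤ C0 := by
    intro x
    obtain ⟨κ, hκ⟩ := rep_one hU h0 hρ x
    obtain ⟨a, ha, h1, h2⟩ := hrep2 κ
    refine ⟨iot K q (a * κ), ?_, h1, h2⟩
    rw [map_mul, mul_left_comm]
    exact Subgroup.mul_mem_sup ⟨a, ha, rfl⟩ hκ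
  -- compactness
  have hcomp : TotallyBounded (Metric.closedBall (0 : (K ≃ₐ[ℚ] K) → ℚ_[q]) C0) :=
    (isCompact_closedBall _ _).totallyBounded
  obtain ⟨t, ht, hcov⟩ := Metric.totallyBounded_iff.mp hcomp ε hεp
  choose r hr1 hr2 hr3 using hrep
  have hcen : ∀ x, ∃ z ∈ t, dist ((bs K q).equivFun (r x : ℚ_[q] ⊗[ℚ] K)) z < ε := by
    intro x
    have : (bs K q).equivFun (r x : ℚ_[q] ⊗[ℚ] K) ∈ Metric.closedBall (0 : (K ≃ₐ[ℚ] K) → ℚ_[q]) C0 := by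
      rw [Metric.mem_closedBall, dist_zero_right]; exact hr2 x
    have := hcov this
    simpa using this
  choose z hz1 hz2 using hcen
  have := ht.to_subtype
  have key : ∀ x x', z x = z x' → x⁻¹ * x' ∈ H := by
    intro x x' hxx
    have h1 : nu K q ((r x' : ℚ_[q] ⊗[ℚ] K) - r x) ≤ ε := by
      have e : (r x' : ℚ_[q] ⊗[ℚ] K) - r x = ((r x' : ℚ_[q] ⊗[ℚ] K) - (bs K q).equivFun.symm (z x)) -
        ((r x : ℚ_[q] ⊗[ℚ] K) - (bs K q).equivFun.symm (z x)) := by ring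
      have hd : ∀ y, z y = z x → nu K q ((r y : ℚ_[q] ⊗[ℚ] K) - (bs K q).equivFun.symm (z x)) ≤ ε := by
        intro y hy
        unfold nu
        rw [map_sub, LinearEquiv.apply_symm_apply, ← dist_eq_norm, ← hy]
        exact (hz2 y).le
      rw [e]
      exact hU.sub_le (hd x' hxx.symm) (hd x rfl)
    have h2 : (r x)⁻¹ * r x' ∈ hU.V ρ h0.le hρ := by
      rw [hU.mem_V]
      have e : (((r x)⁻¹ * r x' : (ℚ_[q] ⊗[ℚ] K)ˣ) : ℚ_[q] ⊗[ℚ] K) - 1 =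
          ((r x)⁻¹ : (ℚ_[q] ⊗[ℚ] K)ˣ) * ((r x' : ℚ_[q] ⊗[ℚ] K) - r x) := by
        rw [mul_sub, Units.inv_mul, Units.val_mul]
      rw [e]
      refine (hU.mul_le (hr3 x) h1).trans (le_of_eq ?_)
      rw [hε]; field_simp
    have h3 : x⁻¹ * x' = (x⁻¹ * r x) * ((r x)⁻¹ * r x') * (x'⁻¹ * r x')⁻¹ := by group
    rw [h3]
    exact H.mul_mem (H.mul_mem (hr1 x) (le_sup_right (a := E.map (iot K q)) h2)) (H.inv_mem (hr1 x'))
  have hfin : Finite ((ℚ_[q] ⊗[ℚ] K)ˣ ⧸ H) := by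
    refine Finite.of_injective (β := t) (fun c => ⟨z c.out, hz1 _⟩) fun c c' hcc => ?_
    have := key _ _ (congrArg Subtype.val hcc)
    rw [← QuotientGroup.eq, QuotientGroup.out_eq', QuotientGroup.out_eq'] at this
    exact this
  exact Subgroup.index_ne_zero_of_finite

theorem local_index {g d : ℕ} [NeZero g] (hd : d ≠ 0) (hgd : g * d = Module.finrank ℚ K)
    (w : ZMod g → Kˣ) (hw : ∀ i, Units.map (σ : K →* K) (w i) = w (i + 1))
    (ha : ∀ a : ZMod g → ℤ, (phi w (Multiplicative.ofAdd a) : K) ∈ Rq K q →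
      (((phi w (Multiplicative.ofAdd a))⁻¹ : Kˣ) : K) ∈ Rq K q → a = 0) (m : ℕ)
    (hb : ∀ κ : Kˣ, ∃ a ∈ (phi w).range, ((a * κ : Kˣ) : K) ∈ Rq K q ∧
      (q : K) ^ m * (((a * κ)⁻¹ : Kˣ) : K) ∈ Rq K q) :
    (NG ℚ_[q] K).index ≠ 0 ∧ d ∣ (NG ℚ_[q] K).index := by
  obtain ⟨C, hU⟩ := exists_UN K q
  obtain ⟨r, hr0, hr⟩ := L2 K q
  have hCp : 0 < C := by linarith [hU.one_le]
  have h0 : 0 < min r (1 / (2 * C)) := by positivity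
  have hρ : C * min r (1 / (2 * C)) ≤ 1 / 2 := by
    calc _ ≤ C * (1 / (2 * C)) := by gcongr; exact min_le_right _ _
      _ = 1 / 2 := by field_simp
  obtain ⟨hst, hV1, hV2⟩ := hbV_loc hσ hgd hU h0.le hρ
  set V := hU.V _ h0.le hρ with hV
  have hidx := fin_idx hU h0 hρ _ m hb
  rw [← hV] at hidx
  have hw' : ∀ i, uact ℚ_[q] σ (iot K q (w i)) = iot K q (w (i + 1)) := by
    intro i
    rw [← hw]
    apply Units.ext
    exact act_tmul _ _ _
  have hphi : (phi fun i => iot K q (w i)) = (iot K q).comp (phi w) := by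
    ext a
    simp [phi]
  have hR : (phi w).range.map (iot K q) = (phi fun i => iot K q (w i)).range := by
    rw [hphi, MonoidHom.range_comp]
  rw [hR] at hidx
  have hsmall : ∀ a : Kˣ, iot K q a ∈ V → (a : K) ∈ Rq K q := by
    intro a h
    rw [hU.mem_V, iot_val] at h
    have e : (1 ⊗ₜ (a : K) - 1 : ℚ_[q] ⊗[ℚ] K) = 1 ⊗ₜ ((a : K) - 1) := by
      rw [TensorProduct.tmul_sub]; rfl
    rw [e] at h
    have := hr _ (h.trans (min_le_left _ _))
    simpa using (Rq K q).add_mem this (Rq K q).one_mem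
  have hmem0 : ∀ a : ZMod g → ℤ, phi (fun i => iot K q (w i)) (Multiplicative.ofAdd a) ∈ V → a = 0 := by
    intro a h
    rw [hphi] at h
    refine ha a (hsmall _ h) (hsmall _ ?_)
    rw [map_inv]
    exact V.inv_mem h
  set E := (phi fun i => iot K q (w i)).range with hE
  obtain ⟨hE1, hE2⟩ := hbE hw' (fun a h => hmem0 a (by rw [h]; exact V.one_mem)) d hd
  rw [← hE, hgd] at hE1 hE2
  have hdisj : Disjoint E V := by
    rw [Subgroup.disjoint_def]
    rintro _ ⟨a, rfl⟩ hx
    have : a = Multiplicative.ofAdd 0 := hmem0 a.toAdd hx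
    rw [this]; exact map_one _
  rw [hgd] at hV1 hV2
  set n := Module.finrank ℚ K
  set s := uact ℚ_[q] σ
  have hn1 : ∀ x, s^[n] x = x := uact_n (sig_pow hσ rfl)
  have sE1 : E.map (Dl s) ≤ E := stable_Dl s (stable_phi hw')
  have sE2 : E.map (Nm s n) ≤ E := stable_Nm s (stable_phi hw') n
  have sV1 : V.map (Dl s) ≤ V := stable_Dl s hst
  have sV2 : V.map (Nm s n) ≤ V := stable_Nm s hst n
  have hB1 := hb_sup (Dl s) (Nm s n) (Dl_Nm s hn1) sE1 sE2 sV1 sV2 hdisj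
  have hB2 := hb_sup (Nm s n) (Dl s) (Nm_Dl s hn1) sE2 sE1 sV2 sV1 hdisj
  rw [hE1, hV1, mul_one] at hB1
  rw [hE2, hV2, mul_one] at hB2
  have hfin : (E ⊔ V).relIndex ⊤ ≠ 0 := by rwa [Subgroup.relIndex_top_right]
  have sB1 : (E ⊔ V).map (Dl s) ≤ E ⊔ V := map_sup_le sE1 sV1
  have sB2 : (E ⊔ V).map (Nm s n) ≤ E ⊔ V := map_sup_le sE2 sV2
  have main := hb_lemma (Dl_Nm s hn1) (Nm_Dl s hn1) le_top sB1 sB2 le_top le_top hfin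
  have hne := hb_ne_zero (Dl_Nm s hn1) le_top sB2 le_top hfin (by rw [hB1]; exact hd)
  rw [hB1, hB2, mul_one] at main
  have hid : MN.hb (Dl s) (Nm s n) ⊤ = (NG ℚ_[q] K).index := by
    unfold MN.hb
    rw [top_inf_eq, ker_Dl hσ, ← MonoidHom.range_eq_map, Nm_range hσ rfl, MonoidHom.range_eq_map,
      Subgroup.relIndex_map_map_of_injective _ _ algMap_inj, Subgroup.relIndex_top_right]
  rw [hid] at main hne
  exact ⟨hne, _, main⟩
end
end MN

namespace MN
set_option linter.unusedSectionVars false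
set_option linter.unusedSimpArgs false
open scoped TensorProduct Pointwise
open IsDedekindDomain NumberField

/-- cyclic orbits -/
lemma orb {Ω : Type*} (x0 : Ω) (s : Ω → Ω) {n : ℕ} (hn0 : n ≠ 0) (hn : ∀ x, s^[n] x = x)
    (tr : ∀ y, ∃ k, s^[k] x0 = y) : ∃ g d : ℕ, g ≠ 0 ∧ d ≠ 0 ∧ g * d = n ∧ ∃ v : ZMod g → Ω,
      Function.Bijective v ∧ ∀ i, v (i + 1) = s (v i) := by
  set g := Function.minimalPeriod s x0 with hg
  obtain ⟨d, hd⟩ : g ∣ n := Function.IsPeriodicPt.minimalPeriod_dvd (hn x0)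
  have hg0 : g ≠ 0 := by rintro h; rw [h, zero_mul] at hd; exact hn0 hd
  have hd0 : d ≠ 0 := by rintro rfl; rw [mul_zero] at hd; exact hn0 hd
  have : NeZero g := ⟨hg0⟩
  refine ⟨g, d, hg0, hd0, hd.symm, fun i => s^[i.val] x0, ⟨?_, ?_⟩, ?_⟩
  · intro i j hij
    have := (Function.iterate_eq_iterate_iff_of_lt_minimalPeriod (ZMod.val_lt i) (ZMod.val_lt j)).mp hij
    exact ZMod.val_injective g this
  · intro y
    obtain ⟨k, hk⟩ := tr y
    refine ⟨(k : ZMod g), ?_⟩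
    simp only [ZMod.val_natCast]
    rw [hg, Function.iterate_mod_minimalPeriod_eq, hk]
  · intro i
    simp only
    have e : (i + 1).val = (i.val + 1) % g := by
      rw [ZMod.val_add, ZMod.val_one_eq_one_mod, Nat.add_mod_mod]
    rw [← Function.iterate_succ_apply' s, e]
    exact Function.iterate_mod_minimalPeriod_eq

section
variable {K : Type} [Field K] [NumberField K]

/-- order at v -/
noncomputable def od (v : HeightOneSpectrum (𝓞 K)) (x : Kˣ) : ℤ := -Multiplicative.toAdd (v.valuationOfNeZero x)

lemma od_mul (v : HeightOneSpectrum (𝓞 K)) (x y : Kˣ) : od v (x * y) = od v x + od v y := by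
  simp [od, map_mul]; ring

lemma od_one (v : HeightOneSpectrum (𝓞 K)) : od v 1 = 0 := by simp [od]

lemma od_inv (v : HeightOneSpectrum (𝓞 K)) (x : Kˣ) : od v x⁻¹ = - od v x := by
  simp [od]

lemma od_zpow (v : HeightOneSpectrum (𝓞 K)) (x : Kˣ) (k : ℤ) : od v (x ^ k) = k * od v x := by
  simp [od, map_zpow]

lemma od_prod {ι : Type*} (v : HeightOneSpectrum (𝓞 K)) (s : Finset ι) (f : ι → Kˣ) :
    od v (∏ i ∈ s, f i) = ∑ i ∈ s, od v (f i) := by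
  simp [od, map_prod]

lemma val_od (v : HeightOneSpectrum (𝓞 K)) (x : Kˣ) : v.valuation K x = WithZero.exp (-od v x) := by
  rw [← HeightOneSpectrum.valuationOfNeZero_eq, od, neg_neg]; rfl

lemma od_le (v : HeightOneSpectrum (𝓞 K)) (x : Kˣ) : 0 ≤ od v x ↔ v.valuation K x ≤ 1 := by
  rw [val_od, ← WithZero.exp_zero, WithZero.exp_le_exp]; omega

lemma od_eq (v : HeightOneSpectrum (𝓞 K)) (x : Kˣ) : od v x = 0 ↔ v.valuation K x = 1 := by
  rw [val_od, ← WithZero.exp_zero, WithZero.exp_inj]; omega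

lemma od_mem (v : HeightOneSpectrum (𝓞 K)) (x : Kˣ) (r : 𝓞 K) (hr : (r : K) = x) (k : ℕ) :
    (k : ℤ) ≤ od v x ↔ r ∈ v.asIdeal ^ k := by
  rw [← HeightOneSpectrum.intValuation_le_pow_iff_mem, ← HeightOneSpectrum.valuation_of_algebraMap (K := K)]
  change _ ↔ v.valuation K (r : K) ≤ _
  rw [hr, val_od, WithZero.exp_le_exp]
  omega

lemma exists_frac (x : Kˣ) : ∃ (a : 𝓞 K) (y : Kˣ) (b : ℕ) (z : Kˣ), (a : K) = y ∧ (b : K) = z ∧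
    b ≠ 0 ∧ x = y / z := by
  obtain ⟨b, hb, h⟩ := exists_integral_multiples ℤ ℚ {(x : K)}
  have h1 := h x (by simp)
  have hb' : ((b.natAbs : ℕ) : K) ≠ 0 := by
    rw [Nat.cast_ne_zero]; exact Int.natAbs_ne_zero.mpr hb
  have h2 : IsIntegral ℤ ((b.natAbs : K) * x) := by
    rw [zsmul_eq_mul] at h1
    rcases Int.natAbs_eq b with e | e
    · have : (b : K) = (b.natAbs : K) := by
        rw [← Int.cast_natCast (R := K)]; exact congrArg (Int.cast (R := K)) e
      rwa [← this]
    · have : (b : K) = -(b.natAbs : K) := by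
        rw [← Int.cast_natCast (R := K), ← Int.cast_neg]; exact congrArg (Int.cast (R := K)) e
      rw [this] at h1; simpa using h1.neg
  refine ⟨⟨_, h2⟩, Units.mk0 _ hb' * x, b.natAbs, Units.mk0 _ hb', rfl, rfl, Int.natAbs_ne_zero.mpr hb, ?_⟩
  rw [mul_div_cancel_left]

/-- Galois action on primes -/
noncomputable def sv (σ : K ≃ₐ[ℚ] K) (v : HeightOneSpectrum (𝓞 K)) : HeightOneSpectrum (𝓞 K) where
  asIdeal := σ • v.asIdeal
  isPrime := inferInstance
  ne_bot h := v.ne_bot (by simpa using congrArg (σ⁻¹ • ·) h)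

lemma smul_pow_ideal (σ : K ≃ₐ[ℚ] K) (I : Ideal (𝓞 K)) (k : ℕ) : σ • (I ^ k) = (σ • I) ^ k := by
  change Ideal.map _ _ = (Ideal.map _ _) ^ k
  exact Ideal.map_pow _ _ _

lemma od_sv (σ : K ≃ₐ[ℚ] K) (v : HeightOneSpectrum (𝓞 K)) (x : Kˣ) :
    od (sv σ v) (Units.map (σ : K →* K) x) = od v x := by
  have key : ∀ (y : Kˣ) (a : 𝓞 K), (a : K) = y → od (sv σ v) (Units.map (σ : K →* K) y) = od v y := by
    intro y a ha
    have h1 : ∀ k : ℕ, (k : ℤ) ≤ od (sv σ v) (Units.map (σ : K →* K) y) ↔ (k : ℤ) ≤ od v y := by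
      intro k
      have e : ((σ • a : 𝓞 K) : K) = Units.map (σ : K →* K) y := by
        change σ (a : K) = σ y; rw [ha]
      rw [od_mem v y a ha, od_mem _ _ _ e]
      change _ ∈ (σ • v.asIdeal) ^ k ↔ _
      rw [← smul_pow_ideal, Ideal.smul_mem_pointwise_smul_iff]
    have h2 := (h1 0).mpr
    have p1 : 0 ≤ od v y := by
      rw [od_le, ← ha]; exact HeightOneSpectrum.valuation_le_one v a
    have p2 := (h1 0).mpr (by exact_mod_cast p1)
    have h3 := h1 (od v y).toNat
    have h4 := h1 (od (sv σ v) (Units.map (σ : K →* K) y)).toNat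
    simp only [Nat.cast_zero] at p2
    rw [Int.toNat_of_nonneg p1] at h3
    rw [Int.toNat_of_nonneg p2] at h4
    exact le_antisymm (h4.mp le_rfl) (h3.mpr le_rfl)
  obtain ⟨a, y, b, z, h1, h2, -, rfl⟩ := exists_frac x
  have h2' : (((b : ℕ) : 𝓞 K) : K) = z := by simpa using h2
  rw [map_div, div_eq_mul_inv, div_eq_mul_inv, od_mul, od_mul, od_inv, od_inv, key y a h1, key z b h2']

lemma od_nat_zero (v : HeightOneSpectrum (𝓞 K)) {q b : ℕ} (hq : q.Prime) (hv : (q : 𝓞 K) ∈ v.asIdeal)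
    (hb : ¬ q ∣ b) : (b : 𝓞 K) ∉ v.asIdeal := by
  intro h
  have hc : IsCoprime (q : ℤ) (b : ℤ) := Nat.isCoprime_iff_coprime.mpr ((hq.coprime_iff_not_dvd).mpr hb)
  obtain ⟨x, y, hxy⟩ := hc
  apply v.isPrime.one_notMem
  have e : (1 : 𝓞 K) = x * q + y * b := by exact_mod_cast congrArg (Int.cast (R := 𝓞 K)) hxy.symm
  rw [e]
  exact v.asIdeal.add_mem (v.asIdeal.mul_mem_left _ hv) (v.asIdeal.mul_mem_left _ h)

lemma od_nat (v : HeightOneSpectrum (𝓞 K)) {b : ℕ} (z : Kˣ) (hz : (b : K) = z) :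
    0 ≤ od v z ∧ (od v z = 0 ↔ (b : 𝓞 K) ∉ v.asIdeal) := by
  have h2' : (((b : ℕ) : 𝓞 K) : K) = z := by simpa using hz
  constructor
  · rw [od_le, ← h2']; exact HeightOneSpectrum.valuation_le_one v _
  · rw [od_eq, ← h2']; exact HeightOneSpectrum.valuation_eq_one_iff_notMem v

lemma mem_Rq {q : ℕ} [hq : Fact q.Prime] (z : Kˣ) :
    (z : K) ∈ Rq K q ↔ ∀ v : HeightOneSpectrum (𝓞 K), (q : 𝓞 K) ∈ v.asIdeal → 0 ≤ od v z := by
  constructor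
  · rintro ⟨b, hb, hint⟩ v hv
    have hb0 : (b : K) ≠ 0 := by
      rw [Nat.cast_ne_zero]; rintro rfl; exact hb (dvd_zero _)
    have h1 : 0 ≤ od v (Units.mk0 _ hb0 * z) := by
      rw [od_le]
      exact HeightOneSpectrum.valuation_le_one v ⟨_, hint⟩
    rw [od_mul, (od_nat v (Units.mk0 _ hb0) rfl).2.mpr (od_nat_zero v hq.out hv hb)] at h1
    simpa using h1
  · intro h
    obtain ⟨a, y, b, u, h1, h2, hb0, rfl⟩ := exists_frac z
    obtain ⟨k, c, hc, rfl⟩ := Nat.exists_eq_pow_mul_and_not_dvd hb0 q hq.out.ne_one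
    refine ⟨c, hc, ?_⟩
    have hc0 : (c : K) ≠ 0 := by
      rw [Nat.cast_ne_zero]; rintro rfl; exact hc (dvd_zero _)
    have hq0 : ((q ^ k : ℕ) : K) ≠ 0 := by
      rw [Nat.cast_ne_zero]; exact pow_ne_zero _ hq.out.ne_zero
    have hu : u = Units.mk0 _ hq0 * Units.mk0 _ hc0 := by
      apply Units.ext; rw [← h2]; simp
    have : ∀ v : HeightOneSpectrum (𝓞 K), v.valuation K ((c : K) * (y / u : Kˣ)) ≤ 1 := by
      intro v
      have := od_le v (Units.mk0 _ hc0 * (y / u))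
      refine this.mp ?_
      by_cases hv : (q : 𝓞 K) ∈ v.asIdeal
      · rw [od_mul]
        exact add_nonneg (od_nat v _ rfl).1 (h v hv)
      · have e : Units.mk0 _ hc0 * (y / u) = y / Units.mk0 _ hq0 := by
          rw [hu, mul_comm (Units.mk0 _ hq0), ← div_div, mul_comm, div_right_comm, div_mul_cancel]
        rw [e, div_eq_mul_inv, od_mul, od_inv, (od_nat v (Units.mk0 _ hq0) rfl).2.mpr ?_, neg_zero, add_zero]
        · rw [od_le, ← h1]; exact HeightOneSpectrum.valuation_le_one v a
        · intro hm
          rw [Nat.cast_pow] at hm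
          exact hv (v.isPrime.mem_of_pow_mem _ hm)
    obtain ⟨t, ht⟩ := HeightOneSpectrum.mem_integers_of_valuation_le_one K _ this
    rw [← ht]
    exact t.2
end
end MN

namespace MN
set_option linter.unusedSectionVars false
set_option linter.unusedSimpArgs false
open scoped TensorProduct Pointwise
open IsDedekindDomain NumberField

section
variable {A : Type*} [CommGroup A]

lemma iter_prod (s : A →* A) (d k : ℕ) (f : ℕ → A) :
    s^[k] (∏ j ∈ Finset.range d, f j) = ∏ j ∈ Finset.range d, s^[k] (f j) := by
  induction k with
  | zero => rfl
  | succ k ih => simp only [Function.iterate_succ_apply', ih, map_prod]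

/-- orbit elements -/
noncomputable def ow (s : A →* A) (g d : ℕ) (x0 : A) (i : ZMod g) : A :=
  s^[i.val] (∏ j ∈ Finset.range d, s^[g * j] x0)

lemma ow_succ (s : A →* A) {g d n : ℕ} [NeZero g] (hgd : g * d = n) (hn : ∀ x, s^[n] x = x) (x0 : A) (i : ZMod g) :
    s (ow s g d x0 i) = ow s g d x0 (i + 1) := by
  unfold ow
  set X := ∏ j ∈ Finset.range d, s^[g * j] x0 with hX
  have hit := iter_prod s d
  have hg : s^[g] X = X := by
    rw [hX, hit]
    have h1 : ∀ j, s^[g] (s^[g * j] x0) = s^[g * (j + 1)] x0 := by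
      intro j; rw [← Function.iterate_add_apply]; congr 1; rw [mul_add, mul_one, add_comm]
    simp only [h1]
    have h2 := Finset.prod_range_succ' (fun j => s^[g * j] x0) d
    rw [Finset.prod_range_succ, hgd, hn] at h2
    simpa using h2.symm
  have hper : Function.IsPeriodicPt s g X := hg
  have e : (i + 1).val = (i.val + 1) % g := by
    rw [ZMod.val_add, ZMod.val_one_eq_one_mod, Nat.add_mod_mod]
  rw [← Function.iterate_succ_apply' s, e]
  exact (hper.iterate_mod_apply _).symm

lemma ow_f {Ω R : Type*} [AddCommGroup R] (s : A →* A) {g d : ℕ} [NeZero g] (x0 : A)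
    (f : Ω → A → R) (hf : ∀ v x y, f v (x * y) = f v x + f v y) (t : Ω → Ω)
    (hft : ∀ v x, f (t v) (s x) = f v x) (v : ZMod g → Ω) (hv : ∀ i, v (i + 1) = t (v i)) (k i : ZMod g) :
    f (v k) (ow s g d x0 i) = d • f (v (k - i)) x0 := by
  have h1 : ∀ (m : ℕ) (l : ZMod g) x, f (v (l + m)) (s^[m] x) = f (v l) x := by
    intro m
    induction m with
    | zero => intro l x; simp
    | succ m ih =>
      intro l x
      rw [Function.iterate_succ_apply', Nat.cast_succ, ← add_assoc, hv, hft, ih]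
  have hk : k = (k - i) + ((i.val : ℕ) : ZMod g) := by simp
  unfold ow
  conv_lhs => rw [hk]
  rw [h1]
  have h0 : ∀ v, f v 1 = 0 := by
    intro v; have := hf v 1 1; rw [mul_one] at this; simpa using this
  have h2 : ∀ (F : ℕ → A) (m : ℕ) (l : Ω), f l (∏ j ∈ Finset.range m, F j) = ∑ j ∈ Finset.range m, f l (F j) := by
    intro F m l
    induction m with
    | zero => simp [h0]
    | succ m ih => rw [Finset.prod_range_succ, hf, ih, Finset.sum_range_succ]
  rw [h2]
  have h3 : ∀ j, f (v (k - i)) (s^[g * j] x0) = f (v (k - i)) x0 := by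
    intro j
    have := h1 (g * j) (k - i) x0
    simpa using this
  simp [h3]

lemma ow_prod (s : A →* A) {g d n : ℕ} [NeZero g] (hgd : g * d = n) (x0 : A) :
    ∏ i : ZMod g, ow s g d x0 i = ∏ k ∈ Finset.range n, s^[k] x0 := by
  have hit := iter_prod s d
  unfold ow
  simp only [hit, ← Function.iterate_add_apply]
  have h1 : ∏ i : ZMod g, ∏ j ∈ Finset.range d, s^[i.val + g * j] x0
      = ∏ i ∈ Finset.range g, ∏ j ∈ Finset.range d, s^[i + g * j] x0 := by
    refine Finset.prod_bij (fun i _ => i.val) (fun i _ => Finset.mem_range.mpr (ZMod.val_lt i))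
      (fun i _ j _ h => ZMod.val_injective g h) (fun b hb => ⟨(b : ZMod g), Finset.mem_univ _, ?_⟩) (fun _ _ => rfl)
    exact ZMod.val_cast_of_lt (Finset.mem_range.mp hb)
  rw [h1, Finset.prod_comm, ← hgd, mul_comm g d]
  clear hgd h1
  induction d with
  | zero => simp
  | succ d ih =>
    rw [Finset.prod_range_succ, ih, Nat.succ_mul, Finset.prod_range_add]
    · congr 1
      refine Finset.prod_congr rfl fun i _ => ?_
      rw [add_comm, mul_comm]
    · exact iter_prod s d
end
end MN

namespace MN
set_option linter.unusedSectionVars false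
set_option linter.unusedSimpArgs false
open scoped TensorProduct Pointwise
open IsDedekindDomain NumberField

section
variable {K : Type} [Field K] [NumberField K]

lemma sv_inv (σ : K ≃ₐ[ℚ] K) (u : HeightOneSpectrum (𝓞 K)) : sv σ (sv σ⁻¹ u) = u :=
  HeightOneSpectrum.ext (smul_inv_smul σ u.asIdeal)

lemma nat_mem_sv (σ : K ≃ₐ[ℚ] K) (u : HeightOneSpectrum (𝓞 K)) (q : ℕ) :
    (q : 𝓞 K) ∈ (sv σ u).asIdeal ↔ (q : 𝓞 K) ∈ u.asIdeal := by
  have : (q : 𝓞 K) = σ • (q : 𝓞 K) := by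
    apply RingOfIntegers.ext
    change ((q : 𝓞 K) : K) = σ ((q : 𝓞 K) : K)
    have h : ((q : 𝓞 K) : K) = (q : K) := map_natCast (algebraMap (𝓞 K) K) q
    rw [h, map_natCast]
  change _ ∈ σ • u.asIdeal ↔ _
  rw [this, Ideal.smul_mem_pointwise_smul_iff, ← this]

lemma sv_iter (σ : K ≃ₐ[ℚ] K) (u : HeightOneSpectrum (𝓞 K)) (k : ℕ) : (sv σ)^[k] u = sv (σ ^ k) u := by
  induction k with
  | zero => exact HeightOneSpectrum.ext (by simp [sv])
  | succ k ih =>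
    rw [Function.iterate_succ_apply', ih]
    exact HeightOneSpectrum.ext (by simp [sv, pow_succ', mul_smul])

lemma liesOver_of_mem {q : ℕ} (hq : q.Prime) (P : Ideal (𝓞 K)) (hP : P ≠ ⊤) (h : (q : 𝓞 K) ∈ P) :
    P.LiesOver (Ideal.span {(q : ℤ)}) := by
  have hm : (Ideal.span {(q : ℤ)}).IsMaximal :=
    ((Ideal.span_singleton_prime (by exact_mod_cast hq.ne_zero)).mpr
      (Nat.prime_iff_prime_int.mp hq)).isMaximal (by simp [hq.ne_zero])
  refine ⟨hm.eq_of_le ?_ ?_⟩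
  · rw [Ne, Ideal.eq_top_iff_one]
    intro h1
    apply hP
    rw [Ideal.eq_top_iff_one]
    simpa [Ideal.under] using h1
  · rw [Ideal.span_singleton_le_iff_mem]
    simpa [Ideal.under] using h

lemma mem_of_liesOver {q : ℕ} (P : Ideal (𝓞 K)) (h : P.LiesOver (Ideal.span {(q : ℤ)})) : (q : 𝓞 K) ∈ P := by
  have h1 : (q : ℤ) ∈ P.under ℤ := by rw [← h.over]; exact Ideal.mem_span_singleton_self _
  simpa [Ideal.under] using h1

lemma exists_over {q : ℕ} (hq : q.Prime) : ∃ v : HeightOneSpectrum (𝓞 K), (q : 𝓞 K) ∈ v.asIdeal := by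
  have hm : (Ideal.span {(q : ℤ)}).IsMaximal :=
    ((Ideal.span_singleton_prime (by exact_mod_cast hq.ne_zero)).mpr
      (Nat.prime_iff_prime_int.mp hq)).isMaximal (by simp [hq.ne_zero])
  obtain ⟨Q, hQ, hl⟩ := Ideal.exists_maximal_ideal_liesOver_of_isIntegral (S := 𝓞 K) (Ideal.span {(q : ℤ)})
  have h1 := mem_of_liesOver Q hl
  refine ⟨⟨Q, hQ.isPrime, ?_⟩, h1⟩
  rintro rfl
  rw [Ideal.mem_bot, Nat.cast_eq_zero] at h1
  exact hq.ne_zero h1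

lemma exists_pi (v : HeightOneSpectrum (𝓞 K)) : ∃ (h : ℕ) (x : Kˣ), h ≠ 0 ∧ od v x = h ∧ ∀ u, u ≠ v → od u x = 0 := by
  have hv : v.asIdeal ∈ nonZeroDivisors (Ideal (𝓞 K)) := mem_nonZeroDivisors_of_ne_zero v.ne_bot
  set h := Fintype.card (ClassGroup (𝓞 K)) with hh
  have hp : ClassGroup.mk0 ⟨v.asIdeal ^ h, pow_mem hv h⟩ = 1 := by
    have : (⟨v.asIdeal ^ h, pow_mem hv h⟩ : nonZeroDivisors (Ideal (𝓞 K))) = ⟨_, hv⟩ ^ h := rfl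
    rw [this, map_pow, hh, pow_card_eq_one]
  rw [ClassGroup.mk0_eq_one_iff] at hp
  obtain ⟨r, hr⟩ := hp.principal
  have hr' : v.asIdeal ^ h = Ideal.span {r} := hr
  have hr0 : (r : K) ≠ 0 := by
    intro e
    have : r = 0 := RingOfIntegers.ext e
    rw [this, Ideal.span_singleton_eq_bot.mpr rfl] at hr'
    exact pow_ne_zero h v.ne_bot hr'
  have h0 : h ≠ 0 := Fintype.card_ne_zero
  refine ⟨h, Units.mk0 _ hr0, h0, ?_, ?_⟩
  · have key : ∀ k : ℕ, (k : ℤ) ≤ od v (Units.mk0 _ hr0) ↔ k ≤ h := by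
      intro k
      rw [od_mem v _ r rfl, ← Ideal.span_singleton_le_iff_mem, ← hr']
      exact (Ideal.pow_right_strictAnti _ v.ne_bot v.isPrime.ne_top).le_iff_ge
    have h1 := (key h).mpr le_rfl
    have h2 := key (od v (Units.mk0 _ hr0)).toNat
    have h3 : (od v (Units.mk0 _ hr0)).toNat ≤ h := h2.mp (by omega)
    omega
  · intro u hu
    have h1 : 0 ≤ od u (Units.mk0 _ hr0) := by rw [od_le]; exact HeightOneSpectrum.valuation_le_one u r
    by_contra hne
    have h2 : ((1 : ℕ) : ℤ) ≤ od u (Units.mk0 _ hr0) := by push_cast; omega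
    rw [od_mem u _ r rfl, ← Ideal.span_singleton_le_iff_mem, ← hr', pow_one] at h2
    have h3 := u.isPrime.le_of_pow_le h2
    exact hu (HeightOneSpectrum.ext ((v.isPrime.isMaximal v.ne_bot).eq_of_le u.isPrime.ne_top h3).symm)

/-- data at a prime -/
structure ED (σ : K ≃ₐ[ℚ] K) (q : ℕ) where
  g : ℕ
  d : ℕ
  g0 : NeZero g
  d0 : d ≠ 0
  gd : g * d = Module.finrank ℚ K
  v : ZMod g → HeightOneSpectrum (𝓞 K)
  vinj : Function.Injective v
  vmem : ∀ u, (q : 𝓞 K) ∈ u.asIdeal ↔ ∃ i, v i = u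
  w : ZMod g → Kˣ
  hw : ∀ i, Units.map (σ : K →* K) (w i) = w (i + 1)
  e : ℕ
  e0 : e ≠ 0
  od1 : ∀ i, od (v i) (w i) = e
  od0 : ∀ k i, k ≠ i → od (v k) (w i) = 0
  od2 : ∀ u, (q : 𝓞 K) ∉ u.asIdeal → ∀ i, od u (w i) = 0

variable [IsGalois ℚ K]

lemma us_iter {σ : K ≃ₐ[ℚ] K} (hσ : ∀ x, x ∈ Subgroup.zpowers σ) (x : Kˣ) :
    (Units.map (σ : K →* K))^[Module.finrank ℚ K] x = x := by
  have h : ∀ k : ℕ, (((Units.map (σ : K →* K))^[k] x : Kˣ) : K) = (σ ^ k) (x : K) := by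
    intro k
    induction k with
    | zero => simp
    | succ k ih => rw [Function.iterate_succ_apply', Units.coe_map, ih, pow_succ']; rfl
  apply Units.ext
  rw [h, sig_pow hσ rfl]; rfl

theorem exists_ED {σ : K ≃ₐ[ℚ] K} (hσ : ∀ x, x ∈ Subgroup.zpowers σ) {q : ℕ} (hq : q.Prime) : Nonempty (ED σ q) := by
  let Ω := {v : HeightOneSpectrum (𝓞 K) // (q : 𝓞 K) ∈ v.asIdeal}
  let t : Ω → Ω := fun v => ⟨sv σ v.1, (nat_mem_sv σ _ q).mpr v.2⟩
  have ht : ∀ (k : ℕ) (v : Ω), ((t^[k] v : Ω) : HeightOneSpectrum (𝓞 K)) = sv (σ ^ k) v.1 := by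
    intro k v
    rw [← sv_iter]
    induction k with
    | zero => rfl
    | succ k ih => rw [Function.iterate_succ_apply', Function.iterate_succ_apply', ← ih]
  obtain ⟨v0, hv0⟩ := exists_over (K := K) hq
  have hm : (Ideal.span {(q : ℤ)}).IsMaximal :=
    ((Ideal.span_singleton_prime (by exact_mod_cast hq.ne_zero)).mpr
      (Nat.prime_iff_prime_int.mp hq)).isMaximal (by simp [hq.ne_zero])
  obtain ⟨g, d, hg, hd, hgd, v, hv, hvs⟩ := orb (⟨v0, hv0⟩ : Ω) t (n := Module.finrank ℚ K)
    Module.finrank_pos.ne' (by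
      intro x
      apply Subtype.ext
      rw [ht, sig_pow hσ rfl]
      exact HeightOneSpectrum.ext (by simp [sv])) (by
      intro y
      have l1 := liesOver_of_mem hq v0.asIdeal v0.isPrime.ne_top hv0
      have l2 := liesOver_of_mem hq y.1.asIdeal y.1.isPrime.ne_top y.2
      have p1 := v0.isPrime
      have p2 := y.1.isPrime
      obtain ⟨τ, hτ⟩ := Ideal.exists_smul_eq_of_isGaloisGroup (Ideal.span {(q : ℤ)}) v0.asIdeal y.1.asIdeal (K ≃ₐ[ℚ] K)
      obtain ⟨k, hk⟩ := (mem_powers_iff_mem_zpowers.mpr (hσ τ))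
      refine ⟨k, Subtype.ext ?_⟩
      rw [ht]
      have hk' : σ ^ k = τ := hk
      rw [hk']
      exact HeightOneSpectrum.ext hτ)
  have g0 : NeZero g := ⟨hg⟩
  obtain ⟨h, x0, h0, hx1, hx2⟩ := exists_pi (v 0).1
  set s : Kˣ →* Kˣ := Units.map (σ : K →* K) with hs
  have hf := ow_f s (d := d) x0 od od_mul (sv σ) (od_sv σ) (fun i => (v i).1) (fun i => by
    have := congrArg Subtype.val (hvs i)
    exact this)
  refine ⟨⟨g, d, g0, hd, hgd, fun i => (v i).1, Subtype.val_injective.comp hv.1, ?_, ow s g d x0,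
    ow_succ s hgd (us_iter hσ) x0, d * h, mul_ne_zero hd h0, ?_, ?_, ?_⟩⟩
  · intro u
    constructor
    · intro hu
      obtain ⟨i, hi⟩ := hv.2 ⟨u, hu⟩
      exact ⟨i, congrArg Subtype.val hi⟩
    · rintro ⟨i, rfl⟩; exact (v i).2
  · intro i
    rw [hf i i]; simp [hx1]
  · intro k i hki
    rw [hf k i, hx2 _ ?_, smul_zero]
    intro e
    have := hv.1 (Subtype.ext e)
    exact hki (sub_eq_zero.mp this)
  · intro u hu i
    let P : Kˣ → Prop := fun y => ∀ u : HeightOneSpectrum (𝓞 K), (q : 𝓞 K) ∉ u.asIdeal → od u y = 0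
    have hPs : ∀ y, P y → P (s y) := by
      intro y hy u hu
      rw [← sv_inv σ u, hs, od_sv]
      exact hy _ (by rwa [nat_mem_sv])
    have hPk : ∀ k y, P y → P (s^[k] y) := by
      intro k y hy
      induction k with
      | zero => exact hy
      | succ k ih => rw [Function.iterate_succ_apply']; exact hPs _ ih
    have hP0 : P x0 := by
      intro u hu
      refine hx2 u ?_
      rintro rfl
      exact hu (v 0).2
    refine hPk _ _ ?_ u hu
    intro u hu
    rw [od_prod]
    exact Finset.sum_eq_zero fun j _ => hPk _ _ hP0 u hu
end
end MN

namespace MN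
set_option linter.unusedSectionVars false
set_option linter.unusedSimpArgs false
open scoped TensorProduct Pointwise
open IsDedekindDomain NumberField

section
variable {K : Type} [Field K] [NumberField K]

lemma not_two {q r : ℕ} (hq : q.Prime) (hr : r.Prime) (h : q ≠ r) (v : HeightOneSpectrum (𝓞 K))
    (hv : (q : 𝓞 K) ∈ v.asIdeal) : (r : 𝓞 K) ∉ v.asIdeal :=
  od_nat_zero v hq hv (fun hd => h ((Nat.prime_dvd_prime_iff_eq hq hr).mp hd))

namespace ED
variable {σ : K ≃ₐ[ℚ] K} {q : ℕ} (D : ED σ q)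

instance : NeZero D.g := D.g0

lemma od_phi (k : ZMod D.g) (a : ZMod D.g → ℤ) :
    od (D.v k) (phi D.w (Multiplicative.ofAdd a)) = a k * D.e := by
  rw [phi_apply, od_prod, Finset.sum_eq_single k]
  · rw [od_zpow, D.od1]
  · intro i _ hi; rw [od_zpow, D.od0 k i hi.symm, mul_zero]
  · simp

lemma od_phi' (u : HeightOneSpectrum (𝓞 K)) (hu : (q : 𝓞 K) ∉ u.asIdeal) (a : ZMod D.g → ℤ) :
    od u (phi D.w (Multiplicative.ofAdd a)) = 0 := by
  rw [phi_apply, od_prod]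
  exact Finset.sum_eq_zero fun i _ => by rw [od_zpow, D.od2 u hu, mul_zero]

lemma a_zero (a : ZMod D.g → ℤ) (h : ∀ k, od (D.v k) (phi D.w (Multiplicative.ofAdd a)) = 0) : a = 0 := by
  funext k
  have := h k
  rw [D.od_phi] at this
  exact (mul_eq_zero.mp this).resolve_right (by exact_mod_cast D.e0)

lemma hind (a : ZMod D.g → ℤ) (h : phi D.w (Multiplicative.ofAdd a) = 1) : a = 0 :=
  D.a_zero a fun k => by rw [h, od_one]

lemma index [IsGalois ℚ K] [hq : Fact q.Prime] (hσ : ∀ x, x ∈ Subgroup.zpowers σ) :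
    (NG ℚ_[q] K).index ≠ 0 ∧ D.d ∣ (NG ℚ_[q] K).index := by
  have he : (0 : ℤ) < D.e := by exact_mod_cast Nat.pos_of_ne_zero D.e0
  refine local_index hσ D.d0 D.gd D.w D.hw ?_ D.e ?_
  · intro a h1 h2
    refine D.a_zero a fun k => ?_
    have hk := (D.vmem (D.v k)).mpr ⟨k, rfl⟩
    have h1' := (mem_Rq _).mp h1 _ hk
    have h2' := (mem_Rq _).mp h2 _ hk
    rw [od_inv] at h2'
    omega
  · intro κ
    have hq0 : ((q : ℕ) : K) ≠ 0 := Nat.cast_ne_zero.mpr hq.out.ne_zero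
    set a : ZMod D.g → ℤ := fun k => -(od (D.v k) κ / D.e) with ha
    have hod : ∀ k, od (D.v k) (phi D.w (Multiplicative.ofAdd a) * κ) = od (D.v k) κ % D.e := by
      intro k
      rw [od_mul, od_phi, ha, Int.emod_def]; ring
    refine ⟨phi D.w (Multiplicative.ofAdd a), ⟨_, rfl⟩, ?_, ?_⟩
    · rw [mem_Rq]
      intro u hu
      obtain ⟨k, rfl⟩ := (D.vmem u).mp hu
      rw [hod]; exact Int.emod_nonneg _ he.ne'
    · have : (q : K) ^ D.e * (((phi D.w (Multiplicative.ofAdd a) * κ)⁻¹ : Kˣ) : K)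
        = ((Units.mk0 _ hq0 ^ (D.e : ℤ) * (phi D.w (Multiplicative.ofAdd a) * κ)⁻¹ : Kˣ) : K) := by
        simp
      rw [this, mem_Rq]
      intro u hu
      have h1 := od_nat u (Units.mk0 _ hq0) rfl
      have h2 : od u (Units.mk0 _ hq0) ≠ 0 := fun h => h1.2.mp h hu
      have h3 : 1 ≤ od u (Units.mk0 _ hq0) := by omega
      obtain ⟨k, rfl⟩ := (D.vmem u).mp hu
      have h4 := Int.emod_lt_of_pos (od (D.v k) κ) he
      rw [od_mul, od_inv, od_zpow, hod]
      nlinarith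
end ED

/-- S-units -/
def US (K : Type) [Field K] [NumberField K] (S : Finset ℕ) : Subgroup Kˣ where
  carrier := {x | ∀ v : HeightOneSpectrum (𝓞 K), (∀ q ∈ S, (q : 𝓞 K) ∉ v.asIdeal) → od v x = 0}
  mul_mem' := by intro a b ha hb v hv; rw [od_mul, ha v hv, hb v hv, add_zero]
  one_mem' := fun v _ => od_one v
  inv_mem' := by intro a ha v hv; rw [od_inv, ha v hv, neg_zero]

lemma US_stable (σ : K ≃ₐ[ℚ] K) (S : Finset ℕ) : ∀ x ∈ US K S, Units.map (σ : K →* K) x ∈ US K S := by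
  intro x hx v hv
  rw [← sv_inv σ v, od_sv]
  exact hx _ fun q hq => by rw [nat_mem_sv]; exact hv q hq

/-- h0 -/
noncomputable def H0 (σ : K ≃ₐ[ℚ] K) (B : Subgroup Kˣ) : ℕ :=
  hb (Dl (Units.map (σ : K →* K))) (Nm (Units.map (σ : K →* K)) (Module.finrank ℚ K)) B
/-- h1 -/
noncomputable def H1 (σ : K ≃ₐ[ℚ] K) (B : Subgroup Kˣ) : ℕ :=
  hb (Nm (Units.map (σ : K →* K)) (Module.finrank ℚ K)) (Dl (Units.map (σ : K →* K))) B

variable [IsGalois ℚ K]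

/-- chosen data -/
noncomputable def Dd {σ : K ≃ₐ[ℚ] K} (hσ : ∀ x, x ∈ Subgroup.zpowers σ) (q : ℕ) (hq : q.Prime) : ED σ q :=
  Classical.choice (exists_ED hσ hq)

open Classical in
/-- local degree -/
noncomputable def dq {σ : K ≃ₐ[ℚ] K} (hσ : ∀ x, x ∈ Subgroup.zpowers σ) (q : ℕ) : ℕ :=
  if h : q.Prime then (Dd hσ q h).d else 1

lemma dq_index {σ : K ≃ₐ[ℚ] K} (hσ : ∀ x, x ∈ Subgroup.zpowers σ) (q : ℕ) [hq : Fact q.Prime] :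
    (NG ℚ_[q] K).index ≠ 0 ∧ dq hσ q ∣ (NG ℚ_[q] K).index := by
  rw [dq, dif_pos hq.out]; exact (Dd hσ q hq.out).index hσ

theorem US_step {σ : K ≃ₐ[ℚ] K} (hσ : ∀ x, x ∈ Subgroup.zpowers σ) (S : Finset ℕ)
    (hS : ∀ q ∈ S, q.Prime) (q : ℕ) (hq : q.Prime) (hqS : q ∉ S)
    (h0 : H0 σ (US K S) ≠ 0) (h1 : H1 σ (US K S) ≠ 0) :
    H0 σ (US K (insert q S)) ≠ 0 ∧ H1 σ (US K (insert q S)) ≠ 0 ∧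
    H0 σ (US K (insert q S)) * H1 σ (US K S) = (H0 σ (US K S) * dq hσ q) * H1 σ (US K (insert q S)) := by
  set D := Dd hσ q hq with hD
  have hd : dq hσ q = D.d := by rw [dq, dif_pos hq]
  set s : Kˣ →* Kˣ := Units.map (σ : K →* K) with hs
  set n := Module.finrank ℚ K with hn
  have hit : ∀ x, s^[n] x = x := us_iter hσ
  set E := (phi D.w).range with hE
  have hEs : ∀ x ∈ E, s x ∈ E := stable_phi D.hw
  have hUs := US_stable σ S
  have hVs := US_stable σ (insert q S)
  have hUV : US K S ≤ US K (insert q S) := by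
    intro x hx v hv
    exact hx v fun r hr => hv r (Finset.mem_insert_of_mem hr)
  have hEV : E ≤ US K (insert q S) := by
    rintro x ⟨a, rfl⟩ v hv
    exact D.od_phi' v (hv q (Finset.mem_insert_self _ _)) a.toAdd
  have hvS : ∀ k, ∀ r ∈ S, (r : 𝓞 K) ∉ (D.v k).asIdeal := by
    intro k r hr
    refine not_two hq (hS r hr) (fun e => hqS (e ▸ hr)) _ ((D.vmem _).mpr ⟨k, rfl⟩)
  have hdis : Disjoint (US K S) E := by
    rw [Subgroup.disjoint_def]
    rintro x hx ⟨a, rfl⟩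
    have : a.toAdd = 0 := D.a_zero a.toAdd fun k => hx _ (hvS k)
    have e : a = 1 := this
    rw [e, map_one]
  have hne : NeZero D.e := ⟨D.e0⟩
  have hfin : (US K S ⊔ E).relIndex (US K (insert q S)) ≠ 0 := by
    let ψ : Kˣ →* Multiplicative (ZMod D.g → ZMod D.e) :=
      { toFun := fun x => Multiplicative.ofAdd fun i => ((od (D.v i) x : ℤ) : ZMod D.e)
        map_one' := by simp [od_one]; rfl
        map_mul' := by
          intro x y
          simp only [od_mul, Int.cast_add]; rfl }
    have h2 : ψ.ker ⊓ US K (insert q S) ≤ US K S ⊔ E := by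
      rintro x ⟨hx, hxV⟩
      have hx' : ∀ i, ((od (D.v i) x : ℤ) : ZMod D.e) = 0 := fun i =>
        congrFun (congrArg Multiplicative.toAdd (MonoidHom.mem_ker.mp hx)) i
      simp only [ZMod.intCast_zmod_eq_zero_iff_dvd] at hx'
      choose a ha using hx'
      have : x = (x * (phi D.w (Multiplicative.ofAdd a))⁻¹) * phi D.w (Multiplicative.ofAdd a) := by group
      rw [this]
      refine Subgroup.mul_mem_sup ?_ ⟨_, rfl⟩
      intro v hv
      by_cases hqv : (q : 𝓞 K) ∈ v.asIdeal
      · obtain ⟨k, rfl⟩ := (D.vmem v).mp hqv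
        rw [od_mul, od_inv, D.od_phi, ha k]; ring
      · rw [od_mul, od_inv, D.od_phi' v hqv, hxV v ?_]
        · simp
        · intro r hr
          rcases Finset.mem_insert.mp hr with rfl | hr
          · exact hqv
          · exact hv r hr
    have h3 : ψ.ker.relIndex (US K (insert q S)) ≠ 0 := by
      rw [Subgroup.relIndex_ker]
      exact Nat.card_ne_zero.mpr ⟨⟨1⟩, inferInstance⟩
    rw [← Subgroup.inf_relIndex_right] at h3
    intro h
    have := Subgroup.relIndex_dvd_of_le_left (US K (insert q S)) h2
    rw [h] at this
    exact h3 (Nat.eq_zero_of_zero_dvd this)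
  have e1 := hb_sup (Dl s) (Nm s n) (Dl_Nm s hit) (stable_Dl s hUs) (stable_Nm s hUs n)
    (stable_Dl s hEs) (stable_Nm s hEs n) hdis
  have e2 := hb_sup (Nm s n) (Dl s) (Nm_Dl s hit) (stable_Nm s hUs n) (stable_Dl s hUs)
    (stable_Nm s hEs n) (stable_Dl s hEs) hdis
  have e3 := hbE D.hw D.hind D.d D.d0
  rw [D.gd] at e3
  have e3a : hb (Dl s) (Nm s n) E = D.d := e3.1
  have e3b : hb (Nm s n) (Dl s) E = 1 := e3.2
  rw [e3a] at e1
  rw [e3b, mul_one] at e2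
  have hsup : US K S ⊔ E ≤ US K (insert q S) := sup_le hUV hEV
  have hBD := map_sup_le (stable_Dl s hUs) (stable_Dl s hEs)
  have hBN := map_sup_le (stable_Nm s hUs n) (stable_Nm s hEs n)
  have e4 := hb_lemma (Dl_Nm s hit) (Nm_Dl s hit) hsup hBD hBN (stable_Dl s hVs) (stable_Nm s hVs n) hfin
  rw [e1, e2] at e4
  refine ⟨?_, ?_, ?_⟩
  · refine hb_ne_zero (Dl_Nm s hit) hsup hBN (stable_Nm s hVs n) hfin ?_
    rw [e1]; exact mul_ne_zero h0 D.d0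
  · refine hb_ne_zero (Nm_Dl s hit) hsup hBD (stable_Dl s hVs) hfin ?_
    rw [e2]; exact h1
  · rw [hd]; exact e4

theorem US_H {σ : K ≃ₐ[ℚ] K} (hσ : ∀ x, x ∈ Subgroup.zpowers σ) (gi : ℕ)
    (hi : H0 σ (US K ∅) * gi = H1 σ (US K ∅)) (hi1 : H0 σ (US K ∅) ≠ 0) (hi2 : H1 σ (US K ∅) ≠ 0)
    (S : Finset ℕ) (hS : ∀ q ∈ S, q.Prime) :
    H0 σ (US K S) ≠ 0 ∧ H1 σ (US K S) ≠ 0 ∧ H0 σ (US K S) * gi = (∏ q ∈ S, dq hσ q) * H1 σ (US K S) := by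
  induction S using Finset.induction_on with
  | empty => exact ⟨hi1, hi2, by simpa using hi⟩
  | insert q S hq ih =>
    obtain ⟨a, b, c⟩ := ih fun r hr => hS r (Finset.mem_insert_of_mem hr)
    obtain ⟨a', b', c'⟩ := US_step hσ S (fun r hr => hS r (Finset.mem_insert_of_mem hr)) q
      (hS q (Finset.mem_insert_self _ _)) hq a b
    refine ⟨a', b', ?_⟩
    rw [Finset.prod_insert hq]
    have : (H0 σ (US K (insert q S)) * gi) * H1 σ (US K S) =
        (dq hσ q * ∏ r ∈ S, dq hσ r) * H1 σ (US K (insert q S)) * H1 σ (US K S) := by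
      calc _ = (H0 σ (US K (insert q S)) * H1 σ (US K S)) * gi := by ring
        _ = (H0 σ (US K S) * gi) * dq hσ q * H1 σ (US K (insert q S)) := by rw [c']; ring
        _ = _ := by rw [c]; ring
    exact Nat.eq_of_mul_eq_mul_right (Nat.pos_of_ne_zero b) this
end
end MN

namespace MN
set_option linter.unusedSectionVars false
set_option linter.unusedSimpArgs false
open scoped TensorProduct Pointwise
open IsDedekindDomain NumberField

section
variable {K : Type} [Field K] [NumberField K]

/-- units -/
noncomputable def ju (K : Type) [Field K] [NumberField K] : (𝓞 K)ˣ →* Kˣ := Units.map (algebraMap (𝓞 K) K)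

lemma ju_inj : Function.Injective (ju K) := Units.map_injective RingOfIntegers.coe_injective

lemma ju_range : (ju K).range = US K ∅ := by
  ext x
  constructor
  · rintro ⟨u, rfl⟩ v -
    have h1 : 0 ≤ od v (ju K u) := by rw [od_le]; exact HeightOneSpectrum.valuation_le_one v _
    have h2 : 0 ≤ od v (ju K u⁻¹) := by rw [od_le]; exact HeightOneSpectrum.valuation_le_one v _
    rw [map_inv, od_inv] at h2
    omega
  · intro hx
    have h : ∀ v : HeightOneSpectrum (𝓞 K), od v x = 0 := fun v => hx v (by simp)
    obtain ⟨a, ha⟩ := HeightOneSpectrum.mem_integers_of_valuation_le_one (R := 𝓞 K) K x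
      (fun v => (od_le v x).mp (h v).ge)
    obtain ⟨b, hb⟩ := HeightOneSpectrum.mem_integers_of_valuation_le_one (R := 𝓞 K) K ((x⁻¹ : Kˣ) : K)
      (fun v => (od_le v _).mp (by rw [od_inv, h v, neg_zero]))
    have hab : a * b = 1 := by
      apply RingOfIntegers.coe_injective
      rw [map_mul, ha, hb]; simp
    exact ⟨⟨a, b, hab, by rw [mul_comm, hab]⟩, Units.ext ha⟩

/-- const lemma -/
lemma const_of_neg {g : ℕ} [NeZero g] (A : ZMod g → ZMod g → ℝ) (hA : ∀ k i, k ≠ i → A k i < 0)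
    (hs : ∀ k, ∑ i, A k i = 0) (a : ZMod g → ℝ) (ha : ∀ k, ∑ i, a i * A k i = 0) : ∀ i j, a i = a j := by
  obtain ⟨k, -, hk⟩ := Finset.exists_max_image (Finset.univ : Finset (ZMod g)) a ⟨0, Finset.mem_univ _⟩
  have h1 : ∑ i, (a i - a k) * A k i = 0 := by
    simp only [sub_mul, Finset.sum_sub_distrib, ha, ← Finset.mul_sum, hs]; simp
  have h2 : ∀ i ∈ Finset.univ, 0 ≤ (a i - a k) * A k i := by
    intro i hi
    by_cases h : k = i
    · subst h; simp
    · exact mul_nonneg_of_nonpos_of_nonpos (sub_nonpos.mpr (hk i hi)) (hA k i h).le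
  have h3 := (Finset.sum_eq_zero_iff_of_nonneg h2).mp h1
  have h4 : ∀ i, a i = a k := by
    intro i
    by_cases h : k = i
    · rw [h]
    · exact sub_eq_zero.mp ((mul_eq_zero.mp (h3 i (Finset.mem_univ _))).resolve_right (hA k i h).ne)
  intro i j; rw [h4, h4 j]

variable [IsGalois ℚ K]

lemma us_iter' (σ : K ≃ₐ[ℚ] K) (x : Kˣ) (k : ℕ) :
    (((Units.map (σ : K →* K))^[k] x : Kˣ) : K) = (σ ^ k) (x : K) := by
  induction k with
  | zero => simp
  | succ k ih => rw [Function.iterate_succ_apply', Units.coe_map, ih, pow_succ']; rfl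

lemma Nm_norm {σ : K ≃ₐ[ℚ] K} (hσ : ∀ x, x ∈ Subgroup.zpowers σ) (x : Kˣ) :
    ((Nm (Units.map (σ : K →* K)) (Module.finrank ℚ K) x : Kˣ) : K) = algebraMap ℚ K (Algebra.norm ℚ (x : K)) := by
  rw [Algebra.norm_eq_prod_automorphisms, prod_cyc hσ, Nm_apply, Units.coe_prod, card_n hσ rfl]
  exact Finset.prod_congr rfl fun i _ => us_iter' _ _ _

lemma norm_unit (u : (𝓞 K)ˣ) : (Algebra.norm ℚ ((u : 𝓞 K) : K)) ^ 2 = 1 := by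
  have := NumberField.isUnit_iff_norm.mp u.isUnit
  rw [RingOfIntegers.coe_norm] at this
  rw [← sq_abs, this, one_pow]

theorem base_H {σ : K ≃ₐ[ℚ] K} (hσ : ∀ x, x ∈ Subgroup.zpowers σ) :
    (∃ d, Fintype.card (InfinitePlace K) * d = Module.finrank ℚ K) ∧
    H0 σ (US K ∅) * Fintype.card (InfinitePlace K) = H1 σ (US K ∅) ∧ H0 σ (US K ∅) ≠ 0 ∧ H1 σ (US K ∅) ≠ 0 := by
  have hti : ∀ (k : ℕ) (v : InfinitePlace K), (fun v : InfinitePlace K => σ • v)^[k] v = σ ^ k • v := by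
    intro k v
    induction k with
    | zero => simp
    | succ k ih => rw [Function.iterate_succ_apply', ih, pow_succ', mul_smul]
  obtain ⟨v0⟩ : Nonempty (InfinitePlace K) := inferInstance
  obtain ⟨g, d, hg, hd, hgd, v, hv, hvs⟩ := orb v0 (fun v : InfinitePlace K => σ • v) (n := Module.finrank ℚ K)
    Module.finrank_pos.ne' (by
      intro x
      rw [hti, sig_pow hσ rfl, one_smul]) (by
      intro y
      obtain ⟨τ, hτ⟩ := InfinitePlace.exists_smul_eq_of_comap_eq (k := ℚ) (w := v0) (w' := y) (Subsingleton.elim _ _)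
      obtain ⟨k, hk⟩ := (mem_powers_iff_mem_zpowers.mpr (hσ τ))
      refine ⟨k, ?_⟩
      rw [hti]
      have hk' : σ ^ k = τ := hk
      rw [hk', hτ])
  have g0 : NeZero g := ⟨hg⟩
  have hcard : Fintype.card (InfinitePlace K) = g := by
    rw [← Fintype.card_of_bijective hv, ZMod.card]
  set s : Kˣ →* Kˣ := Units.map (σ : K →* K) with hs
  set n := Module.finrank ℚ K with hn
  have hit : ∀ x, s^[n] x = x := us_iter hσ
  let f : InfinitePlace K → Kˣ → ℝ := fun v x => Real.log (v (x : K))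
  have hfm : ∀ v x y, f v (x * y) = f v x + f v y := by
    intro v x y
    change Real.log _ = Real.log _ + Real.log _
    rw [Units.val_mul, map_mul, Real.log_mul] <;> simp
  have hft : ∀ v x, f (σ • v) (s x) = f v x := by
    intro v x
    change Real.log _ = Real.log _
    rw [InfinitePlace.smul_apply, hs, Units.coe_map]
    congr 2
    exact σ.symm_apply_apply _
  obtain ⟨u, hu⟩ := NumberField.Units.dirichletUnitTheorem.exists_unit K (v 0)
  set x0 : Kˣ := ju K u ^ 2 with hx0
  have hx0U : x0 ∈ US K ∅ := by rw [← ju_range]; exact ⟨u ^ 2, map_pow _ _ _⟩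
  have hUs := US_stable σ (∅ : Finset ℕ)
  have hUk : ∀ k y, y ∈ US K ∅ → s^[k] y ∈ US K ∅ := by
    intro k y hy
    induction k with
    | zero => exact hy
    | succ k ih => rw [Function.iterate_succ_apply']; exact hUs _ ih
  set w := ow s g d x0 with hw
  have hwU : ∀ i, w i ∈ US K ∅ := fun i => hUk _ _ (Subgroup.prod_mem _ fun j _ => hUk _ _ hx0U)
  have hws : ∀ i, s (w i) = w (i + 1) := ow_succ s hgd hit x0
  have hW : ∏ i, w i = 1 := by
    rw [hw, ow_prod s hgd]
    change Nm s n x0 = 1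
    apply Units.ext
    rw [Nm_norm hσ, hx0, Units.val_pow_eq_pow_val, map_pow]
    have : ((ju K u : Kˣ) : K) = ((u : 𝓞 K) : K) := rfl
    rw [this, norm_unit, map_one]; rfl
  have hf0 : ∀ v, f v 1 = 0 := fun v => by simp [f]
  have hfp : ∀ (v) (a : ZMod g → ℤ), f v (phi w (Multiplicative.ofAdd a)) = ∑ i, a i * f v (w i) := by
    intro v a
    let F : Kˣ →* Multiplicative ℝ :=
      { toFun := fun x => Multiplicative.ofAdd (f v x), map_one' := by rw [hf0]; rfl
        map_mul' := fun x y => by rw [hfm]; rfl }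
    have := congrArg Multiplicative.toAdd (map_prod F (fun i => w i ^ a i) Finset.univ)
    simp only [map_zpow] at this
    rw [phi_apply]
    change f v _ = _ at this
    rw [this, toAdd_prod]
    refine Finset.sum_congr rfl fun i _ => ?_
    rw [toAdd_zpow, zsmul_eq_mul]; rfl
  let A : ZMod g → ZMod g → ℝ := fun k i => f (v k) (w i)
  have hA : ∀ k i, k ≠ i → A k i < 0 := by
    intro k i hki
    change f (v k) (ow s g d x0 i) < 0
    rw [ow_f s x0 f hfm _ hft v hvs k i]
    have h1 : v (k - i) ≠ v 0 := fun e => hki (sub_eq_zero.mp (hv.1 e))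
    have h2 := hu _ h1
    have h3 : f (v (k - i)) x0 = 2 * Real.log (v (k - i) ((u : 𝓞 K) : K)) := by
      rw [hx0, sq, hfm, two_mul]; rfl
    rw [h3, nsmul_eq_mul]
    have : (0 : ℝ) < d := by exact_mod_cast Nat.pos_of_ne_zero hd
    nlinarith
  have hsum : ∀ k, ∑ i, A k i = 0 := by
    intro k
    have := hfp (v k) (fun _ => 1)
    rw [phi_apply] at this
    simp only [zpow_one, hW, hf0, Int.cast_one, one_mul] at this
    exact this.symm
  have hind : ∀ a : ZMod g → ℤ, phi w (Multiplicative.ofAdd a) = 1 → ∀ i, a i = a 0 := by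
    intro a ha i
    have := const_of_neg A hA hsum (fun i => (a i : ℝ)) (fun k => by
      rw [← hfp (v k) a, ha, hf0]) i 0
    exact_mod_cast this
  -- finite index
  have hfin : (phi w).range.relIndex (US K ∅) ≠ 0 := by
    have hW' : ∀ i, ∃ y, ju K y = w i := fun i => by
      have := hwU i; rw [← ju_range] at this; exact this
    choose y hy using hW'
    have hc : Fintype.card {i : ZMod g // i ≠ 0} = Units.rank K := by
      rw [Fintype.card_subtype_compl, ZMod.card, Fintype.card_subtype_eq, Units.rank, hcard]
    let e : Fin (Units.rank K) ≃ {i : ZMod g // i ≠ 0} := (Fintype.equivFinOfCardEq hc).symm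
    have hmr : Units.IsMaxRank (fun i => y (e i).1) := by
      rw [Units.IsMaxRank, Fintype.linearIndependent_iff]
      intro c hc
      let a : ZMod g → ℝ := fun i => if h : i ≠ 0 then c (e.symm ⟨i, h⟩) else 0
      have hsa : ∀ (B : ZMod g → ℝ), ∑ i, a i * B i = ∑ j, c j * B (e j).1 := by
        intro B
        rw [← Equiv.sum_comp e.symm (fun j => c j * B (e j).1)]
        simp only [Equiv.apply_symm_apply]
        rw [← Fintype.sum_subtype_add_sum_subtype (fun i : ZMod g => i ≠ 0) (fun i => a i * B i)]
        have h0 : ∑ i : {x : ZMod g // ¬ x ≠ 0}, a i.1 * B i.1 = 0 :=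
          Finset.sum_eq_zero fun i _ => by simp only [a]; rw [dif_neg i.2, zero_mul]
        rw [h0, add_zero]
        refine Finset.sum_congr rfl fun i _ => ?_
        simp only [a]; rw [dif_pos i.2]
      have hlog : ∀ (w' : {w : InfinitePlace K // w ≠ Units.dirichletUnitTheorem.w₀}),
          ∑ j, c j * Real.log (w'.1 ((y (e j).1 : 𝓞 K) : K)) = 0 := by
        intro w'
        have h1 := congrFun hc w'
        rw [Finset.sum_apply] at h1
        simp only [Pi.smul_apply, smul_eq_mul, Units.dirichletUnitTheorem.logEmbedding_component, Pi.zero_apply] at h1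
        have h2 : (w'.1.mult : ℝ) * ∑ j, c j * Real.log (w'.1 ((y (e j).1 : 𝓞 K) : K)) = 0 := by
          rw [← h1, Finset.mul_sum]
          exact Finset.sum_congr rfl fun j _ => by ring
        exact (mul_eq_zero.mp h2).resolve_left (by exact_mod_cast InfinitePlace.mult_ne_zero)
      have hlog0 : ∑ j, c j * Real.log ((Units.dirichletUnitTheorem.w₀ : InfinitePlace K) ((y (e j).1 : 𝓞 K) : K)) = 0 := by
        classical
        have h1 : ∀ j, (Units.dirichletUnitTheorem.w₀ : InfinitePlace K).mult *
            Real.log ((Units.dirichletUnitTheorem.w₀ : InfinitePlace K) ((y (e j).1 : 𝓞 K) : K)) =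
            - ∑ w' : {w : InfinitePlace K // w ≠ Units.dirichletUnitTheorem.w₀}, w'.1.mult * Real.log (w'.1 ((y (e j).1 : 𝓞 K) : K)) := by
          intro j
          have := Units.dirichletUnitTheorem.sum_logEmbedding_component (y (e j).1)
          simp only [Units.dirichletUnitTheorem.logEmbedding_component] at this
          rw [this]; ring
        have h2 : ((Units.dirichletUnitTheorem.w₀ : InfinitePlace K).mult : ℝ) * ∑ j, c j * Real.log ((Units.dirichletUnitTheorem.w₀ : InfinitePlace K) ((y (e j).1 : 𝓞 K) : K)) = 0 := by
          calc _ = ∑ j, c j * ((Units.dirichletUnitTheorem.w₀ : InfinitePlace K).mult * Real.log ((Units.dirichletUnitTheorem.w₀ : InfinitePlace K) ((y (e j).1 : 𝓞 K) : K))) := by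
                rw [Finset.mul_sum]; exact Finset.sum_congr rfl fun j _ => by ring
            _ = - ∑ w' : {w : InfinitePlace K // w ≠ Units.dirichletUnitTheorem.w₀}, w'.1.mult * ∑ j, c j * Real.log (w'.1 ((y (e j).1 : 𝓞 K) : K)) := by
                simp only [h1, mul_neg, Finset.sum_neg_distrib, Finset.mul_sum]
                rw [Finset.sum_comm]
                congr 1
                exact Finset.sum_congr rfl fun _ _ => Finset.sum_congr rfl fun _ _ => by ring
            _ = 0 := by simp [hlog]
        exact (mul_eq_zero.mp h2).resolve_left (by exact_mod_cast InfinitePlace.mult_ne_zero)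
      have hall : ∀ w' : InfinitePlace K, ∑ j, c j * Real.log (w' ((y (e j).1 : 𝓞 K) : K)) = 0 := by
        intro w'
        by_cases h : w' = Units.dirichletUnitTheorem.w₀
        · rw [h]; exact hlog0
        · exact hlog ⟨w', h⟩
      have hca := const_of_neg A hA hsum a (fun k => by
        rw [hsa]
        convert hall (v k) using 2 with j
        change _ * Real.log (v k (w (e j).1 : K)) = _
        rw [← hy]; rfl)
      intro j
      have h1 := hca (e j).1 0
      have h2 : a 0 = 0 := by simp [a]
      have h3 : a (e j).1 = c j := by simp only [a]; rw [dif_pos (e j).2]; simp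
      rw [← h3, h1, h2]
    have h1 := Units.isMaxRank_iff_closure_finiteIndex.mp hmr
    have h2 : (Subgroup.map (ju K) (Subgroup.closure (Set.range fun i => y (e i).1))).relIndex (US K ∅) ≠ 0 := by
      rw [← ju_range, MonoidHom.range_eq_map, Subgroup.relIndex_map_map_of_injective _ _ ju_inj, Subgroup.relIndex_top_right]
      exact h1.index_ne_zero
    have h3 : Subgroup.map (ju K) (Subgroup.closure (Set.range fun i => y (e i).1)) ≤ (phi w).range := by
      rw [Subgroup.map_le_iff_le_comap, Subgroup.closure_le]
      rintro _ ⟨i, rfl⟩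
      change ju K (y (e i).1) ∈ (phi w).range
      rw [hy]
      exact ⟨_, phi_single w _⟩
    intro h
    have := Subgroup.relIndex_dvd_of_le_left (US K ∅) h3
    rw [h] at this
    exact h2 (Nat.eq_zero_of_zero_dvd this)
  have hFU : (phi w).range ≤ US K ∅ := by
    rintro _ ⟨a, rfl⟩
    exact Subgroup.prod_mem _ fun i _ => Subgroup.zpow_mem _ (hwU i) _
  have hFs := stable_phi hws
  have e3 := hbF hws hW hind d
  rw [hgd] at e3
  have e4 := hb_lemma (Dl_Nm s hit) (Nm_Dl s hit) hFU (stable_Dl s hFs) (stable_Nm s hFs n) (stable_Dl s hUs) (stable_Nm s hUs n) hfin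
  rw [e3.1, e3.2, one_mul] at e4
  refine ⟨⟨d, by rw [hcard, hgd]⟩, by rw [hcard]; exact e4, ?_, ?_⟩
  · refine hb_ne_zero (Dl_Nm s hit) hFU (stable_Nm s hFs n) (stable_Nm s hUs n) hfin ?_
    rw [e3.1]; exact one_ne_zero
  · refine hb_ne_zero (Nm_Dl s hit) hFU (stable_Dl s hFs) (stable_Dl s hUs) hfin ?_
    rw [e3.2]; exact hg
end
end MN

namespace MN
set_option linter.unusedSectionVars false
set_option linter.unusedSimpArgs false
open scoped TensorProduct Pointwise
open IsDedekindDomain NumberField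

/-- rational S-units -/
def ZS (S : Finset ℕ) : Subgroup ℚˣ where
  carrier := {z | ∀ p : ℕ, p.Prime → p ∉ S → padicValRat p (z : ℚ) = 0}
  mul_mem' := by
    intro a b ha hb p hp hpS
    have := Fact.mk hp
    rw [Units.val_mul, padicValRat.mul a.ne_zero b.ne_zero, ha p hp hpS, hb p hp hpS, add_zero]
  one_mem' := by intro p _ _; simp
  inv_mem' := by
    intro a ha p hp hpS
    have := Fact.mk hp
    rw [Units.val_inv_eq_inv_val, padicValRat.inv, ha p hp hpS, neg_zero]

/-- primes as units -/
def uq (q : ℕ) (hq : q.Prime) : ℚˣ := Units.mk0 (q : ℚ) (Nat.cast_ne_zero.mpr hq.ne_zero)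

section
variable {K : Type} [Field K] [NumberField K]

/-- embedding -/
noncomputable def io (K : Type) [Field K] [NumberField K] : ℚˣ →* Kˣ := Units.map (algebraMap ℚ K)

lemma io_inj : Function.Injective (io K) := Units.map_injective (algebraMap ℚ K).injective

lemma io_nat (b : ℕ) (z : ℚˣ) (h : (b : ℚ) = z) : (b : K) = io K z := by
  change _ = algebraMap ℚ K z
  rw [← h, map_natCast]

lemma exists_prime_mem (v : HeightOneSpectrum (𝓞 K)) : ∃ q : ℕ, q.Prime ∧ (q : 𝓞 K) ∈ v.asIdeal := by
  have hex : ∃ m : ℕ, m ≠ 0 ∧ (m : 𝓞 K) ∈ v.asIdeal := by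
    refine ⟨Ideal.absNorm v.asIdeal, ?_, Ideal.absNorm_mem _⟩
    rw [Ne, Ideal.absNorm_eq_zero_iff]; exact v.ne_bot
  classical
  obtain ⟨h0, h1⟩ := Nat.find_spec hex
  set m := Nat.find hex with hm
  have hm1 : m ≠ 1 := by
    intro e; rw [e, Nat.cast_one] at h1; exact v.isPrime.one_notMem h1
  refine ⟨m.minFac, Nat.minFac_prime hm1, ?_⟩
  have h2 : ((m.minFac : ℕ) : 𝓞 K) * ((m / m.minFac : ℕ) : 𝓞 K) ∈ v.asIdeal := by
    rw [← Nat.cast_mul, Nat.mul_div_cancel' (Nat.minFac_dvd m)]; exact h1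
  rcases v.isPrime.mem_or_mem h2 with h | h
  · exact h
  · exfalso
    have h3 : m / m.minFac < m := Nat.div_lt_self (Nat.pos_of_ne_zero h0) (Nat.minFac_prime hm1).one_lt
    refine Nat.find_min hex h3 ⟨?_, h⟩
    exact (Nat.div_pos (Nat.minFac_le (Nat.pos_of_ne_zero h0)) (Nat.minFac_pos m)).ne'

lemma od_unram {q : ℕ} (hq : q.Prime) (hd : ¬ (q : ℤ) ∣ discr K) (v : HeightOneSpectrum (𝓞 K))
    (hv : (q : 𝓞 K) ∈ v.asIdeal) : od v (io K (uq q hq)) = 1 := by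
  have hP := v.isPrime
  have hl := liesOver_of_mem hq v.asIdeal v.isPrime.ne_top hv
  have hun := (NumberField.not_dvd_discr_iff_forall_mem K (𝓞 K) (Nat.prime_iff_prime_int.mp hq)).mp hd
    v.asIdeal v.isPrime (by simpa using hv)
  have h1 := Ideal.ramificationIdx_eq_one v.asIdeal ℤ
  have hne : Ideal.span {(q : ℤ)} ≠ ⊥ := by
    rw [Ne, Ideal.span_singleton_eq_bot]; exact_mod_cast hq.ne_zero
  rw [← Ideal.ramificationIdx'_eq_ramificationIdx (Ideal.span {(q : ℤ)}) v.asIdeal hne] at h1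
  have e0 := io_nat (K := K) q (uq q hq) rfl
  have e1 : (((q : ℕ) : 𝓞 K) : K) = io K (uq q hq) := by
    rw [← e0]; exact map_natCast (algebraMap (𝓞 K) K) q
  have hpos := (od_nat v (io K (uq q hq)) e0).1
  have key : ∀ k : ℕ, Ideal.map (algebraMap ℤ (𝓞 K)) (Ideal.span {(q : ℤ)}) ≤ v.asIdeal ^ k ↔
      (k : ℤ) ≤ od v (io K (uq q hq)) := by
    intro k
    rw [od_mem v _ _ e1, Ideal.map_span, Set.image_singleton, Ideal.span_singleton_le_iff_mem]
    simp
  have h2 := Ideal.ramificationIdx'_spec (n := (od v (io K (uq q hq))).toNat)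
    ((key _).mpr (by omega)) (fun h => by have := (key _).mp h; push_cast at this; omega)
  omega

lemma od_coprime {q b : ℕ} (hq : q.Prime) (hb : ¬ q ∣ b) (v : HeightOneSpectrum (𝓞 K))
    (hv : (q : 𝓞 K) ∈ v.asIdeal) (z : ℚˣ) (hz : (b : ℚ) = z) : od v (io K z) = 0 :=
  (od_nat v _ (io_nat b z hz)).2.mpr (od_nat_zero v hq hv hb)

lemma od_neg_one (v : HeightOneSpectrum (𝓞 K)) : od v (-1) = 0 := by
  have : od v ((-1) * (-1)) = 0 := by rw [neg_mul_neg, one_mul, od_one]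
  rw [od_mul] at this; omega

lemma od_rat {q : ℕ} (hq : q.Prime) (v : HeightOneSpectrum (𝓞 K)) (hv : (q : 𝓞 K) ∈ v.asIdeal) (z : ℚˣ) :
    od v (io K z) = padicValRat q (z : ℚ) * od v (io K (uq q hq)) := by
  have hf := Fact.mk hq
  have hnat : ∀ (b : ℕ) (y : ℚˣ), (b : ℚ) = y → od v (io K y) = padicValRat q (y : ℚ) * od v (io K (uq q hq)) := by
    intro b y hy
    have hb0 : b ≠ 0 := by rintro rfl; exact y.ne_zero (by rw [← hy]; simp)
    obtain ⟨k, c, hc, hbc⟩ := Nat.exists_eq_pow_mul_and_not_dvd hb0 q hq.ne_one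
    have hc0 : (c : ℚ) ≠ 0 := by rw [Nat.cast_ne_zero]; rintro rfl; exact hc (dvd_zero _)
    have hyc : y = uq q hq ^ (k : ℤ) * Units.mk0 _ hc0 := by
      apply Units.ext; rw [← hy, hbc]; simp [uq]
    have h2 : padicValRat q (c : ℚ) = 0 := by
      rw [padicValRat.of_nat, padicValNat.eq_zero_of_not_dvd hc]; rfl
    rw [hyc, map_mul, map_zpow, od_mul, od_zpow, od_coprime hq hc v hv (Units.mk0 (c:ℚ) hc0) rfl, Units.val_mul,
      padicValRat.mul (Units.ne_zero _) (Units.ne_zero _), Units.val_mk0, h2, Units.val_zpow_eq_zpow_val]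
    have h3 : padicValRat q ((uq q hq : ℚ) ^ (k : ℤ)) = k := by
      rw [zpow_natCast, padicValRat.pow]
      simp [uq, hq.one_lt]
    rw [h3]; ring
  have hd0 : ((z : ℚ).den : ℚ) ≠ 0 := Nat.cast_ne_zero.mpr (z : ℚ).den_nz
  have hn0 : ((z : ℚ).num.natAbs : ℚ) ≠ 0 := by
    rw [Nat.cast_ne_zero, Int.natAbs_ne_zero, Rat.num_ne_zero]; exact z.ne_zero
  have hpos : ∀ z' : ℚˣ, (z' = Units.mk0 _ hn0 / Units.mk0 _ hd0) → od v (io K z') = padicValRat q (z' : ℚ) * od v (io K (uq q hq)) := by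
    rintro z' rfl
    rw [map_div, div_eq_mul_inv, od_mul, od_inv, hnat _ _ rfl, hnat _ (Units.mk0 _ hd0) rfl,
      Units.val_div_eq_div_val, padicValRat.div (Units.ne_zero _) (Units.ne_zero _)]
    ring
  rcases Int.natAbs_eq (z : ℚ).num with e | e
  · apply hpos
    apply Units.ext
    conv_lhs => rw [← Rat.num_div_den (z : ℚ), e]
    simp
  · have := hpos (-z) (by
      apply Units.ext
      rw [Units.val_neg]
      conv_lhs => rw [← Rat.num_div_den (z : ℚ), e]
      simp [neg_div])
    have h1 : io K (-z) = (-1) * io K z := by apply Units.ext; simp [io]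
    rw [h1, od_mul, od_neg_one, Units.val_neg, padicValRat.neg, zero_add] at this
    exact this

lemma od_uq_pos {q : ℕ} (hq : q.Prime) (v : HeightOneSpectrum (𝓞 K)) (hv : (q : 𝓞 K) ∈ v.asIdeal) :
    0 < od v (io K (uq q hq)) := by
  have h := od_nat v (io K (uq q hq)) (io_nat (K := K) q (uq q hq) rfl)
  have : od v (io K (uq q hq)) ≠ 0 := fun e => h.2.mp e hv
  omega

lemma io_mem_US (S : Finset ℕ) (hS : ∀ q ∈ S, q.Prime) (z : ℚˣ) : io K z ∈ US K S ↔ z ∈ ZS S := by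
  constructor
  · intro h p hp hpS
    obtain ⟨v, hv⟩ := exists_over (K := K) hp
    have h1 := h v fun r hr => not_two hp (hS r hr) (fun e => hpS (e ▸ hr)) v hv
    rw [od_rat hp v hv] at h1
    exact (mul_eq_zero.mp h1).resolve_right (od_uq_pos hp v hv).ne'
  · intro h v hv
    obtain ⟨p, hp, hpv⟩ := exists_prime_mem v
    rw [od_rat hp v hpv, h p hp (fun hpS => hv p hpS hpv), zero_mul]

/-- global norm on units -/
noncomputable def gn (K : Type) [Field K] [NumberField K] : Kˣ →* ℚˣ := Units.map (Algebra.norm ℚ : K →* ℚ)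

variable [IsGalois ℚ K]

lemma Nm_gn {σ : K ≃ₐ[ℚ] K} (hσ : ∀ x, x ∈ Subgroup.zpowers σ) (x : Kˣ) :
    Nm (Units.map (σ : K →* K)) (Module.finrank ℚ K) x = io K (gn K x) :=
  Units.ext (Nm_norm hσ x)

lemma fixed_io {σ : K ≃ₐ[ℚ] K} (hσ : ∀ x, x ∈ Subgroup.zpowers σ) (x : Kˣ) (h : Units.map (σ : K →* K) x = x) :
    ∃ z, io K z = x := by
  have h0 : σ (x : K) = x := congrArg Units.val h
  have h1 : ∀ τ : K ≃ₐ[ℚ] K, τ (x : K) = x := by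
    intro τ
    obtain ⟨k, hk⟩ := mem_powers_iff_mem_zpowers.mpr (hσ τ)
    have hk' : σ ^ k = τ := hk
    rw [← hk']
    clear hk hk'
    induction k with
    | zero => rfl
    | succ k ih => rw [pow_succ, AlgEquiv.mul_apply, h0, ih]
  obtain ⟨z, hz⟩ := (IsGalois.mem_range_algebraMap_iff_fixed (F := ℚ) (x : K)).mpr h1
  have hz0 : z ≠ 0 := by rintro rfl; exact x.ne_zero (by rw [← hz, map_zero])
  exact ⟨Units.mk0 z hz0, Units.ext hz⟩

/-- norms of S-units -/
noncomputable def NU (K : Type) [Field K] [NumberField K] (S : Finset ℕ) : Subgroup ℚˣ := (US K S).map (gn K)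

lemma H0_eq {σ : K ≃ₐ[ℚ] K} (hσ : ∀ x, x ∈ Subgroup.zpowers σ) (S : Finset ℕ) (hS : ∀ q ∈ S, q.Prime) :
    H0 σ (US K S) = (NU K S).relIndex (ZS S) := by
  have h1 : (US K S).map (Nm (Units.map (σ : K →* K)) (Module.finrank ℚ K)) = (NU K S).map (io K) := by
    rw [NU, Subgroup.map_map]
    congr 1
    exact MonoidHom.ext fun x => Nm_gn hσ x
  have h2 : US K S ⊓ (Dl (Units.map (σ : K →* K))).ker = (ZS S).map (io K) := by
    ext x
    constructor
    · rintro ⟨hx, hx2⟩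
      have h3 := MonoidHom.mem_ker.mp hx2
      rw [Dl_apply, div_eq_one] at h3
      obtain ⟨z, rfl⟩ := fixed_io hσ x h3
      exact ⟨z, (io_mem_US S hS z).mp hx, rfl⟩
    · rintro ⟨z, hz, rfl⟩
      refine ⟨(io_mem_US S hS z).mpr hz, ?_⟩
      apply MonoidHom.mem_ker.mpr
      rw [Dl_apply, div_eq_one]
      apply Units.ext
      exact σ.commutes _
  rw [H0, hb, h1, h2, Subgroup.relIndex_map_map_of_injective _ _ io_inj]

lemma NU_le {σ : K ≃ₐ[ℚ] K} (hσ : ∀ x, x ∈ Subgroup.zpowers σ) (S : Finset ℕ) (hS : ∀ q ∈ S, q.Prime) : NU K S ≤ ZS S := by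
  rintro _ ⟨x, hx, rfl⟩
  rw [← io_mem_US (K := K) S hS, ← Nm_gn hσ]
  exact stable_Nm _ (US_stable σ S) _ ⟨x, hx, rfl⟩

lemma od_const {σ : K ≃ₐ[ℚ] K} (hσ : ∀ x, x ∈ Subgroup.zpowers σ) {q : ℕ} (hq : q.Prime) (y : Kˣ)
    (h : ∀ v : HeightOneSpectrum (𝓞 K), (q : 𝓞 K) ∈ v.asIdeal → od v (Units.map (σ : K →* K) y) = od v y)
    (u v : HeightOneSpectrum (𝓞 K)) (hu : (q : 𝓞 K) ∈ u.asIdeal) (hv : (q : 𝓞 K) ∈ v.asIdeal) : od u y = od v y := by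
  have hm : (Ideal.span {(q : ℤ)}).IsMaximal :=
    ((Ideal.span_singleton_prime (by exact_mod_cast hq.ne_zero)).mpr
      (Nat.prime_iff_prime_int.mp hq)).isMaximal (by simp [hq.ne_zero])
  have l1 := liesOver_of_mem hq u.asIdeal u.isPrime.ne_top hu
  have l2 := liesOver_of_mem hq v.asIdeal v.isPrime.ne_top hv
  have p1 := u.isPrime
  have p2 := v.isPrime
  obtain ⟨τ, hτ⟩ := Ideal.exists_smul_eq_of_isGaloisGroup (Ideal.span {(q : ℤ)}) u.asIdeal v.asIdeal (K ≃ₐ[ℚ] K)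
  obtain ⟨k, hk⟩ := (mem_powers_iff_mem_zpowers.mpr (hσ τ))
  have hk' : σ ^ k = τ := hk
  have e : v = (sv σ)^[k] u := by
    rw [sv_iter, hk']; exact HeightOneSpectrum.ext hτ.symm
  have hmem : ∀ k, (q : 𝓞 K) ∈ ((sv σ)^[k] u).asIdeal := by
    intro k
    induction k with
    | zero => exact hu
    | succ k ih => rw [Function.iterate_succ_apply', nat_mem_sv]; exact ih
  rw [e]
  clear e hk hk' l2 hτ
  induction k with
  | zero => rfl
  | succ k ih =>
    rw [ih, ← h _ (hmem (k + 1)), Function.iterate_succ_apply', od_sv]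

lemma H1_eq {σ : K ≃ₐ[ℚ] K} (hσ : ∀ x, x ∈ Subgroup.zpowers σ) (S : Finset ℕ) (hS : ∀ q ∈ S, q.Prime)
    (hram : ∀ q : ℕ, q.Prime → (q : ℤ) ∣ discr K → q ∈ S) : H1 σ (US K S) = 1 := by
  rw [H1, hb, Subgroup.relIndex_eq_one]
  rintro x ⟨hx, hx2⟩
  have h3 := MonoidHom.mem_ker.mp hx2
  rw [Nm_gn hσ] at h3
  have h4 : gn K x = 1 := io_inj (by rw [h3, map_one])
  have h5 : Algebra.norm ℚ (x : K) = 1 := congrArg Units.val h4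
  have hcyc : IsCyclic (K ≃ₐ[ℚ] K) := ⟨σ, hσ⟩
  obtain ⟨y, hy⟩ := groupCohomology.exists_div_of_norm_eq_one hσ h5
  have hxy : x = y / Units.map (σ : K →* K) y := by
    apply Units.ext; rw [← hy, Units.val_div_eq_div_val]; rfl
  have hody : ∀ v : HeightOneSpectrum (𝓞 K), (∀ q ∈ S, (q : 𝓞 K) ∉ v.asIdeal) →
      od v (Units.map (σ : K →* K) y) = od v y := by
    intro v hv
    have := hx v hv
    rw [hxy, div_eq_mul_inv, od_mul, od_inv] at this
    omega
  classical
  let ov : ℕ → HeightOneSpectrum (𝓞 K) := fun q => if h : q.Prime then (exists_over (K := K) h).choose else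
    (exists_over (K := K) Nat.prime_two).choose
  have hov : ∀ q : ℕ, q.Prime → (q : 𝓞 K) ∈ (ov q).asIdeal := by
    intro q hq; simp only [ov, dif_pos hq]; exact (exists_over (K := K) hq).choose_spec
  have hfin : {q : ℕ | q.Prime ∧ od (ov q) y ≠ 0}.Finite := by
    have hf : {v : HeightOneSpectrum (𝓞 K) | od v y ≠ 0}.Finite := by
      refine ((HeightOneSpectrum.Support.finite (𝓞 K) (y : K)).union
        (HeightOneSpectrum.Support.finite (𝓞 K) ((y⁻¹ : Kˣ) : K))).subset ?_
      intro v hv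
      by_contra hcon
      simp only [Set.mem_union, not_or, HeightOneSpectrum.Support, Set.mem_ofPred_eq, not_lt] at hcon
      have a1 := (od_le v _).mpr hcon.1
      have a2 := (od_le v _).mpr hcon.2
      rw [od_inv] at a2
      exact hv (by omega)
    refine Set.Finite.of_finite_image (f := ov) (hf.subset ?_) ?_
    · rintro _ ⟨q, hq, rfl⟩; exact hq.2
    · intro q hq r hr e
      by_contra hne
      have h1 := hov r hr.1
      rw [← e] at h1
      exact not_two hq.1 hr.1 hne _ (hov q hq.1) h1
  let T := hfin.toFinset.filter (· ∉ S)
  have hT : ∀ q ∈ T, q.Prime := fun q hq => by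
    simp only [T, Finset.mem_filter, Set.Finite.mem_toFinset] at hq; exact hq.1.1
  let b : ℚˣ := ∏ q ∈ T.attach, uq q.1 (hT q.1 q.2) ^ (od (ov q.1) y)
  have hb : ∀ v : HeightOneSpectrum (𝓞 K), (∀ q ∈ S, (q : 𝓞 K) ∉ v.asIdeal) → od v (io K b) = od v y := by
    intro v hv
    obtain ⟨p, hp, hpv⟩ := exists_prime_mem v
    have hpS : p ∉ S := fun h => hv p h hpv
    have hc : od v y = od (ov p) y := by
      refine od_const hσ hp y ?_ v (ov p) hpv (hov p hp)
      intro u hu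
      exact hody u fun r hr hru => not_two hp (hS r hr) (fun e => hpS (e ▸ hr)) u hu hru
    rw [map_prod, od_prod]
    have hz : ∀ q : {q // q ∈ T}, q.1 ≠ p → od v (io K (uq q.1 (hT q.1 q.2) ^ (od (ov q.1) y))) = 0 := by
      intro q hqp
      rw [map_zpow, od_zpow, od_coprime hp (b := q.1) ?_ v hpv _ rfl, mul_zero]
      intro hd
      exact hqp ((Nat.prime_dvd_prime_iff_eq hp (hT q.1 q.2)).mp hd).symm
    by_cases hpT : p ∈ T
    · rw [Finset.sum_eq_single ⟨p, hpT⟩]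
      · rw [map_zpow, od_zpow, od_unram hp (fun h => hpS (hram p hp h)) v hpv, hc, mul_one]
      · intro q _ hq; exact hz q fun e => hq (Subtype.ext e)
      · intro h; exact absurd (Finset.mem_attach _ _) h
    · rw [Finset.sum_eq_zero fun q _ => hz q fun e => hpT (e ▸ q.2), hc]
      by_contra hne
      exact hpT (by simp only [T, Finset.mem_filter, Set.Finite.mem_toFinset]; exact ⟨⟨hp, fun e => hne e.symm⟩, hpS⟩)
  refine ⟨(y / io K b)⁻¹, ?_, ?_⟩
  · apply Subgroup.inv_mem
    intro v hv
    rw [div_eq_mul_inv, od_mul, od_inv, hb v hv]; ring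
  · have hfix : Units.map (σ : K →* K) (io K b) = io K b := Units.ext (σ.commutes _)
    rw [Dl_apply, map_inv, map_div, hfix, hxy, inv_div_inv, div_div_div_cancel_right]
end
end MN

namespace MN
set_option linter.unusedSectionVars false
set_option linter.unusedSimpArgs false
open scoped TensorProduct Pointwise
open IsDedekindDomain NumberField

lemma uq_mem_ZS {S : Finset ℕ} {q : ℕ} (hq : q.Prime) (h : q ∈ S) : uq q hq ∈ ZS S := by
  intro p hp hpS
  have := Fact.mk hp
  change padicValRat p ((q : ℕ) : ℚ) = 0
  rw [padicValRat.of_nat, padicValNat.eq_zero_of_not_dvd]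
  · rfl
  · intro hd; exact hpS (((Nat.prime_dvd_prime_iff_eq hp hq).mp hd) ▸ h)

lemma neg_one_mem_ZS (S : Finset ℕ) : (-1 : ℚˣ) ∈ ZS S := by
  intro p hp hpS
  rw [Units.val_neg, padicValRat.neg]; simp

theorem WA (S : Finset ℕ) (hS : ∀ q ∈ S, q.Prime) (k : ℕ) (hk : 1 ≤ k) (z0 : ℚˣ)
    (t : ∀ (q : ℕ) [Fact q.Prime], ℚ_[q]ˣ) :
    ∃ z ∈ ZS S, 0 < (z : ℚ) * z0 ∧ ∃ b : ℕ, 0 < b ∧ (∀ q ∈ S, q.Coprime b) ∧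
      ∀ (q : ℕ) [Fact q.Prime], q ∈ S → ‖((z : ℚ) : ℚ_[q]) * b / (t q : ℚ_[q]) - 1‖ ≤ (q : ℝ) ^ (-(k : ℤ)) := by
  classical
  let e : ℕ → ℤ := fun q => if h : q.Prime then (@Padic.valuation q ⟨h⟩ ((@t q ⟨h⟩ : (@Padic q ⟨h⟩)ˣ) : @Padic q ⟨h⟩)) else 0
  have he : ∀ (q : ℕ) [hq : Fact q.Prime], e q = (t q : ℚ_[q]).valuation := by
    intro q hq; simp only [e, dif_pos hq.out]
  let z1 : ℚˣ := ∏ q ∈ S.attach, uq q.1 (hS q.1 q.2) ^ e q.1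
  have hz1 : z1 ∈ ZS S := Subgroup.prod_mem _ fun q _ => Subgroup.zpow_mem _ (uq_mem_ZS _ q.2) _
  have hz1pos : 0 < (z1 : ℚ) := by
    simp only [z1, Units.coe_prod, Units.val_zpow_eq_zpow_val]
    refine Finset.prod_pos fun q _ => zpow_pos ?_ _
    exact Nat.cast_pos.mpr (hS q.1 q.2).pos
  obtain ⟨z, hz, hzpos, hznorm⟩ : ∃ z ∈ ZS S, 0 < (z : ℚ) * z0 ∧ ((z : ℚ) = z1 ∨ (z : ℚ) = -z1) := by
    rcases lt_or_gt_of_ne z0.ne_zero with h | h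
    · refine ⟨-1 * z1, Subgroup.mul_mem _ (neg_one_mem_ZS S) hz1, ?_, Or.inr (by simp)⟩
      simp only [Units.val_mul, Units.val_neg, Units.val_one]
      nlinarith
    · exact ⟨z1, hz1, mul_pos hz1pos h, Or.inl rfl⟩
  have hnorm : ∀ (q : ℕ) [hq : Fact q.Prime], q ∈ S → ‖((z : ℚ) : ℚ_[q])‖ = ‖(t q : ℚ_[q])‖ := by
    intro q hq hqS
    have h1 : ‖((z : ℚ) : ℚ_[q])‖ = ‖((z1 : ℚ) : ℚ_[q])‖ := by
      rcases hznorm with h | h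
      · rw [h]
      · rw [h]; push_cast; rw [norm_neg]
    have h2 : ((z1 : ℚ) : ℚ_[q]) = ∏ r ∈ S.attach, (((r.1 : ℕ) : ℚ_[q])) ^ e r.1 := by
      simp only [z1, Units.coe_prod, Units.val_zpow_eq_zpow_val]
      push_cast
      rfl
    rw [h1, h2, norm_prod, Finset.prod_eq_single ⟨q, hqS⟩]
    · rw [norm_zpow, Padic.norm_p, he q, Padic.norm_eq_zpow_neg_valuation (t q).ne_zero, inv_zpow, zpow_neg]
    · intro r _ hr
      have : ‖((r.1 : ℕ) : ℚ_[q])‖ = 1 := by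
        rw [Padic.norm_natCast_eq_one_iff, Nat.coprime_primes hq.out (hS _ r.2)]
        exact fun h => hr (Subtype.ext h.symm)
      rw [norm_zpow, this, one_zpow]
    · intro h; exact absurd (Finset.mem_attach _ _) h
  let u : ∀ (q : ℕ) [Fact q.Prime], ℤ_[q] := fun q hq => if h : ‖(t q : ℚ_[q]) / ((z : ℚ) : ℚ_[q])‖ ≤ 1 then ⟨_, h⟩ else 1
  have hz0 : ∀ (q : ℕ) [hq : Fact q.Prime], ((z : ℚ) : ℚ_[q]) ≠ 0 := by
    intro q hq; exact_mod_cast z.ne_zero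
  have hu1 : ∀ (q : ℕ) [hq : Fact q.Prime], q ∈ S → ‖(t q : ℚ_[q]) / ((z : ℚ) : ℚ_[q])‖ = 1 := by
    intro q hq hqS
    rw [norm_div, hnorm q hqS, div_self (norm_ne_zero_iff.mpr (t q).ne_zero)]
  have hu : ∀ (q : ℕ) [hq : Fact q.Prime], q ∈ S → ((u q : ℤ_[q]) : ℚ_[q]) = (t q : ℚ_[q]) / ((z : ℚ) : ℚ_[q]) := by
    intro q hq hqS
    have h : ‖(t q : ℚ_[q]) / ((z : ℚ) : ℚ_[q])‖ ≤ 1 := (hu1 q hqS).le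
    have e1 : u q = ⟨_, h⟩ := dif_pos h
    rw [e1]
  let a : ℕ → ℕ := fun q => if h : q.Prime then (@PadicInt.appr q ⟨h⟩ (@u q ⟨h⟩) k) else 0
  have ha : ∀ (q : ℕ) [hq : Fact q.Prime], a q = (u q).appr k := by
    intro q hq; simp only [a, dif_pos hq.out]
  obtain ⟨b0, hb0⟩ := Nat.chineseRemainderOfFinset a (fun q => q ^ k) S
    (fun q hq => pow_ne_zero _ (hS q hq).ne_zero)
    (fun q hq r hr hne => Nat.Coprime.pow _ _ ((Nat.coprime_primes (hS q hq) (hS r hr)).mpr hne))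
  let b := b0 + ∏ q ∈ S, q ^ k
  have hM : 0 < ∏ q ∈ S, q ^ k := Finset.prod_pos fun q hq => pow_pos (hS q hq).pos _
  have hb : ∀ q ∈ S, b ≡ a q [MOD q ^ k] := by
    intro q hq
    have h1 : ∏ q ∈ S, q ^ k ≡ 0 [MOD q ^ k] := (Nat.modEq_zero_iff_dvd).mpr (Finset.dvd_prod_of_mem _ hq)
    simpa using (hb0 q hq).add h1
  have key : ∀ (q : ℕ) [Fact q.Prime], q ∈ S → ‖(b : ℚ_[q]) - (u q : ℤ_[q])‖ ≤ (q : ℝ) ^ (-(k : ℤ)) := by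
    intro q hq hqS
    have h1 : ((b : ℤ_[q]) - u q) ∈ Ideal.span {(q : ℤ_[q]) ^ k} := by
      have h2 : ((b : ℤ_[q]) - (a q : ℤ_[q])) ∈ Ideal.span {(q : ℤ_[q]) ^ k} := by
        rw [Ideal.mem_span_singleton]
        have h3 := (Nat.modEq_iff_dvd.mp (hb q hqS).symm)
        have h4 := map_dvd (Int.castRingHom ℤ_[q]) h3
        simpa using h4
      have h5 := PadicInt.appr_spec k (u q)
      rw [← ha q] at h5
      have := Ideal.sub_mem _ h2 h5
      simpa using this
    have h6 := (PadicInt.norm_le_pow_iff_mem_span_pow _ _).mpr h1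
    simpa [PadicInt.norm_def] using h6
  refine ⟨z, hz, hzpos, b, by omega, ?_, ?_⟩
  · intro q hqS
    have hq : Fact q.Prime := ⟨hS q hqS⟩
    rw [← Padic.norm_natCast_eq_one_iff (p := q)]
    have h1 : ‖((u q : ℤ_[q]) : ℚ_[q])‖ = 1 := by rw [hu q hqS, hu1 q hqS]
    have h2 : ‖(b : ℚ_[q]) - (u q : ℤ_[q])‖ < 1 := (key q hqS).trans_lt (by
      rw [zpow_neg, zpow_natCast]
      exact inv_lt_one_of_one_lt₀ (one_lt_pow₀ (by exact_mod_cast hq.out.one_lt) (by omega)))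
    have h3 := IsUltrametricDist.norm_eq_of_add_norm_lt_max (x := (b : ℚ_[q])) (y := -((u q : ℤ_[q]) : ℚ_[q])) (by
      rw [norm_neg, h1, ← sub_eq_add_neg]; exact h2.trans_le (le_max_right _ _))
    rw [h3, norm_neg, h1]
  · intro q hq hqS
    have h1 : ((z : ℚ) : ℚ_[q]) * b / (t q : ℚ_[q]) - 1 = ((b : ℚ_[q]) - (u q : ℤ_[q])) * (((z : ℚ) : ℚ_[q]) / t q) := by
      rw [hu q hqS]
      have := hz0 q
      have := (t q).ne_zero
      field_simp
    rw [h1, norm_mul, norm_div, hnorm q hqS, div_self (norm_ne_zero_iff.mpr (t q).ne_zero), mul_one]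
    exact key q hqS

section
variable {K : Type} [Field K] [NumberField K]

lemma norm_nonneg_of_complex (h : ∀ w : InfinitePlace K, w.IsComplex) (x : K) : 0 ≤ Algebra.norm ℚ x := by
  classical
  have h1 := Algebra.norm_eq_prod_embeddings ℚ ℂ x
  rw [← Fintype.prod_equiv (RingHom.equivRatAlgHom K ℂ) (fun f => f x)
      (fun φ => φ x) fun _ => by simp [RingHom.equivRatAlgHom_apply],
      ← Finset.prod_fiberwise Finset.univ InfinitePlace.mk (fun φ => φ x)] at h1
  have h2 : ∀ w : InfinitePlace K, ∏ φ ∈ Finset.univ.filter (fun φ : K →+* ℂ => InfinitePlace.mk φ = w), φ x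
      = ((‖w.embedding x‖ ^ 2 : ℝ) : ℂ) := by
    intro w
    have h3 : Finset.univ.filter (fun φ : K →+* ℂ => InfinitePlace.mk φ = w)
        = {w.embedding, ComplexEmbedding.conjugate w.embedding} := by
      ext φ
      simp only [Finset.mem_filter, Finset.mem_univ, true_and, Finset.mem_insert, Finset.mem_singleton]
      conv_lhs => rw [← InfinitePlace.mk_embedding w, eq_comm, InfinitePlace.mk_eq_iff]
      rw [eq_comm, @eq_comm _ (ComplexEmbedding.conjugate _)]
    have h4 : w.embedding ≠ ComplexEmbedding.conjugate w.embedding := by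
      intro e
      exact (InfinitePlace.isComplex_iff.mp (h w)) e.symm
    rw [h3, Finset.prod_pair h4, ComplexEmbedding.conjugate_coe_eq, Complex.mul_conj, Complex.normSq_eq_norm_sq]
  rw [Finset.prod_congr rfl fun w _ => h2 w, ← Complex.ofReal_prod, eq_ratCast] at h1
  have h5 : ((Algebra.norm ℚ x : ℚ) : ℝ) = ∏ w : InfinitePlace K, ‖w.embedding x‖ ^ 2 := by
    exact_mod_cast h1
  have h6 : (0 : ℝ) ≤ ((Algebra.norm ℚ x : ℚ) : ℝ) := by
    rw [h5]; exact Finset.prod_nonneg fun w _ => by positivity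
  exact_mod_cast h6

lemma norm_one_tmul (F : Type) [Field F] [Algebra ℚ F] (x : K) :
    Algebra.norm F ((1 : F) ⊗ₜ[ℚ] x) = algebraMap ℚ F (Algebra.norm ℚ x) := by
  rw [Algebra.norm_apply, Algebra.norm_apply, ← LinearMap.det_baseChange]
  congr 1
  apply TensorProduct.AlgebraTensorModule.ext
  intro a b
  simp [LinearMap.baseChange_tmul]

lemma norm_tensor_nonneg (h : ∀ w : InfinitePlace K, w.IsComplex) (x : ℝ ⊗[ℚ] K) : 0 ≤ Algebra.norm ℝ x := by
  classical
  let b := Module.finBasis ℚ K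
  let B := Algebra.TensorProduct.basis ℝ b
  let f : (Fin (Module.finrank ℚ K) → ℝ) → ℝ := fun a => Algebra.norm ℝ (∑ i, a i • B i)
  have hf : Continuous f := by
    have : f = fun a => (∑ i, a i • Algebra.leftMulMatrix B (B i)).det := by
      funext a
      simp only [f]
      rw [Algebra.norm_eq_matrix_det B, map_sum]
      simp only [map_smul]
    rw [this]
    exact Continuous.matrix_det (continuous_finsetSum _ fun i _ => (continuous_apply i).smul continuous_const)
  have hd : DenseRange (fun (a : Fin (Module.finrank ℚ K) → ℚ) i => (a i : ℝ)) :=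
    DenseRange.piMap (fun _ => Rat.denseRange_cast)
  have hx : x = ∑ i, B.repr x i • B i := (B.sum_repr x).symm
  rw [hx]
  change 0 ≤ f (fun i => B.repr x i)
  refine hd.induction_on (p := fun a => 0 ≤ f a) _ (isClosed_le continuous_const hf) ?_
  intro a
  have h1 : ∑ i, (a i : ℝ) • B i = (1 : ℝ) ⊗ₜ[ℚ] (∑ i, a i • b i) := by
    rw [TensorProduct.tmul_sum]
    refine Finset.sum_congr rfl fun i _ => ?_
    rw [Algebra.TensorProduct.basis_apply, TensorProduct.tmul_smul, TensorProduct.smul_tmul', TensorProduct.smul_tmul']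
    congr 1
  simp only [f]
  rw [h1, norm_one_tmul]
  have := norm_nonneg_of_complex h (∑ i, a i • b i)
  simp only [eq_ratCast]
  exact_mod_cast this
end
end MN

namespace MN
set_option linter.unusedSectionVars false
set_option linter.unusedSimpArgs false
open scoped TensorProduct Pointwise
open IsDedekindDomain NumberField

section
variable (K : Type) [Field K] [NumberField K]

/-- local map -/
noncomputable def lm (F : Type) [Field F] [Algebra ℚ F] : ℚˣ →* Fˣ := Units.map (algebraMap ℚ F)

/-- rational numbers that are norms at q -/
noncomputable def LQ (q : ℕ) : Subgroup ℚˣ :=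
  if h : q.Prime then (@NG (@Padic q ⟨h⟩) K _ _ _ _).comap (lm (@Padic q ⟨h⟩)) else ⊤

lemma LQ_eq (q : ℕ) [hq : Fact q.Prime] : LQ K q = (NG ℚ_[q] K).comap (lm ℚ_[q]) := by
  rw [LQ, dif_pos hq.out]

/-- at infinity -/
noncomputable def LI : Subgroup ℚˣ := (NG ℝ K).comap (lm ℝ)

/-- all in S -/
noncomputable def LL (S : Finset ℕ) : Subgroup ℚˣ := LI K ⊓ ⨅ q ∈ S, LQ K q

lemma mem_LL {S : Finset ℕ} {z : ℚˣ} : z ∈ LL K S ↔ z ∈ LI K ∧ ∀ q ∈ S, z ∈ LQ K q := by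
  simp only [LL, Subgroup.mem_inf, Subgroup.mem_iInf]

lemma gn_mem_NG (F : Type) [Field F] [Algebra ℚ F] (x : Kˣ) : gn K x ∈ (NG F K).comap (lm F) := by
  refine ⟨Units.map (Algebra.TensorProduct.includeRight : K →ₐ[ℚ] F ⊗[ℚ] K) x, ?_⟩
  apply Units.ext
  exact norm_one_tmul F (x : K)

lemma gn_mem_LL (S : Finset ℕ) (x : Kˣ) : gn K x ∈ LL K S := by
  rw [mem_LL]
  refine ⟨gn_mem_NG K ℝ x, fun q _ => ?_⟩
  rw [LQ]; split_ifs with h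
  · exact gn_mem_NG K _ x
  · trivial

lemma pos_mem_LI {z : ℚˣ} (hz : 0 < (z : ℚ)) : z ∈ LI K := by
  have hn : Module.finrank ℚ K ≠ 0 := Module.finrank_pos.ne'
  have hz' : (0 : ℝ) < ((z : ℚ) : ℝ) := by exact_mod_cast hz
  let y : ℝ := (((z : ℚ) : ℝ)) ^ ((Module.finrank ℚ K : ℝ)⁻¹)
  have hy : y ^ Module.finrank ℚ K = ((z : ℚ) : ℝ) := Real.rpow_inv_natCast_pow hz'.le hn
  have hy0 : y ≠ 0 := by intro h; rw [h, zero_pow hn] at hy; exact hz'.ne hy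
  refine ⟨Units.map (algebraMap ℝ (ℝ ⊗[ℚ] K)) (Units.mk0 y hy0), ?_⟩
  apply Units.ext
  change Algebra.norm ℝ (algebraMap ℝ (ℝ ⊗[ℚ] K) y) = ((z : ℚ) : ℝ)
  rw [Algebra.norm_algebraMap, Module.finrank_baseChange, hy]

lemma LI_index {d : ℕ} (hd : Fintype.card (InfinitePlace K) * d = Module.finrank ℚ K) :
    (LI K).index ≠ 0 ∧ d ≤ (LI K).index := by
  have h0 : (LI K).index ≠ 0 := by
    have h1 : (Units.map (signHom : ℚ →*₀ SignType).toMonoidHom).ker ≤ LI K := by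
      intro z hz
      apply pos_mem_LI
      have h2 : SignType.sign (z : ℚ) = 1 := congrArg Units.val (MonoidHom.mem_ker.mp hz)
      exact sign_eq_one_iff.mp h2
    have h3 : (Units.map (signHom : ℚ →*₀ SignType).toMonoidHom).ker.index ≠ 0 := by
      rw [Subgroup.index_ker]; exact Nat.card_pos.ne'
    exact fun h => h3 (Nat.eq_zero_of_zero_dvd (h ▸ Subgroup.index_dvd_of_le h1))
  refine ⟨h0, ?_⟩
  have e1 := InfinitePlace.card_eq_nrRealPlaces_add_nrComplexPlaces K
  have e2 := InfinitePlace.card_add_two_mul_card_eq_rank K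
  have hpos : 0 < Fintype.card (InfinitePlace K) := Fintype.card_pos
  have hd2 : d ≤ 2 := by
    by_contra hcon
    have : Fintype.card (InfinitePlace K) * 3 ≤ Fintype.card (InfinitePlace K) * d := Nat.mul_le_mul_left _ (by omega)
    omega
  rcases Nat.lt_or_ge d 2 with h | h
  · omega
  have hd' : d = 2 := by omega
  subst hd'
  have hr : InfinitePlace.nrRealPlaces K = 0 := by omega
  have hc := NumberField.nrRealPlaces_eq_zero_iff.mp hr
  have hne : (LI K).index ≠ 1 := by
    intro h1
    rw [Subgroup.index_eq_one] at h1
    have h2 : (-1 : ℚˣ) ∈ LI K := by rw [h1]; trivial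
    obtain ⟨x, hx⟩ := h2
    have h3 : Algebra.norm ℝ (x : ℝ ⊗[ℚ] K) = ((-1 : ℚ) : ℝ) := congrArg Units.val hx
    have h4 := norm_tensor_nonneg (K := K) (fun w => hc.isComplex w) (x : ℝ ⊗[ℚ] K)
    rw [h3] at h4
    norm_num at h4
  omega

lemma index_inf_of_sup {G : Type*} [CommGroup G] {A B : Subgroup G} (h : A ⊔ B = ⊤) : (A ⊓ B).index = A.index * B.index := by
  rw [← Subgroup.relIndex_mul_index (inf_le_right : A ⊓ B ≤ B), Subgroup.inf_relIndex_right,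
    ← Subgroup.relIndex_sup_left, h, Subgroup.relIndex_top_right]

variable [IsGalois ℚ K]

/-- k is good for S -/
def good (S : Finset ℕ) (k : ℕ) : Prop := 1 ≤ k ∧ ∀ (q : ℕ) [Fact q.Prime], q ∈ S → ∀ u : ℚ_[q]ˣ,
  ‖(u : ℚ_[q]) - 1‖ ≤ (q : ℝ) ^ (-(k : ℤ)) → u ∈ NG ℚ_[q] K

variable {K}

lemma zpow_mono_aux {q : ℕ} (hq : q.Prime) {k k' : ℕ} (h : k ≤ k') : (q : ℝ) ^ (-(k' : ℤ)) ≤ (q : ℝ) ^ (-(k : ℤ)) :=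
  zpow_le_zpow_right₀ (by exact_mod_cast hq.one_lt.le) (by omega)

lemma good_mono {S : Finset ℕ} {k k' : ℕ} (h : good K S k) (hk : k ≤ k') : good K S k' :=
  ⟨h.1.trans hk, fun q hq hqS u hu => h.2 q hqS u (hu.trans (zpow_mono_aux hq.out hk))⟩

lemma exists_good {σ : K ≃ₐ[ℚ] K} (hσ : ∀ x, x ∈ Subgroup.zpowers σ) (S : Finset ℕ) (hS : ∀ q ∈ S, q.Prime) :
    ∃ k, good K S k := by
  classical
  induction S using Finset.induction_on with
  | empty => exact ⟨1, le_rfl, by simp⟩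
  | insert r S hr ih =>
    obtain ⟨k, hk⟩ := ih fun q hq => hS q (Finset.mem_insert_of_mem hq)
    have hrp := hS r (Finset.mem_insert_self _ _)
    have hf := Fact.mk hrp
    obtain ⟨ρ, hρ, hu⟩ := NG_open (K := K) (q := r) hσ
    obtain ⟨m, hm⟩ := exists_pow_lt_of_lt_one hρ (inv_lt_one_of_one_lt₀ (show (1 : ℝ) < (r : ℝ) by exact_mod_cast hrp.one_lt))
    refine ⟨max k m, hk.1.trans (le_max_left _ _), ?_⟩
    intro q hq hqS u hu'
    rcases Finset.mem_insert.mp hqS with rfl | hqS'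
    · apply hu
      refine (hu'.trans (zpow_mono_aux hrp (le_max_right k m))).trans ?_
      rw [zpow_neg, zpow_natCast, ← inv_pow]; exact hm.le
    · exact (good_mono hk (le_max_left k m)).2 q hqS' u hu'

lemma good_mem {S : Finset ℕ} {k : ℕ} (h : good K S k) {z : ℚˣ} {q : ℕ} [Fact q.Prime] (hq : q ∈ S)
    (t : ℚ_[q]ˣ) (hz : ‖((z : ℚ) : ℚ_[q]) / t - 1‖ ≤ (q : ℝ) ^ (-(k : ℤ))) : lm ℚ_[q] z / t ∈ NG ℚ_[q] K := by
  apply h.2 q hq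
  rw [Units.val_div_eq_div_val]; exact hz

lemma LQ_index {σ : K ≃ₐ[ℚ] K} (hσ : ∀ x, x ∈ Subgroup.zpowers σ) (q : ℕ) [hq : Fact q.Prime] :
    (LQ K q).index = (NG ℚ_[q] K).index := by
  rw [LQ_eq, Subgroup.index_comap, ← Subgroup.relIndex_sup_left, ← Subgroup.relIndex_top_right]
  congr 1
  rw [eq_top_iff]
  intro t _
  classical
  obtain ⟨k, hk⟩ := exists_good hσ {q} (by simpa using hq.out)
  obtain ⟨z, -, -, b, hb, -, h⟩ := WA {q} (by simpa using hq.out) k hk.1 1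
    (fun r hr => if h : q = r then by subst h; exact t else 1)
  have h1 := h q (by simp)
  have hb0 : (b : ℚ) ≠ 0 := by exact_mod_cast hb.ne'
  simp only [dite_true] at h1
  have h2 := good_mem hk (z := z * Units.mk0 (b : ℚ) hb0) (by simp) t (by simpa using h1)
  have h3 : t = (lm ℚ_[q] (z * Units.mk0 (b : ℚ) hb0) / t)⁻¹ * lm ℚ_[q] (z * Units.mk0 (b : ℚ) hb0) := by
    rw [inv_div, div_mul_cancel]
  rw [h3]
  exact Subgroup.mul_mem_sup (Subgroup.inv_mem _ h2) ⟨_, rfl⟩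

lemma LL_sup {σ : K ≃ₐ[ℚ] K} (hσ : ∀ x, x ∈ Subgroup.zpowers σ) (S : Finset ℕ) (hS : ∀ q ∈ S, q.Prime)
    (q : ℕ) (hq : q.Prime) (hqS : q ∉ S) : LQ K q ⊔ LL K S = ⊤ := by
  classical
  rw [eq_top_iff]
  intro y _
  have hf := Fact.mk hq
  have hS' : ∀ r ∈ insert q S, r.Prime := by
    intro r hr; rcases Finset.mem_insert.mp hr with rfl | h
    · exact hq
    · exact hS r h
  obtain ⟨k, hk⟩ := exists_good hσ (insert q S) hS'
  obtain ⟨z, -, hzp, b, hb, -, h⟩ := WA (insert q S) hS' k hk.1 1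
    (fun r hr => if r = q then lm ℚ_[r] y else 1)
  have hb0 : (b : ℚ) ≠ 0 := by exact_mod_cast hb.ne'
  set w : ℚˣ := z * Units.mk0 (b : ℚ) hb0 with hw
  have hwL : w ∈ LL K S := by
    rw [mem_LL]
    constructor
    · apply pos_mem_LI
      rw [hw, Units.val_mul, Units.val_mk0]
      simp only [Units.val_one, mul_one] at hzp
      exact mul_pos hzp (by exact_mod_cast hb)
    · intro r hr
      have hrp := Fact.mk (hS r hr)
      have h1 := h r (Finset.mem_insert_of_mem hr)
      rw [if_neg (fun e : r = q => hqS (e ▸ hr))] at h1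
      rw [LQ_eq]
      have := good_mem hk (z := w) (Finset.mem_insert_of_mem hr) 1 (by simpa [hw] using h1)
      rwa [div_one] at this
  have hyw : w / y ∈ LQ K q := by
    have h1 := h q (Finset.mem_insert_self _ _)
    rw [if_pos rfl] at h1
    rw [LQ_eq]
    have := good_mem hk (z := w) (Finset.mem_insert_self _ _) (lm ℚ_[q] y) (by simpa [hw] using h1)
    rwa [← map_div] at this
  have h3 : y = (w / y)⁻¹ * w := by rw [inv_div, div_mul_cancel]
  rw [h3]
  exact Subgroup.mul_mem_sup (Subgroup.inv_mem _ hyw) hwL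

theorem LL_index {σ : K ≃ₐ[ℚ] K} (hσ : ∀ x, x ∈ Subgroup.zpowers σ) (S : Finset ℕ) (hS : ∀ q ∈ S, q.Prime)
    {d : ℕ} (hd : Fintype.card (InfinitePlace K) * d = Module.finrank ℚ K) :
    (LL K S).index ≠ 0 ∧ (∏ q ∈ S, dq hσ q) * d ≤ (LL K S).index := by
  classical
  induction S using Finset.induction_on with
  | empty =>
    have : LL K ∅ = LI K := by simp [LL]
    rw [this]; simpa using LI_index K hd
  | insert q S hq ih =>
    have hqp := hS q (Finset.mem_insert_self _ _)
    have hf := Fact.mk hqp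
    have hS' : ∀ q ∈ S, q.Prime := fun q hq => hS q (Finset.mem_insert_of_mem hq)
    have h1 : LL K (insert q S) = LQ K q ⊓ LL K S := by
      ext z; simp only [mem_LL, Subgroup.mem_inf, Finset.forall_mem_insert]; tauto
    rw [h1, index_inf_of_sup (LL_sup hσ S hS' q hqp hq), LQ_index hσ q, Finset.prod_insert hq, mul_assoc]
    obtain ⟨h2, h3⟩ := dq_index hσ q
    exact ⟨mul_ne_zero h2 (ih hS').1, Nat.mul_le_mul (Nat.le_of_dvd (Nat.pos_of_ne_zero h2) h3) (ih hS').2⟩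

/-- class index -/
noncomputable def xi (K : Type) [Field K] [NumberField K] (S : Finset ℕ) : ℕ := (LL K S ⊔ ZS S).index

theorem counting {σ : K ≃ₐ[ℚ] K} (hσ : ∀ x, x ∈ Subgroup.zpowers σ) (S : Finset ℕ) (hS : ∀ q ∈ S, q.Prime)
    (hram : ∀ q : ℕ, q.Prime → (q : ℤ) ∣ discr K → q ∈ S) :
    xi K S ≠ 0 ∧ (xi K S ≤ Module.finrank ℚ K → xi K S = Module.finrank ℚ K ∧ LL K S ⊓ ZS S ≤ NU K S) := by
  obtain ⟨⟨d, hd⟩, hb, hb0, hb1⟩ := base_H hσ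
  obtain ⟨hU0, hU1, hU⟩ := US_H hσ _ hb hb0 hb1 S hS
  rw [H1_eq hσ S hS hram, mul_one, H0_eq hσ S hS] at hU
  rw [H0_eq hσ S hS] at hU0
  obtain ⟨hL0, hL⟩ := LL_index hσ S hS hd
  rw [← hU, mul_assoc, hd] at hL
  have hx : (LL K S).relIndex (ZS S) * xi K S = (LL K S).index := by
    rw [← Subgroup.relIndex_mul_index (le_sup_left : LL K S ≤ LL K S ⊔ ZS S), Subgroup.relIndex_sup_left]; rfl
  have hx0 : xi K S ≠ 0 := fun h => hL0 (by rw [← hx, h, mul_zero])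
  refine ⟨hx0, fun hle => ?_⟩
  have hle1 : NU K S ≤ LL K S ⊓ ZS S := le_inf (by rintro _ ⟨x, -, rfl⟩; exact gn_mem_LL K S x) (NU_le hσ S hS)
  have hmul : (NU K S).relIndex (LL K S ⊓ ZS S) * (LL K S).relIndex (ZS S) = (NU K S).relIndex (ZS S) := by
    rw [← Subgroup.inf_relIndex_right (LL K S)]
    exact Subgroup.relIndex_mul_relIndex _ _ _ hle1 inf_le_right
  set A := (NU K S).relIndex (LL K S ⊓ ZS S)
  set B := (LL K S).relIndex (ZS S)
  set C := (NU K S).relIndex (ZS S)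
  set n := Module.finrank ℚ K
  have hA : A ≠ 0 := fun h => hU0 (by rw [← hmul, h, zero_mul])
  have hB : B ≠ 0 := fun h => hU0 (by rw [← hmul, h, mul_zero])
  have hn : 0 < n := Module.finrank_pos
  rw [← hx, ← hmul] at hL
  have h1 : A * n ≤ xi K S := by
    refine le_of_mul_le_mul_left (a := B) ?_ (Nat.pos_of_ne_zero hB)
    rwa [← mul_assoc, mul_comm B A]
  have h2 : A = 1 := by
    by_contra hA1
    have : 2 * n ≤ A * n := Nat.mul_le_mul_right n (by omega)
    omega
  refine ⟨by rw [h2] at h1; omega, Subgroup.relIndex_eq_one.mp h2⟩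
end
end MN

namespace MN
set_option linter.unusedSectionVars false
set_option linter.unusedSimpArgs false
open scoped TensorProduct Pointwise
open IsDedekindDomain NumberField

/-- positive integers as units -/
def nu1 (b : ℕ) (hb : 0 < b) : ℚˣ := Units.mk0 (b : ℚ) (Nat.cast_ne_zero.mpr hb.ne')

/-- modulus -/
def MM (S : Finset ℕ) (k : ℕ) : ℕ := ∏ q ∈ S, q ^ k

lemma MM_pos {S : Finset ℕ} (hS : ∀ q ∈ S, q.Prime) (k : ℕ) : 0 < MM S k :=
  Finset.prod_pos fun q hq => pow_pos (hS q hq).pos _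

section
variable {K : Type} [Field K] [NumberField K] [IsGalois ℚ K]

lemma close_mem {S : Finset ℕ} (hS : ∀ q ∈ S, q.Prime) {k : ℕ} (hk : good K S k) {a b : ℕ} (ha : 0 < a) (hb : 0 < b)
    (hcb : ∀ q ∈ S, q.Coprime b) (hab : (a : ZMod (MM S k)) = b) : nu1 a ha / nu1 b hb ∈ LL K S := by
  rw [mem_LL]
  constructor
  · apply pos_mem_LI
    rw [Units.val_div_eq_div_val]
    exact div_pos (Nat.cast_pos.mpr ha) (Nat.cast_pos.mpr hb)
  · intro q hq
    have hf := Fact.mk (hS q hq)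
    rw [LQ_eq, Subgroup.mem_comap, map_div]
    refine good_mem hk hq _ ?_
    have h1 : ‖(b : ℚ_[q])‖ = 1 := Padic.norm_natCast_eq_one_iff.mpr (hcb q hq)
    have hb0 : (b : ℚ_[q]) ≠ 0 := by exact_mod_cast hb.ne'
    have e1 : (((nu1 a ha : ℚˣ) : ℚ) : ℚ_[q]) = a := by simp [nu1]
    have e2 : ((lm ℚ_[q] (nu1 b hb) : ℚ_[q]ˣ) : ℚ_[q]) = b := by simp [lm, nu1]
    rw [e1, e2, div_sub_one hb0, norm_div, h1, div_one]
    have h2 : ((a : ℚ_[q]) - b) = (((a : ℤ) - (b : ℤ) : ℤ) : ℚ_[q]) := by push_cast; rfl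
    rw [h2, Padic.norm_int_le_pow_iff_dvd]
    have h3 := Nat.modEq_iff_dvd.mp ((ZMod.natCast_eq_natCast_iff _ _ _).mp hab).symm
    refine dvd_trans ?_ h3
    have h4 : q ^ k ∣ MM S k := Finset.dvd_prod_of_mem (fun q => q ^ k) hq
    exact_mod_cast h4

theorem classes {σ : K ≃ₐ[ℚ] K} (hσ : ∀ x, x ∈ Subgroup.zpowers σ) {S : Finset ℕ} (hS : ∀ q ∈ S, q.Prime) {k : ℕ}
    (hk : good K S k) : ∃ A : Finset (ZMod (MM S k)), (∀ a ∈ A, IsUnit a) ∧ A.card * xi K S = (MM S k).totient ∧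
      ∀ (p : ℕ) (hp : p.Prime), p ∉ S → (uq p hp ∈ LL K S ⊔ ZS S ↔ (p : ZMod (MM S k)) ∈ A) := by
  classical
  set M := MM S k with hM
  have hMpos := MM_pos hS k
  rw [← hM] at hMpos
  have hNZ : NeZero M := ⟨hMpos.ne'⟩
  set W := LL K S ⊔ ZS S with hW
  let rp : (ZMod M)ˣ → ℕ := fun u => (u : ZMod M).val + M
  have rpos : ∀ u, 0 < rp u := fun u => by simp only [rp]; omega
  have rcast : ∀ u, ((rp u : ℕ) : ZMod M) = u := by
    intro u; simp only [rp]; push_cast; simp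
  have rcop' : ∀ b : ℕ, IsUnit (b : ZMod M) → ∀ q ∈ S, q.Coprime b := by
    intro b hb q hq
    rw [ZMod.isUnit_iff_coprime] at hb
    have h1 : q ∣ M := (dvd_pow_self q (by have := hk.1; omega)).trans (Finset.dvd_prod_of_mem (fun q => q ^ k) hq)
    exact (Nat.Coprime.coprime_dvd_right h1 hb).symm
  have copr : ∀ b : ℕ, (∀ q ∈ S, q.Coprime b) → b.Coprime M := by
    intro b hb
    exact Nat.Coprime.prod_right fun q hq => Nat.Coprime.pow_right _ (hb q hq).symm
  have rcop : ∀ u, ∀ q ∈ S, q.Coprime (rp u) := fun u => rcop' _ (by rw [rcast]; exact u.isUnit)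
  let mk := QuotientGroup.mk' W
  have hmk : ∀ {a b : ℕ} (ha : 0 < a) (hb : 0 < b), (∀ q ∈ S, q.Coprime b) → (a : ZMod M) = b → mk (nu1 a ha) = mk (nu1 b hb) := by
    intro a b ha hb hcb hab
    have h1 := close_mem hS hk ha hb hcb hab
    rw [← div_eq_one, ← map_div]
    exact (QuotientGroup.eq_one_iff _).mpr (Subgroup.mem_sup_left h1)
  have hmul : ∀ {a b : ℕ} (ha : 0 < a) (hb : 0 < b), nu1 a ha * nu1 b hb = nu1 (a * b) (Nat.mul_pos ha hb) := by
    intro a b ha hb; apply Units.ext; simp [nu1]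
  let θ : (ZMod M)ˣ →* ℚˣ ⧸ W := MonoidHom.mk' (fun u => mk (nu1 (rp u) (rpos u))) (by
    intro u v
    change mk _ = mk _ * mk _
    rw [← map_mul, hmul]
    refine hmk _ _ (fun q hq => Nat.Coprime.mul_right (rcop u q hq) (rcop v q hq)) ?_
    push_cast
    rw [rcast, rcast, rcast]; rfl)
  have hθ : ∀ (b : ℕ) (hb : 0 < b) (u : (ZMod M)ˣ), (b : ZMod M) = u → θ u = mk (nu1 b hb) := by
    intro b hb u hbu
    refine hmk _ _ (rcop' b (by rw [hbu]; exact u.isUnit)) ?_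
    rw [rcast, hbu]
  have hsurj : Function.Surjective θ := by
    intro y
    obtain ⟨y, rfl⟩ := QuotientGroup.mk'_surjective W y
    obtain ⟨z, hz, hzp, b, hb, hbc, h⟩ := WA S hS k hk.1 y (fun r hr => lm ℚ_[r] y)
    have hcop := copr b hbc
    refine ⟨ZMod.unitOfCoprime b hcop, ?_⟩
    rw [hθ b hb _ rfl, ← div_eq_one, ← map_div]
    refine (QuotientGroup.eq_one_iff _).mpr ?_
    have h1 : nu1 b hb / y = (z * nu1 b hb / y) * z⁻¹ := by
      rw [mul_div_assoc, mul_comm z, mul_inv_cancel_right]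
    rw [h1]
    refine Subgroup.mul_mem_sup ?_ (Subgroup.inv_mem _ hz)
    rw [mem_LL]
    constructor
    · apply pos_mem_LI
      rw [Units.val_div_eq_div_val, Units.val_mul]
      have hy2 : (0 : ℚ) < (y : ℚ) * y := mul_self_pos.mpr y.ne_zero
      have hbq : (0 : ℚ) < (nu1 b hb : ℚ) := Nat.cast_pos.mpr hb
      have e : (z : ℚ) * (nu1 b hb : ℚ) / y = (z * y) * (nu1 b hb : ℚ) / ((y : ℚ) * y) := by
        have := y.ne_zero; field_simp
      rw [e]
      exact div_pos (mul_pos hzp hbq) hy2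
    · intro q hq
      have hf := Fact.mk (hS q hq)
      rw [LQ_eq, Subgroup.mem_comap, map_div]
      refine good_mem hk hq _ ?_
      have h2 := h q hq
      simpa [nu1] using h2
  refine ⟨(Finset.univ.filter (fun u : (ZMod M)ˣ => θ u = 1)).image (Units.val : (ZMod M)ˣ → ZMod M), ?_, ?_, ?_⟩
  · intro a ha
    obtain ⟨u, -, rfl⟩ := Finset.mem_image.mp ha
    exact u.isUnit
  · rw [Finset.card_image_of_injective _ Units.val_injective]
    have h1 : (Finset.univ.filter (fun u : (ZMod M)ˣ => θ u = 1)).card = Nat.card θ.ker := by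
      rw [Nat.card_eq_fintype_card, ← Fintype.card_coe]
      refine Fintype.card_congr (Equiv.subtypeEquivRight fun u => ?_)
      simp [MonoidHom.mem_ker]
    have h2 : xi K S = θ.ker.index := by
      rw [Subgroup.index_ker, MonoidHom.range_eq_top.mpr hsurj, xi, Subgroup.index]
      exact (Nat.card_congr (Subgroup.topEquiv).toEquiv).symm
    rw [h1, h2, Subgroup.card_mul_index, Nat.card_eq_fintype_card, ZMod.card_units_eq_totient]
  · intro p hp hpS
    have hcop : p.Coprime M := copr p fun q hq => (Nat.coprime_primes (hS q hq) hp).mpr fun e => hpS (e ▸ hq)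
    have h1 := hθ p hp.pos (ZMod.unitOfCoprime p hcop) rfl
    have h2 : uq p hp ∈ W ↔ θ (ZMod.unitOfCoprime p hcop) = 1 := by
      rw [h1]; exact (QuotientGroup.eq_one_iff _).symm
    rw [h2]
    constructor
    · intro h; exact Finset.mem_image.mpr ⟨_, by simpa using h, rfl⟩
    · intro h
      obtain ⟨u, hu, hup⟩ := Finset.mem_image.mp h
      have : u = ZMod.unitOfCoprime p hcop := Units.ext hup
      rw [← this]; simpa using hu
end
end MN


namespace MN
set_option linter.unusedSectionVars false
set_option linter.unusedSimpArgs false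

open ArithmeticFunction ArithmeticFunction.vonMangoldt in
lemma residue_upper {q : ℕ} [NeZero q] {a : ZMod q} (ha : IsUnit a) :
    ∃ C : ℝ, ∀ (x : ℝ), 1 < x → x ≤ 2 →
      ∑' n, residueClass a n / (n : ℝ) ^ x ≤ (q.totient : ℝ)⁻¹ / (x - 1) + C := by
  have H {x : ℝ} (hx : 1 < x) :
      ∑' n, residueClass a n / (n : ℝ) ^ x =
        (LFunctionResidueClassAux a x).re + (q.totient : ℝ)⁻¹ / (x - 1) := by
    refine Complex.ofReal_injective ?_
    simp only [Complex.ofReal_tsum, Complex.ofReal_div, Complex.ofReal_cpow (Nat.cast_nonneg _), Complex.ofReal_natCast,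
      Complex.ofReal_add, Complex.ofReal_inv, Complex.ofReal_sub, Complex.ofReal_one]
    simp_rw [← LFunctionResidueClassAux_real ha hx,
      eqOn_LFunctionResidueClassAux ha <| Set.mem_ofPred.mpr (Complex.ofReal_re x ▸ hx), sub_add_cancel,
      LSeries, LSeries.term]
    refine tsum_congr fun n ↦ ?_
    split_ifs with hn
    · simp only [hn, residueClass_apply_zero, Complex.ofReal_zero, zero_div]
    · rfl
  have : ContinuousOn (fun x : ℝ ↦ (LFunctionResidueClassAux a x).re) (Set.Icc 1 2) :=
    Complex.continuous_re.continuousOn.comp (t := Set.univ) (continuousOn_LFunctionResidueClassAux a)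
      (fun ⦃x⦄ a ↦ trivial) |>.comp Complex.continuous_ofReal.continuousOn fun x hx ↦ by
        simpa only [Set.mem_ofPred_eq, Complex.ofReal_re] using hx.1
  obtain ⟨C, hC⟩ := bddAbove_def.mp <| IsCompact.bddAbove_image isCompact_Icc this
  refine ⟨C, fun x hx hx2 ↦ ?_⟩
  rw [H hx, add_comm, add_le_add_iff_left]
  exact hC _ (Set.mem_image_of_mem (fun x : ℝ ↦ (LFunctionResidueClassAux a x).re) ⟨hx.le, hx2⟩)

open ArithmeticFunction ArithmeticFunction.vonMangoldt in
lemma prime_log_upper {q : ℕ} [NeZero q] {a : ZMod q} (ha : IsUnit a) :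
    ∃ C : ℝ, ∀ F : Finset ℕ, (∀ p ∈ F, p.Prime ∧ (p : ZMod q) = a) → ∀ (x : ℝ), 1 < x → x ≤ 2 →
      ∑ p ∈ F, Real.log p * (p : ℝ) ^ (-x) ≤ (q.totient : ℝ)⁻¹ / (x - 1) + C := by
  obtain ⟨C, hC⟩ := residue_upper ha
  refine ⟨C, fun F hF x hx hx2 => le_trans ?_ (hC x hx hx2)⟩
  have hsum : Summable fun n : ℕ => residueClass a n / (n : ℝ) ^ x :=
    LSeries.summable_real_of_abscissaOfAbsConv_lt <|
        (abscissaOfAbsConv_residueClass_le_one a).trans_lt <| by exact_mod_cast hx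
  refine le_trans (Finset.sum_le_sum fun p hp => ?_) (hsum.sum_le_tsum F fun n _ =>
    div_nonneg (residueClass_nonneg a n) (by positivity))
  obtain ⟨hp1, hp2⟩ := hF p hp
  have : residueClass a p = Real.log p := by
    rw [residueClass, Set.indicator_of_mem (show p ∈ {n : ℕ | (n : ZMod q) = a} from hp2), vonMangoldt_apply_prime hp1]
  rw [this, Real.rpow_neg (Nat.cast_nonneg _), div_eq_mul_inv]

theorem prime_upper {q : ℕ} [NeZero q] {a : ZMod q} (ha : IsUnit a) :
    ∃ C : ℝ, ∀ F : Finset ℕ, (∀ p ∈ F, p.Prime ∧ (p : ZMod q) = a) → ∀ (x : ℝ), 1 < x → x ≤ 2 →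
      ∑ p ∈ F, (p : ℝ) ^ (-x) ≤ (q.totient : ℝ)⁻¹ * Real.log (1 / (x - 1)) + C := by
  obtain ⟨C, hC⟩ := prime_log_upper ha
  have hs2 : Summable fun n : ℕ => (n : ℝ) ^ (-2 : ℝ) := Real.summable_nat_rpow.mpr (by norm_num)
  refine ⟨(∑' n : ℕ, (n : ℝ) ^ (-2 : ℝ)) + |C|, fun F hF x hx hx2 => ?_⟩
  set φ := (q.totient : ℝ)⁻¹
  let f : ℝ → ℝ := fun s => ∑ p ∈ F, (p : ℝ) ^ (-s) + φ * Real.log (s - 1) + |C| * s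
  have hder : ∀ s : ℝ, 1 < s → HasDerivAt f (∑ p ∈ F, -(Real.log p * (p : ℝ) ^ (-s)) + φ / (s - 1) + |C|) s := by
    intro s hs
    have h1 : ∀ p ∈ F, HasDerivAt (fun s : ℝ => (p : ℝ) ^ (-s)) (-(Real.log p * (p : ℝ) ^ (-s))) s := by
      intro p hp
      have hp0 : (0 : ℝ) < p := Nat.cast_pos.mpr (hF p hp).1.pos
      have := (hasDerivAt_neg s).const_rpow hp0
      convert this using 1
      ring
    have h2 : HasDerivAt (fun s : ℝ => φ * Real.log (s - 1)) (φ / (s - 1)) s := by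
      have := (((hasDerivAt_id s).sub_const 1).log (by simp only [id]; linarith)).const_mul φ
      refine HasDerivAt.congr_deriv this ?_
      change φ * (1 / (s - 1)) = _
      ring
    have h3 : HasDerivAt (fun s : ℝ => |C| * s) |C| s := by
      simpa using (hasDerivAt_id s).const_mul |C|
    exact ((HasDerivAt.fun_sum h1).add h2).add h3
  have hmono : MonotoneOn f (Set.Icc x 2) := by
    apply monotoneOn_of_deriv_nonneg (convex_Icc x 2)
    · exact fun s hs => (hder s (by linarith [hs.1])).continuousAt.continuousWithinAt
    · intro s hs
      rw [interior_Icc] at hs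
      exact (hder s (by linarith [hs.1])).differentiableAt.differentiableWithinAt
    · intro s hs
      rw [interior_Icc] at hs
      rw [(hder s (by linarith [hs.1])).deriv, Finset.sum_neg_distrib]
      have := hC F hF s (by linarith [hs.1]) hs.2.le
      have := le_abs_self C
      linarith
  have h := hmono ⟨le_rfl, hx2⟩ ⟨hx2, le_rfl⟩ hx2
  have h2 : ∑ p ∈ F, (p : ℝ) ^ (-(2 : ℝ)) ≤ ∑' n : ℕ, (n : ℝ) ^ (-2 : ℝ) :=
    hs2.sum_le_tsum F fun n _ => by positivity
  simp only [f] at h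
  rw [show (2 : ℝ) - 1 = 1 by norm_num, Real.log_one] at h
  rw [one_div, Real.log_inv]
  have h3 : |C| * 1 ≤ |C| * x := mul_le_mul_of_nonneg_left hx.le (abs_nonneg C)
  linarith
end MN

namespace MN
set_option linter.unusedSectionVars false
set_option linter.unusedSimpArgs false
open scoped TensorProduct Pointwise Topology
open IsDedekindDomain NumberField

section
variable {K : Type} [Field K] [NumberField K]

lemma absNorm_over {p : ℕ} (hp : p.Prime) (P : Ideal (𝓞 K)) (hP : P.IsPrime) (h : (p : 𝓞 K) ∈ P) :
    ∃ f : ℕ, 1 ≤ f ∧ Ideal.absNorm P = p ^ f := by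
  have h1 : P ∣ Ideal.span {(p : 𝓞 K)} := Ideal.dvd_span_singleton.mpr h
  have h2 := map_dvd (Ideal.absNorm (S := 𝓞 K)) h1
  rw [Ideal.absNorm_span_natCast, Nat.dvd_prime_pow hp] at h2
  obtain ⟨f, -, hf⟩ := h2
  refine ⟨f, ?_, hf⟩
  by_contra h0
  have : f = 0 := by omega
  rw [this, pow_zero, Ideal.absNorm_eq_one_iff] at hf
  exact hP.ne_top hf

lemma card_over {p : ℕ} (hp : p.Prime) (T : Finset (Ideal (𝓞 K))) (hT : ∀ P ∈ T, Prime P ∧ (p : 𝓞 K) ∈ P) :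
    T.card ≤ Module.finrank ℚ K := by
  have h1 : ∏ P ∈ T, P ∣ Ideal.span {(p : 𝓞 K)} :=
    Finset.prod_primes_dvd _ (fun P hP => (hT P hP).1) fun P hP => Ideal.dvd_span_singleton.mpr (hT P hP).2
  have h2 := map_dvd (Ideal.absNorm (S := 𝓞 K)) h1
  rw [Ideal.absNorm_span_natCast, map_prod] at h2
  have h3 : p ^ T.card ∣ ∏ P ∈ T, Ideal.absNorm P := by
    rw [← Finset.prod_const]
    refine Finset.prod_dvd_prod_of_dvd _ _ fun P hP => ?_
    obtain ⟨f, hf, e⟩ := absNorm_over hp P (Ideal.isPrime_of_prime (hT P hP).1) (hT P hP).2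
    rw [e]; exact dvd_pow_self p (by omega)
  have h4 := (Nat.pow_dvd_pow_iff_le_right hp.one_lt).mp (h3.trans h2)
  rwa [RingOfIntegers.rank] at h4

lemma euler_bound {s : ℝ} (hs : 1 < s) (I : Finset (Ideal (𝓞 K))) (hI : ∀ J ∈ I, J ≠ ⊥) :
    ∃ T : Finset (Ideal (𝓞 K)), (∀ P ∈ T, Prime P) ∧
      ∑ J ∈ I, (Ideal.absNorm J : ℝ) ^ (-s) ≤ ∏ P ∈ T, (1 - (Ideal.absNorm P : ℝ) ^ (-s))⁻¹ := by
  classical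
  let nf : Ideal (𝓞 K) → Multiset (Ideal (𝓞 K)) := UniqueFactorizationMonoid.normalizedFactors
  let T : Finset (Ideal (𝓞 K)) := I.biUnion fun J => (nf J).toFinset
  have hTp : ∀ P ∈ T, Prime P := by
    intro P hP
    obtain ⟨J, hJ, hPJ⟩ := Finset.mem_biUnion.mp hP
    exact UniqueFactorizationMonoid.prime_of_normalized_factor P (Multiset.mem_toFinset.mp hPJ)
  let E : ℕ := (I.sup fun J => (nf J).card) + 1
  let f : Ideal (𝓞 K) → ℝ := fun J => (Ideal.absNorm J : ℝ) ^ (-s)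
  have hfm : ∀ A B, f (A * B) = f A * f B := by
    intro A B; simp only [f]
    rw [map_mul, Nat.cast_mul, Real.mul_rpow (Nat.cast_nonneg _) (Nat.cast_nonneg _)]
  have hf1 : f 1 = 1 := by simp [f]
  let fh : Ideal (𝓞 K) →* ℝ := ⟨⟨f, hf1⟩, hfm⟩
  have hf0 : ∀ A, 0 ≤ f A := fun A => Real.rpow_nonneg (Nat.cast_nonneg _) _
  refine ⟨T, hTp, ?_⟩
  have hlt : ∀ P ∈ T, f P < 1 := by
    intro P hP
    have h2 : 1 < Ideal.absNorm P := by
      have ha : Ideal.absNorm P ≠ 0 := fun h => (hTp P hP).ne_zero (Ideal.absNorm_eq_zero_iff.mp h)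
      have hb : Ideal.absNorm P ≠ 1 := fun h => (hTp P hP).not_isUnit (by
        rw [Ideal.absNorm_eq_one_iff] at h; rw [h, ← Ideal.one_eq_top]; exact isUnit_one)
      omega
    exact Real.rpow_lt_one_of_one_lt_of_neg (by exact_mod_cast h2) (by linarith)
  let ex : Ideal (𝓞 K) → ({P // P ∈ T} → ℕ) := fun J P => (nf J).count P.1
  have hprod : ∀ J ∈ I, ∏ P : {P // P ∈ T}, P.1 ^ ex J P = J := by
    intro J hJ
    conv_rhs => rw [← Ideal.prod_normalizedFactors_eq_self (hI J hJ)]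
    rw [Finset.prod_multiset_count_of_subset _ T (Finset.subset_biUnion_of_mem (fun J => (nf J).toFinset) hJ)]
    rw [← Finset.prod_coe_sort T]
  have hinj : Set.InjOn ex I := by
    intro J hJ J' hJ' e
    rw [← hprod J hJ, ← hprod J' hJ', e]
  have hmem : ∀ J ∈ I, ex J ∈ Fintype.piFinset (fun _ : {P // P ∈ T} => Finset.range E) := by
    intro J hJ
    rw [Fintype.mem_piFinset]
    intro P
    rw [Finset.mem_range]
    have h1 : (nf J).card ≤ I.sup fun J => (nf J).card := Finset.le_sup (f := fun J => (nf J).card) hJ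
    have h2 := Multiset.count_le_card P.1 (nf J)
    exact Nat.lt_succ_of_le (h2.trans h1)
  calc ∑ J ∈ I, f J = ∑ J ∈ I, ∏ P : {P // P ∈ T}, f P.1 ^ ex J P := by
        refine Finset.sum_congr rfl fun J hJ => ?_
        conv_lhs => rw [← hprod J hJ]
        change fh _ = ∏ P : {P // P ∈ T}, fh P.1 ^ ex J P
        rw [map_prod]; simp only [map_pow]
    _ = ∑ e ∈ I.image ex, ∏ P : {P // P ∈ T}, f P.1 ^ e P := by
        rw [Finset.sum_image hinj]
    _ ≤ ∑ e ∈ Fintype.piFinset (fun _ : {P // P ∈ T} => Finset.range E), ∏ P : {P // P ∈ T}, f P.1 ^ e P := by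
        refine Finset.sum_le_sum_of_subset_of_nonneg ?_ fun e _ _ => Finset.prod_nonneg fun P _ => pow_nonneg (hf0 _) _
        intro e he
        obtain ⟨J, hJ, rfl⟩ := Finset.mem_image.mp he
        exact hmem J hJ
    _ = ∏ P : {P // P ∈ T}, ∑ j ∈ Finset.range E, f P.1 ^ j := (Finset.prod_univ_sum _ _).symm
    _ ≤ ∏ P : {P // P ∈ T}, (1 - f P.1)⁻¹ := by
        refine Finset.prod_le_prod (fun P _ => Finset.sum_nonneg fun j _ => pow_nonneg (hf0 _) _) fun P _ => ?_
        rw [← tsum_geometric_of_lt_one (hf0 _) (hlt P.1 P.2)]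
        exact (summable_geometric_of_lt_one (hf0 _) (hlt P.1 P.2)).sum_le_tsum _ fun j _ => pow_nonneg (hf0 _) _
    _ = ∏ P ∈ T, (1 - f P)⁻¹ := Finset.prod_coe_sort T fun P => (1 - f P)⁻¹

lemma log_aux {t : ℝ} (_h0 : 0 ≤ t) (h1 : t ≤ 1 / 2) : Real.log ((1 - t)⁻¹) ≤ t + 2 * t ^ 2 := by
  have h2 : 0 < 1 - t := by linarith
  have h3 := Real.log_le_sub_one_of_pos (inv_pos.mpr h2)
  refine h3.trans ?_
  rw [inv_eq_one_div, div_sub_one h2.ne', div_le_iff₀ h2]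
  nlinarith [sq_nonneg t, mul_nonneg (sq_nonneg t) (by linarith : 0 ≤ 1 / 2 - t)]

lemma zeta_partial : ∃ r : ℝ, 0 < r ∧ ∃ δ : ℝ, 0 < δ ∧ ∀ s : ℝ, 1 < s → s < 1 + δ →
    ∃ I : Finset (Ideal (𝓞 K)), (∀ J ∈ I, J ≠ ⊥) ∧ r / (s - 1) ≤ ∑ J ∈ I, (Ideal.absNorm J : ℝ) ^ (-s) := by
  classical
  have hr := dedekindZeta_residue_pos K
  have ht := tendsto_sub_one_mul_dedekindZeta_nhdsGT K
  set r := dedekindZeta_residue K with hrdef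
  have hev := ht.eventually (Metric.ball_mem_nhds _ (show 0 < r / 4 by linarith))
  obtain ⟨δ, hδ, h⟩ := (mem_nhdsGT_iff_exists_Ioo_subset).mp hev
  refine ⟨r / 2, by linarith, δ - 1, by linarith [Set.mem_Ioi.mp hδ], fun s hs hs2 => ?_⟩
  have hs1 : 0 < s - 1 := by linarith
  have h1 : dist (((s : ℂ) - 1) * dedekindZeta K s) (r : ℂ) < r / 4 := h ⟨hs, show s < δ by linarith⟩
  rw [dist_eq_norm] at h1
  let cf : ℕ → ℕ := fun n => Nat.card {I : Ideal (𝓞 K) // Ideal.absNorm I = n}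
  have hz : dedekindZeta K s = ∑' n, LSeries.term (fun n => (cf n : ℂ)) s n := rfl
  have hsum : Summable (LSeries.term (fun n => (cf n : ℂ)) s) := by
    by_contra hns
    rw [hz, tsum_eq_zero_of_not_summable hns, mul_zero, zero_sub, norm_neg, Complex.norm_real, Real.norm_eq_abs,
      abs_of_pos hr] at h1
    linarith
  have hhs := hsum.hasSum
  rw [← hz] at hhs
  obtain ⟨N, hN⟩ := (hhs.eventually (Metric.ball_mem_nhds _ (show 0 < (r / 4) / (s - 1) by positivity))).exists
  rw [dist_eq_norm] at hN
  have hterm : ∀ n, LSeries.term (fun n => (cf n : ℂ)) s n = (((if n = 0 then 0 else (cf n : ℝ) * (n : ℝ) ^ (-s)) : ℝ) : ℂ) := by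
    intro n
    rw [LSeries.term]
    split_ifs with hn
    · simp
    · rw [Real.rpow_neg (Nat.cast_nonneg _), ← div_eq_mul_inv, Complex.ofReal_div, Complex.ofReal_cpow (Nat.cast_nonneg _)]
      simp
  have hreal : r / 2 / (s - 1) ≤ ∑ n ∈ N, (if n = 0 then 0 else (cf n : ℝ) * (n : ℝ) ^ (-s)) := by
    rw [Finset.sum_congr rfl fun n _ => hterm n, ← Complex.ofReal_sum] at hN
    set Y := ∑ n ∈ N, (if n = 0 then 0 else (cf n : ℝ) * (n : ℝ) ^ (-s))
    have a1 := (Complex.abs_re_le_norm _).trans_lt hN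
    rw [Complex.sub_re, Complex.ofReal_re, abs_lt] at a1
    have a2 := (Complex.abs_re_le_norm _).trans_lt h1
    have e : (((s : ℂ) - 1) * dedekindZeta K s - (r : ℂ)).re = (s - 1) * (dedekindZeta K s).re - r := by
      rw [Complex.sub_re, Complex.ofReal_re, ← Complex.ofReal_one, ← Complex.ofReal_sub, Complex.re_ofReal_mul]
    rw [e, abs_lt] at a2
    rw [div_le_iff₀ hs1]
    have a3 : (s - 1) * (r / 4 / (s - 1)) = r / 4 := by field_simp
    have a4 := mul_lt_mul_of_pos_left a1.1 hs1
    rw [mul_neg, a3] at a4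
    nlinarith [a2.1]
  let fi : ℕ → Finset (Ideal (𝓞 K)) := fun n => (Ideal.finite_setOfPred_absNorm_eq (S := 𝓞 K) n).toFinset
  have hfi : ∀ n J, J ∈ fi n ↔ Ideal.absNorm J = n := by
    intro n J; simp [fi]
  refine ⟨(N.filter (· ≠ 0)).biUnion fi, ?_, ?_⟩
  · intro J hJ e
    obtain ⟨n, hn, hJn⟩ := Finset.mem_biUnion.mp hJ
    rw [hfi, e, Ideal.absNorm_bot] at hJn
    exact (Finset.mem_filter.mp hn).2 hJn.symm
  · refine hreal.trans (le_of_eq ?_)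
    rw [Finset.sum_biUnion, Finset.sum_filter]
    · refine Finset.sum_congr rfl fun n _ => ?_
      by_cases hn : n = 0
      · simp [hn]
      · rw [if_neg hn, if_pos hn, Finset.sum_congr rfl fun J hJ => by rw [(hfi n J).mp hJ], Finset.sum_const, nsmul_eq_mul]
        have e : cf n = (fi n).card := Set.ncard_eq_toFinset_card _ (Ideal.finite_setOfPred_absNorm_eq (S := 𝓞 K) n)
        rw [e]
    · intro n _ m _ hnm
      change Disjoint (fi n) (fi m)
      rw [Finset.disjoint_left]
      intro J hJ hJ'
      rw [hfi] at hJ hJ'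
      exact hnm (hJ.symm.trans hJ')

theorem split_lower (K : Type) [Field K] [NumberField K] (S : Finset ℕ) : ∃ C : ℝ, ∃ δ : ℝ, 0 < δ ∧ ∀ s : ℝ, 1 < s → s < 1 + δ →
    ∃ F : Finset ℕ, (∀ p ∈ F, p.Prime ∧ p ∉ S ∧ ∃ P : HeightOneSpectrum (𝓞 K), Ideal.absNorm P.asIdeal = p) ∧
      Real.log (1 / (s - 1)) ≤ Module.finrank ℚ K * ∑ p ∈ F, (p : ℝ) ^ (-s) + C := by
  classical
  obtain ⟨r, hr, δ, hδ, h⟩ := zeta_partial (K := K)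
  set n := Module.finrank ℚ K
  have hs2 : Summable fun n : ℕ => (n : ℝ) ^ (-2 : ℝ) := Real.summable_nat_rpow.mpr (by norm_num)
  set Z := ∑' n : ℕ, (n : ℝ) ^ (-2 : ℝ)
  refine ⟨n * (3 * Z + S.card) - Real.log r, δ, hδ, fun s hs hsδ => ?_⟩
  obtain ⟨I, hI0, hI⟩ := h s hs hsδ
  obtain ⟨T, hT, hTI⟩ := euler_bound hs I hI0
  have hs1 : 0 < s - 1 := by linarith
  have hex : ∀ P : Ideal (𝓞 K), ∃ q : ℕ, Prime P → q.Prime ∧ (q : 𝓞 K) ∈ P := by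
    intro P
    by_cases hP : Prime P
    · obtain ⟨q, hq⟩ := exists_prime_mem (K := K) ⟨P, Ideal.isPrime_of_prime hP, hP.ne_zero⟩
      exact ⟨q, fun _ => hq⟩
    · exact ⟨0, fun h => absurd h hP⟩
  choose pr hpr using hex
  let F : Finset ℕ := ((T.filter fun P => Ideal.absNorm P = pr P).image pr).filter (· ∉ S)
  refine ⟨F, ?_, ?_⟩
  · intro p hp
    obtain ⟨hp1, hp2⟩ := Finset.mem_filter.mp hp
    obtain ⟨P, hP, rfl⟩ := Finset.mem_image.mp hp1
    obtain ⟨hP1, hP2⟩ := Finset.mem_filter.mp hP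
    exact ⟨(hpr P (hT P hP1)).1, hp2, ⟨P, Ideal.isPrime_of_prime (hT P hP1), (hT P hP1).ne_zero⟩, hP2⟩
  let b : ℕ → ℝ := fun p => (if p ∈ F then (p : ℝ) ^ (-s) else 0) + 3 * (p : ℝ) ^ (-2 : ℝ) + (if p ∈ S then 1 else 0)
  have hb0 : ∀ p, 0 ≤ b p := by
    intro p; simp only [b]
    have : (0 : ℝ) ≤ (p : ℝ) ^ (-s) := by positivity
    have : (0 : ℝ) ≤ (p : ℝ) ^ (-2 : ℝ) := by positivity
    split_ifs <;> linarith
  have hterm : ∀ P ∈ T, 0 < (1 - (Ideal.absNorm P : ℝ) ^ (-s))⁻¹ ∧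
      Real.log ((1 - (Ideal.absNorm P : ℝ) ^ (-s))⁻¹) ≤ b (pr P) := by
    intro P hP
    obtain ⟨hp, hpP⟩ := hpr P (hT P hP)
    obtain ⟨f, hf, hN⟩ := absNorm_over hp P (Ideal.isPrime_of_prime (hT P hP)) hpP
    set p := pr P with hpdef
    have hp2 : (2 : ℝ) ≤ p := by exact_mod_cast hp.two_le
    have hp1 : (1 : ℝ) ≤ p := by linarith
    set t := (Ideal.absNorm P : ℝ) ^ (-s) with ht
    have ht0 : 0 ≤ t := by positivity
    have ht1 : t ≤ (p : ℝ) ^ (-1 : ℝ) := by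
      have e1 : (p : ℝ) ≤ (Ideal.absNorm P : ℝ) := by
        rw [hN]; push_cast; exact le_self_pow₀ hp1 (by omega)
      calc t ≤ (p : ℝ) ^ (-s) := Real.rpow_le_rpow_of_nonpos (by linarith) e1 (by linarith)
        _ ≤ _ := Real.rpow_le_rpow_of_exponent_le hp1 (by linarith)
    have hth : t ≤ 1 / 2 := by
      refine ht1.trans ?_
      rw [Real.rpow_neg_one, one_div]
      exact inv_anti₀ (by norm_num) hp2
    have ht2 : t ^ 2 ≤ (p : ℝ) ^ (-2 : ℝ) := by
      have e2 : (p : ℝ) ^ (-2 : ℝ) = ((p : ℝ) ^ (-1 : ℝ)) ^ 2 := by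
        rw [← Real.rpow_natCast, ← Real.rpow_mul (by linarith)]; norm_num
      rw [e2]; exact pow_le_pow_left₀ ht0 ht1 2
    refine ⟨inv_pos.mpr (by linarith), (log_aux ht0 hth).trans ?_⟩
    have hp0 : (0 : ℝ) ≤ (p : ℝ) ^ (-s) := by positivity
    have hp0' : (0 : ℝ) ≤ (p : ℝ) ^ (-2 : ℝ) := by positivity
    simp only [b]
    by_cases hf1 : f = 1
    · rw [hf1, pow_one] at hN
      by_cases hpS : p ∈ S
      · rw [if_pos hpS]
        have : (0 : ℝ) ≤ if p ∈ F then (p : ℝ) ^ (-s) else 0 := by split_ifs <;> linarith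
        linarith
      · have hpF : p ∈ F := Finset.mem_filter.mpr ⟨Finset.mem_image.mpr ⟨P, Finset.mem_filter.mpr ⟨hP, hN⟩, rfl⟩, hpS⟩
        rw [if_pos hpF, if_neg hpS, ht, hN]
        rw [ht, hN] at ht2
        linarith
    · have e3 : t ≤ (p : ℝ) ^ (-2 : ℝ) := by
        have e4 : ((p : ℝ) ^ 2) ≤ (Ideal.absNorm P : ℝ) := by
          rw [hN]; push_cast; exact pow_le_pow_right₀ hp1 (by omega)
        calc t ≤ ((p : ℝ) ^ 2) ^ (-s) := Real.rpow_le_rpow_of_nonpos (by positivity) e4 (by linarith)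
          _ ≤ ((p : ℝ) ^ 2) ^ (-1 : ℝ) := Real.rpow_le_rpow_of_exponent_le (by nlinarith) (by linarith)
          _ = _ := by rw [← Real.rpow_natCast, ← Real.rpow_mul (by linarith)]; norm_num
      have : (0 : ℝ) ≤ if p ∈ F then (p : ℝ) ^ (-s) else 0 := by split_ifs <;> linarith
      have : (0 : ℝ) ≤ if p ∈ S then (1 : ℝ) else 0 := by split_ifs <;> linarith
      linarith
  have h1 : Real.log (r / (s - 1)) ≤ ∑ P ∈ T, b (pr P) := by
    refine (Real.log_le_log (by positivity) (hI.trans hTI)).trans ?_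
    rw [Real.log_prod fun P hP => (hterm P hP).1.ne']
    exact Finset.sum_le_sum fun P hP => (hterm P hP).2
  have h2 : ∑ P ∈ T, b (pr P) ≤ n * ∑ p ∈ T.image pr, b p := by
    rw [Finset.sum_comp, Finset.mul_sum]
    refine Finset.sum_le_sum fun p hp => ?_
    rw [nsmul_eq_mul]
    refine mul_le_mul_of_nonneg_right ?_ (hb0 p)
    obtain ⟨P0, hP0, rfl⟩ := Finset.mem_image.mp hp
    exact_mod_cast card_over (hpr P0 (hT P0 hP0)).1 _ fun P hP => by
      obtain ⟨hP1, hP2⟩ := Finset.mem_filter.mp hP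
      exact ⟨hT P hP1, hP2 ▸ (hpr P (hT P hP1)).2⟩
  have h3 : ∑ p ∈ T.image pr, b p ≤ ∑ p ∈ F, (p : ℝ) ^ (-s) + 3 * Z + S.card := by
    simp only [b]
    rw [Finset.sum_add_distrib, Finset.sum_add_distrib, ← Finset.mul_sum]
    have a1 : ∑ p ∈ T.image pr, (if p ∈ F then (p : ℝ) ^ (-s) else 0) ≤ ∑ p ∈ F, (p : ℝ) ^ (-s) := by
      rw [← Finset.sum_filter]
      exact Finset.sum_le_sum_of_subset_of_nonneg (fun p hp => (Finset.mem_filter.mp hp).2) fun _ _ _ => by positivity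
    have a2 : ∑ p ∈ T.image pr, (p : ℝ) ^ (-2 : ℝ) ≤ Z := hs2.sum_le_tsum _ fun _ _ => by positivity
    have a3 : ∑ p ∈ T.image pr, (if p ∈ S then (1 : ℝ) else 0) ≤ S.card := by
      rw [← Finset.sum_filter, Finset.sum_const, nsmul_eq_mul, mul_one]
      exact_mod_cast Finset.card_le_card fun p hp => (Finset.mem_filter.mp hp).2
    linarith
  have h4 : Real.log (r / (s - 1)) = Real.log r + Real.log (1 / (s - 1)) := by
    rw [← Real.log_mul hr.ne' (by positivity)]; congr 1; ring
  have h5 := mul_le_mul_of_nonneg_left h3 (Nat.cast_nonneg n : (0 : ℝ) ≤ n)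
  rw [h4] at h1
  linarith
end
end MN

namespace MN
set_option linter.unusedSectionVars false
set_option linter.unusedSimpArgs false
open scoped TensorProduct Pointwise Topology
open IsDedekindDomain NumberField

section
variable (K : Type) [Field K] [NumberField K]

theorem split_mem : ∃ S0 : Finset ℕ, (∀ q ∈ S0, q.Prime) ∧ (∀ q : ℕ, q.Prime → (q : ℤ) ∣ discr K → q ∈ S0) ∧
    ∀ (p : ℕ) (hp : p.Prime) (P : HeightOneSpectrum (𝓞 K)), Ideal.absNorm P.asIdeal = p →
      ∀ S : Finset ℕ, S0 ⊆ S → uq p hp ∈ ZS S ⊔ (gn K).range := by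
  classical
  choose J hJ using (ClassGroup.mk0_surjective (R := 𝓞 K))
  refine ⟨(discr K).natAbs.primeFactors ∪ Finset.univ.biUnion fun c => (Ideal.absNorm (J c : Ideal (𝓞 K))).primeFactors, ?_, ?_, ?_⟩
  · intro q hq
    rcases Finset.mem_union.mp hq with h | h
    · exact Nat.prime_of_mem_primeFactors h
    · obtain ⟨c, -, h⟩ := Finset.mem_biUnion.mp h
      exact Nat.prime_of_mem_primeFactors h
  · intro q hq hd
    refine Finset.mem_union_left _ (Nat.mem_primeFactors.mpr ⟨hq, Int.natCast_dvd.mp hd, ?_⟩)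
    exact Int.natAbs_ne_zero.mpr (discr_ne_zero K)
  · intro p hp P hP S hS
    let P0 : nonZeroDivisors (Ideal (𝓞 K)) := ⟨P.asIdeal, mem_nonZeroDivisors_of_ne_zero P.ne_bot⟩
    set c := (ClassGroup.mk0 P0)⁻¹ with hc
    have h1 : ClassGroup.mk0 (P0 * J c) = 1 := by rw [map_mul, hJ, hc, mul_inv_cancel]
    have hprin := (ClassGroup.mk0_eq_one_iff (P0 * J c).2).mp h1
    obtain ⟨β, hβ⟩ := hprin.principal
    have hβ' : P.asIdeal * (J c : Ideal (𝓞 K)) = Ideal.span {β} := hβ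
    have h2 := congrArg Ideal.absNorm hβ'
    rw [map_mul, hP, Ideal.absNorm_span_singleton] at h2
    set m := Ideal.absNorm (J c : Ideal (𝓞 K)) with hm
    have hm0 : m ≠ 0 := fun h => nonZeroDivisors.ne_zero (J c).2 (Ideal.absNorm_eq_zero_iff.mp h)
    have hN0 : Algebra.norm ℤ β ≠ 0 := by
      intro h; rw [h, Int.natAbs_zero] at h2
      exact (mul_ne_zero hp.ne_zero hm0) h2
    have hβ0 : (β : K) ≠ 0 := by
      intro h
      have : β = 0 := by exact_mod_cast h
      exact hN0 (by rw [this]; exact Algebra.norm_zero)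
    let b : Kˣ := Units.mk0 (β : K) hβ0
    have hgn : ((gn K b : ℚˣ) : ℚ) = (Algebra.norm ℤ β : ℤ) := (Algebra.coe_norm_int β).symm
    have hw : uq p hp / gn K b ∈ ZS S := by
      intro l hl hlS
      have := Fact.mk hl
      have hlm : ¬ l ∣ m := fun h => hlS (hS (Finset.mem_union_right _ (Finset.mem_biUnion.mpr
        ⟨c, Finset.mem_univ _, Nat.mem_primeFactors.mpr ⟨hl, h, hm0⟩⟩)))
      have hp0 : (p : ℚ) ≠ 0 := Nat.cast_ne_zero.mpr hp.ne_zero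
      have e : padicValRat l ((gn K b : ℚˣ) : ℚ) = padicValRat l (p : ℚ) := by
        rw [hgn, padicValRat.of_int, padicValInt, ← h2, padicValNat.mul hp.ne_zero hm0,
          padicValNat.eq_zero_of_not_dvd hlm, add_zero, padicValRat.of_nat]
      rw [Units.val_div_eq_div_val, padicValRat.div (Units.ne_zero _) (Units.ne_zero _), e]
      exact sub_self _
    have e : uq p hp = (uq p hp / gn K b) * gn K b := (div_mul_cancel _ _).symm
    rw [e]
    exact Subgroup.mul_mem_sup hw ⟨b, rfl⟩

lemma log_tendsto (a C : ℝ) (δ : ℝ) (hδ : 0 < δ) (h : ∀ s : ℝ, 1 < s → s < 1 + δ → a * Real.log (1 / (s - 1)) ≤ C) : a ≤ 0 := by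
  by_contra ha
  push Not at ha
  set L := |C| / a + 1 + |Real.log δ| with hL
  have hL0 : 0 < L := by positivity
  have h1 := h (1 + Real.exp (-L)) (by linarith [Real.exp_pos (-L)]) (by
    have : Real.exp (-L) < δ := by
      rw [← Real.lt_log_iff_exp_lt hδ]
      have := neg_abs_le (Real.log δ)
      have : 0 ≤ |C| / a := by positivity
      linarith
    linarith)
  rw [add_sub_cancel_left, one_div, Real.log_inv, Real.log_exp, neg_neg] at h1
  have h2 : a * (|C| / a) = |C| := by field_simp
  have h3 := le_abs_self C
  nlinarith [mul_nonneg ha.le (abs_nonneg (Real.log δ))]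

/-- union of classes upper bound -/
lemma classes_upper {M : ℕ} [NeZero M] (A : Finset (ZMod M)) (hA : ∀ a ∈ A, IsUnit a) : ∃ C : ℝ, ∀ F : Finset ℕ,
    (∀ p ∈ F, p.Prime ∧ (p : ZMod M) ∈ A) → ∀ x : ℝ, 1 < x → x ≤ 2 →
      ∑ p ∈ F, (p : ℝ) ^ (-x) ≤ A.card * ((M.totient : ℝ)⁻¹ * Real.log (1 / (x - 1))) + C := by
  classical
  have : ∀ a : ZMod M, ∃ C : ℝ, a ∈ A → ∀ F : Finset ℕ, (∀ p ∈ F, p.Prime ∧ (p : ZMod M) = a) → ∀ x : ℝ, 1 < x → x ≤ 2 →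
      ∑ p ∈ F, (p : ℝ) ^ (-x) ≤ (M.totient : ℝ)⁻¹ * Real.log (1 / (x - 1)) + C := by
    intro a
    by_cases ha : a ∈ A
    · obtain ⟨C, hC⟩ := prime_upper (hA a ha)
      exact ⟨C, fun _ => hC⟩
    · exact ⟨0, fun h => absurd h ha⟩
  choose C hC using this
  refine ⟨∑ a ∈ A, C a, fun F hF x hx hx2 => ?_⟩
  rw [← Finset.sum_fiberwise_of_maps_to (fun p hp => (hF p hp).2)]
  refine (Finset.sum_le_sum fun a ha => hC a ha _ (fun p hp => ⟨(hF p (Finset.mem_filter.mp hp).1).1,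
    (Finset.mem_filter.mp hp).2⟩) x hx hx2).trans ?_
  rw [Finset.sum_add_distrib, Finset.sum_const, nsmul_eq_mul]

variable {K} [IsGalois ℚ K]

/-- primes that are everywhere local norms modulo S-units, but not global ones -/
def Bad (K : Type) [Field K] [NumberField K] (S : Finset ℕ) : Set ℕ :=
  {p | ∃ hp : p.Prime, p ∉ S ∧ uq p hp ∈ LL K S ⊔ ZS S ∧ uq p hp ∉ ZS S ⊔ (gn K).range}

theorem interface {σ : K ≃ₐ[ℚ] K} (hσ : ∀ x, x ∈ Subgroup.zpowers σ) : ∃ S0 : Finset ℕ, (∀ q ∈ S0, q.Prime) ∧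
    ∀ S : Finset ℕ, (∀ q ∈ S, q.Prime) → S0 ⊆ S → LL K S ⊓ ZS S ≤ NU K S ∧
      ∃ C δ : ℝ, 0 < δ ∧ ∀ B : Finset ℕ, (∀ p ∈ B, p ∈ Bad K S) → ∀ s : ℝ, 1 < s → s < 1 + δ →
        ∑ p ∈ B, (p : ℝ) ^ (-s) ≤ C := by
  classical
  obtain ⟨S0, hS0, hram, hsp⟩ := split_mem K
  refine ⟨S0, hS0, fun S hS hSS => ?_⟩
  obtain ⟨k, hk⟩ := exists_good hσ S hS
  obtain ⟨A, hA, hcard, hAp⟩ := classes hσ hS hk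
  obtain ⟨hx0, hcount⟩ := counting hσ S hS fun q hq hd => hSS (hram q hq hd)
  have hNZ : NeZero (MM S k) := ⟨(MM_pos hS k).ne'⟩
  obtain ⟨C1, hC1⟩ := classes_upper A hA
  obtain ⟨C2, δ, hδ, hC2⟩ := split_lower K S
  have hphi : 0 < ((MM S k).totient : ℝ) := by exact_mod_cast Nat.totient_pos.mpr (MM_pos hS k)
  set φ : ℝ := ((MM S k).totient : ℝ)
  have hcardR : (A.card : ℝ) * xi K S = φ := by simp only [φ]; exact_mod_cast hcard
  set n := Module.finrank ℚ K
  have hn : 0 < n := Module.finrank_pos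
  have hnR : (0 : ℝ) < n := by exact_mod_cast hn
  have hle : LL K S ⊔ ZS S ≥ ZS S ⊔ (gn K).range := by
    refine sup_le le_sup_right ?_
    rintro _ ⟨x, rfl⟩
    exact Subgroup.mem_sup_left (gn_mem_LL K S x)
  have hFA : ∀ p : ℕ, p.Prime → p ∉ S → (∃ P : HeightOneSpectrum (𝓞 K), Ideal.absNorm P.asIdeal = p) →
      (p : ZMod (MM S k)) ∈ A := by
    rintro p hp hpS ⟨P, hP⟩
    exact (hAp p hp hpS).mp (hle (hsp p hp P hP S hSS))
  have hxpos : (0 : ℝ) < xi K S := by exact_mod_cast Nat.pos_of_ne_zero hx0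
  have hAφ : (A.card : ℝ) * φ⁻¹ = (xi K S : ℝ)⁻¹ := by
    rw [← hcardR]
    have : (A.card : ℝ) ≠ 0 := by intro h; rw [h, zero_mul] at hcardR; exact hphi.ne hcardR
    field_simp
  -- the main inequality
  have hmain : ∀ B : Finset ℕ, (∀ p ∈ B, p ∈ Bad K S) → ∀ s : ℝ, 1 < s → s < 1 + min δ 1 →
      n * ∑ p ∈ B, (p : ℝ) ^ (-s) + Real.log (1 / (s - 1)) ≤ n * ((xi K S : ℝ)⁻¹ * Real.log (1 / (s - 1))) + (n * C1 + C2) := by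
    intro B hB s hs hs'
    obtain ⟨F, hF, hlog⟩ := hC2 s hs (hs'.trans_le (by linarith [min_le_left δ 1]))
    have hdis : Disjoint B F := by
      rw [Finset.disjoint_left]
      intro p hpB hpF
      obtain ⟨hp, -, -, hnot⟩ := hB p hpB
      obtain ⟨-, -, P, hP⟩ := hF p hpF
      exact hnot (hsp p hp P hP S hSS)
    have h1 := hC1 (B ∪ F) (by
      intro p hp
      rcases Finset.mem_union.mp hp with h | h
      · obtain ⟨hp, hpS, hin, -⟩ := hB p h
        exact ⟨hp, (hAp p hp hpS).mp hin⟩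
      · obtain ⟨hp, hpS, hP⟩ := hF p h
        exact ⟨hp, hFA p hp hpS hP⟩) s hs (by linarith [min_le_right δ 1])
    rw [Finset.sum_union hdis, ← mul_assoc, hAφ] at h1
    have h2 := mul_le_mul_of_nonneg_left h1 hnR.le
    rw [mul_add, mul_add] at h2
    linarith
  have hδ1 : 0 < min δ 1 := lt_min hδ one_pos
  have hxi : xi K S ≤ n := by
    have h1 := log_tendsto (1 - n * (xi K S : ℝ)⁻¹) (n * C1 + C2) _ hδ1 fun s hs hs' => by
      have := hmain ∅ (by simp) s hs hs'
      rw [Finset.sum_empty, mul_zero, zero_add] at this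
      linarith
    have h2 : (1 : ℝ) ≤ n * (xi K S : ℝ)⁻¹ := by linarith
    rw [← div_eq_mul_inv, one_le_div hxpos] at h2
    exact_mod_cast h2
  obtain ⟨hxe, hH⟩ := hcount hxi
  refine ⟨hH, (n * C1 + C2) / n, min δ 1, hδ1, fun B hB s hs hs' => ?_⟩
  have h1 := hmain B hB s hs hs'
  rw [hxe, ← mul_assoc, mul_inv_cancel₀ hnR.ne', one_mul] at h1
  rw [le_div_iff₀ hnR]
  linarith
end

/-- primes in a unit residue class are not covered by finitely many thin sets -/
theorem dirichlet_avoid {M : ℕ} [NeZero M] {a : ZMod M} (ha : IsUnit a) (S : Finset ℕ) (T : Set ℕ)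
    (hT : ∃ C δ : ℝ, 0 < δ ∧ ∀ B : Finset ℕ, (∀ p ∈ B, p ∈ T) → ∀ s : ℝ, 1 < s → s < 1 + δ →
        ∑ p ∈ B, (p : ℝ) ^ (-s) ≤ C) : ∃ p : ℕ, p.Prime ∧ p ∉ S ∧ p ∉ T ∧ (p : ZMod M) = a := by
  classical
  by_contra hno
  push Not at hno
  obtain ⟨C, δ, hδ, hC⟩ := hT
  obtain ⟨C2, δ', hδ', hC2⟩ := split_lower ℚ (S ∪ M.primeFactors)
  let A : Finset (ZMod M) := (Finset.univ.filter IsUnit).erase a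
  obtain ⟨C1, hC1⟩ := classes_upper A (by intro x hx; simpa [A] using (Finset.mem_of_mem_erase hx))
  have hphi : 0 < (M.totient : ℝ) := by exact_mod_cast Nat.totient_pos.mpr (NeZero.pos M)
  have hcard : (A.card : ℝ) = M.totient - 1 := by
    have h1 : (Finset.univ.filter (IsUnit : ZMod M → Prop)).card = M.totient := by
      rw [← ZMod.card_units_eq_totient, ← Fintype.card_subtype]
      refine Fintype.card_congr ⟨fun x => x.2.unit, fun u => ⟨u, u.isUnit⟩, fun x => rfl, fun u => Units.ext rfl⟩
    have h2 : A.card + 1 = M.totient := by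
      rw [← h1]; exact Finset.card_erase_add_one (by simpa using ha)
    rw [← h2]; push_cast; ring
  have key := log_tendsto ((M.totient : ℝ)⁻¹) (C + C1 + C2) (min (min δ δ') 1) (lt_min (lt_min hδ hδ') one_pos) (by
    intro s hs hs'
    have a1 : min (min δ δ') 1 ≤ δ := (min_le_left _ _).trans (min_le_left _ _)
    have a2 : min (min δ δ') 1 ≤ δ' := (min_le_left _ _).trans (min_le_right _ _)
    have a3 := min_le_right (min δ δ') 1
    obtain ⟨F, hF, hlog⟩ := hC2 s hs (by linarith)
    rw [Module.finrank_self, Nat.cast_one, one_mul] at hlog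
    rw [← Finset.sum_filter_add_sum_filter_not F (fun p => (p : ZMod M) = a)] at hlog
    have b1 := hC (F.filter fun p => (p : ZMod M) = a) (by
      intro p hp
      obtain ⟨h1, h2⟩ := Finset.mem_filter.mp hp
      obtain ⟨hp1, hp2, -⟩ := hF p h1
      by_contra hpT
      exact hno p hp1 (fun h => hp2 (Finset.mem_union_left _ h)) hpT h2) s hs (by linarith)
    have b2 := hC1 (F.filter fun p => ¬ (p : ZMod M) = a) (by
      intro p hp
      obtain ⟨h1, h2⟩ := Finset.mem_filter.mp hp
      obtain ⟨hp1, hp2, -⟩ := hF p h1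
      refine ⟨hp1, Finset.mem_erase.mpr ⟨h2, Finset.mem_filter.mpr ⟨Finset.mem_univ _, ?_⟩⟩⟩
      rw [ZMod.isUnit_iff_coprime, Nat.Prime.coprime_iff_not_dvd hp1]
      exact fun h => hp2 (Finset.mem_union_right _ (Nat.mem_primeFactors.mpr ⟨hp1, h, NeZero.ne M⟩))) s hs (by linarith)
    rw [hcard, ← mul_assoc, sub_mul, mul_inv_cancel₀ hphi.ne', one_mul, sub_mul, one_mul] at b2
    linarith)
  have := inv_pos.mpr hphi
  linarith
end MN

namespace MN
set_option linter.unusedSectionVars false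
set_option linter.unusedSimpArgs false
open scoped TensorProduct Pointwise Topology
open IsDedekindDomain NumberField

lemma cg1 {G : Type*} [CommGroup G] (a b s : G) : a * b = (a * s) * (b / s) := by rw [mul_assoc, mul_div_cancel]

lemma pos_mem_NG (K : Type) [Field K] [NumberField K] {z : ℝˣ} (hz : 0 < (z : ℝ)) : z ∈ NG ℝ K := by
  have hn : Module.finrank ℚ K ≠ 0 := Module.finrank_pos.ne'
  let y : ℝ := (z : ℝ) ^ ((Module.finrank ℚ K : ℝ)⁻¹)
  have hy : y ^ Module.finrank ℚ K = (z : ℝ) := Real.rpow_inv_natCast_pow hz.le hn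
  have hy0 : y ≠ 0 := by intro h; rw [h, zero_pow hn] at hy; exact hz.ne hy
  refine ⟨Units.map (algebraMap ℝ (ℝ ⊗[ℚ] K)) (Units.mk0 y hy0), ?_⟩
  apply Units.ext
  change Algebra.norm ℝ (algebraMap ℝ (ℝ ⊗[ℚ] K) y) = (z : ℝ)
  rw [Algebra.norm_algebraMap, Module.finrank_baseChange, hy]

lemma mem_NG_of (F K : Type) [Field F] [Algebra ℚ F] [Field K] [NumberField K] (x : F ⊗[ℚ] K) (u : Fˣ)
    (h : Algebra.norm F x = u) : u ∈ NG F K := by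
  have hx : IsUnit x := by
    have h1 : IsUnit (LinearMap.det (Algebra.lmul F (F ⊗[ℚ] K) x)) := by
      rw [← Algebra.norm_apply, h]; exact u.isUnit
    have h2 := (LinearMap.equivOfIsUnitDet h1).surjective
    obtain ⟨y, hy⟩ := h2 1
    rw [LinearMap.equivOfIsUnitDet_apply] at hy
    exact IsUnit.of_mul_eq_one y hy
  obtain ⟨w, rfl⟩ := hx
  exact ⟨w, Units.ext h⟩

theorem core (r : ℕ) (K : Fin r → Type) [∀ i, Field (K i)] [∀ i, NumberField (K i)] [∀ i, IsGalois ℚ (K i)]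
    (hcyc : ∀ i, ∃ σ : K i ≃ₐ[ℚ] K i, ∀ x, x ∈ Subgroup.zpowers σ) (c : Fin r → ℚˣ)
    (s0 : ℝˣ) (hs0 : ∀ i, lm ℝ (c i) * s0 ∈ NG ℝ (K i))
    (t : ∀ (q : ℕ) [Fact q.Prime], ℚ_[q]ˣ) (ht : ∀ (q : ℕ) [Fact q.Prime], ∀ i, lm ℚ_[q] (c i) * t q ∈ NG ℚ_[q] (K i)) :
    ∃ s : ℚˣ, ∀ i, c i * s ∈ (gn (K i)).range := by
  classical
  choose σ hσ using hcyc
  have hint := fun i => interface (hσ i)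
  choose S0 hS0 hS using hint
  let S : Finset ℕ := Finset.univ.biUnion fun i => S0 i ∪ ((c i : ℚ).num.natAbs.primeFactors ∪ (c i : ℚ).den.primeFactors)
  have hSp : ∀ q ∈ S, q.Prime := by
    intro q hq
    obtain ⟨i, -, h⟩ := Finset.mem_biUnion.mp hq
    rcases Finset.mem_union.mp h with h | h
    · exact hS0 i q h
    · rcases Finset.mem_union.mp h with h | h <;> exact Nat.prime_of_mem_primeFactors h
  have hSS : ∀ i, S0 i ⊆ S := fun i q hq => Finset.mem_biUnion.mpr ⟨i, Finset.mem_univ _, Finset.mem_union_left _ hq⟩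
  have hcS : ∀ i, c i ∈ ZS S := by
    intro i p hp hpS
    have hn : ¬ p ∣ (c i : ℚ).num.natAbs := fun h => hpS (Finset.mem_biUnion.mpr ⟨i, Finset.mem_univ _,
      Finset.mem_union_right _ (Finset.mem_union_left _ (Nat.mem_primeFactors.mpr ⟨hp, h,
        Int.natAbs_ne_zero.mpr (Rat.num_ne_zero.mpr (c i).ne_zero)⟩))⟩)
    have hd : ¬ p ∣ (c i : ℚ).den := fun h => hpS (Finset.mem_biUnion.mpr ⟨i, Finset.mem_univ _,
      Finset.mem_union_right _ (Finset.mem_union_right _ (Nat.mem_primeFactors.mpr ⟨hp, h, (c i : ℚ).den_ne_zero⟩))⟩)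
    rw [padicValRat.eq_1, padicValInt, padicValNat.eq_zero_of_not_dvd hn, padicValNat.eq_zero_of_not_dvd hd]
    simp
  choose kk hkk using fun i => exists_good (hσ i) S hSp
  let k := (Finset.univ.sup kk) + 1
  have hk : ∀ i, good (K i) S k := fun i => good_mono (hkk i) ((Finset.le_sup (Finset.mem_univ i)).trans (Nat.le_succ _))
  have hk1 : 1 ≤ k := Nat.le_add_left _ _
  let z0 : ℚˣ := if 0 < (s0 : ℝ) then 1 else -1
  have hz0 : 0 < ((z0 : ℚ) : ℝ) * s0 := by
    simp only [z0]; split_ifs with h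
    · simpa using h
    · have : (s0 : ℝ) < 0 := lt_of_le_of_ne (not_lt.mp h) s0.ne_zero
      simpa using this
  obtain ⟨z, hz, hzz, b, hb, hbS, hzb⟩ := WA S hSp k hk1 z0 t
  have hbL : ∀ i, c i * z * nu1 b hb ∈ LL (K i) S := by
    intro i
    rw [mem_LL]
    constructor
    · change lm ℝ (c i * z * nu1 b hb) ∈ NG ℝ (K i)
      have e : lm ℝ (c i * z * nu1 b hb) = (lm ℝ (c i) * s0) * (lm ℝ (z * nu1 b hb) / s0) := by
        rw [mul_assoc, map_mul]; exact cg1 _ _ _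
      rw [e]
      refine mul_mem (hs0 i) (pos_mem_NG (K i) ?_)
      rw [Units.val_div_eq_div_val]
      change 0 < (((z : ℚ) * (b : ℚ) : ℚ) : ℝ) / (s0 : ℝ)
      have h1 : 0 < ((z : ℚ) : ℝ) * ((z0 : ℚ) : ℝ) := by exact_mod_cast hzz
      have h2 : 0 < ((z : ℚ) : ℝ) * s0 := by
        have h3 := mul_pos h1 hz0
        have h4 : (((z0 : ℚ) : ℝ)) ^ 2 = 1 := by simp only [z0]; split_ifs <;> simp
        have h5 : ((z : ℚ) : ℝ) * ((z0 : ℚ) : ℝ) * (((z0 : ℚ) : ℝ) * s0) = ((z : ℚ) : ℝ) * s0 * ((z0 : ℚ) : ℝ) ^ 2 := by ring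
        rwa [h5, h4, mul_one] at h3
      have hb' : (0 : ℝ) < b := by exact_mod_cast hb
      have e2 : (((z : ℚ) * (b : ℚ) : ℚ) : ℝ) / (s0 : ℝ) = ((z : ℚ) : ℝ) * s0 * b / (s0 : ℝ) ^ 2 := by
        have := s0.ne_zero
        push_cast; field_simp
      rw [e2]
      have : 0 < (s0 : ℝ) ^ 2 := by have := s0.ne_zero; positivity
      positivity
    · intro q hq
      have := Fact.mk (hSp q hq)
      rw [LQ_eq, Subgroup.mem_comap]
      have e : lm ℚ_[q] (c i * z * nu1 b hb) = (lm ℚ_[q] (c i) * t q) * (lm ℚ_[q] (z * nu1 b hb) / t q) := by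
        rw [mul_assoc, map_mul]; exact cg1 _ _ _
      rw [e]
      refine mul_mem (ht q i) (good_mem (hk i) hq _ ?_)
      have := hzb q hq
      simpa [nu1] using this
  have hNZ : NeZero (MM S k) := ⟨(MM_pos hSp k).ne'⟩
  have hbu : IsUnit (b : ZMod (MM S k)) := by
    rw [ZMod.isUnit_iff_coprime]
    exact Nat.Coprime.prod_right fun q hq => Nat.Coprime.pow_right _ (hbS q hq).symm
  choose C δ hδ hC using fun i => (hS i S hSp (hSS i)).2
  obtain ⟨p, hp, hpS, hpT, hpb⟩ := dirichlet_avoid hbu S (⋃ i, Bad (K i) S) (by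
    by_cases hr : Nonempty (Fin r)
    · refine ⟨∑ i, C i, Finset.univ.inf' Finset.univ_nonempty δ, (Finset.lt_inf'_iff _).mpr fun i _ => hδ i, fun B hB s hs hs' => ?_⟩
      calc ∑ p ∈ B, (p : ℝ) ^ (-s) ≤ ∑ p ∈ B, ∑ i, (if p ∈ Bad (K i) S then (p : ℝ) ^ (-s) else 0) := by
            refine Finset.sum_le_sum fun p hp => ?_
            obtain ⟨i, hi⟩ := Set.mem_iUnion.mp (hB p hp)
            have h1 := Finset.single_le_sum (f := fun i => if p ∈ Bad (K i) S then (p : ℝ) ^ (-s) else 0)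
              (fun j _ => by split_ifs <;> positivity) (Finset.mem_univ i)
            simp only [if_pos hi] at h1
            exact h1
        _ = ∑ i, ∑ p ∈ B.filter (· ∈ Bad (K i) S), (p : ℝ) ^ (-s) := by
            rw [Finset.sum_comm]; simp only [Finset.sum_filter]
        _ ≤ ∑ i, C i := Finset.sum_le_sum fun i _ => hC i _ (fun p hp => (Finset.mem_filter.mp hp).2) s hs
            (hs'.trans_le (by linarith [Finset.inf'_le δ (Finset.mem_univ i)]))
    · refine ⟨0, 1, one_pos, fun B hB s _ _ => ?_⟩
      rw [Finset.sum_eq_zero]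
      intro p hp
      obtain ⟨i, -⟩ := Set.mem_iUnion.mp (hB p hp)
      exact absurd ⟨i⟩ hr)
  have hup : uq p hp = nu1 p hp.pos := rfl
  refine ⟨z * uq p hp, fun i => ?_⟩
  have h1 : c i * z * uq p hp ∈ LL (K i) S := by
    have e : c i * z * uq p hp = (c i * z * nu1 b hb) * (nu1 p hp.pos / nu1 b hb) := by
      rw [hup]; exact (by rw [mul_assoc (c i * z), mul_div_cancel])
    rw [e]
    exact mul_mem (hbL i) (close_mem hSp (hk i) hp.pos hb hbS hpb)
  have h2 : c i * z ∈ ZS S := mul_mem (hcS i) hz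
  have h3 : uq p hp ∈ LL (K i) S ⊔ ZS S := by
    have e : uq p hp = (c i * z * uq p hp) * (c i * z)⁻¹ := by rw [mul_comm (c i * z), mul_inv_cancel_right]
    rw [e]
    exact Subgroup.mul_mem_sup h1 (inv_mem h2)
  have h4 : uq p hp ∈ ZS S ⊔ (gn (K i)).range := by
    by_contra h
    exact hpT (Set.mem_iUnion.mpr ⟨i, hp, hpS, h3, h⟩)
  obtain ⟨w, hw, y, ⟨α, rfl⟩, hwy⟩ := Subgroup.mem_sup.mp h4
  have h5 : c i * z * w ∈ LL (K i) S ⊓ ZS S := by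
    refine ⟨?_, mul_mem h2 hw⟩
    have e : c i * z * w = (c i * z * uq p hp) * (gn (K i) α)⁻¹ := by rw [← hwy, ← mul_assoc, mul_inv_cancel_right]
    rw [e]
    exact (LL (K i) S).mul_mem h1 ((LL (K i) S).inv_mem (gn_mem_LL (K i) S α))
  obtain ⟨β, -, hβ⟩ := (hS i S hSp (hSS i)).1 h5
  refine ⟨β * α, ?_⟩
  rw [map_mul, hβ, ← hwy]
  simp only [mul_assoc]
end MN

/-- Hasse principle for the multinorm variety
`N_{K_1/ℚ}(x_1)/c_1 = … = N_{K_r/ℚ}(x_r)/c_r ≠ 0`: if for every completion `ℚ_v` of `ℚ`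
(`ℚ_v = ℝ` or `ℚ_p`) there exist a nonzero `s ∈ ℚ_v` and `x i ∈ K i ⊗_ℚ ℚ_v` with
`N(x i) = c i * s` for all `i`, then such `s ∈ ℚ^×` and `x i ∈ K i` exist over `ℚ`. -/
theorem multinorm_hasse_principle
    (r : ℕ) (K : Fin r → Type) [∀ i, Field (K i)] [∀ i, Algebra ℚ (K i)]
    [∀ i, FiniteDimensional ℚ (K i)] [∀ i, IsGalois ℚ (K i)]
    [∀ i, IsCyclic (K i ≃ₐ[ℚ] K i)]
    (c : Fin r → ℚ) (hc : ∀ i, c i ≠ 0)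
    (hreal : ∃ s : ℝ, s ≠ 0 ∧ ∃ x : ∀ i, ℝ ⊗[ℚ] K i, ∀ i,
      Algebra.norm ℝ (x i) = (c i : ℝ) * s)
    (hpadic : ∀ (p : ℕ) [Fact p.Prime],
      ∃ s : ℚ_[p], s ≠ 0 ∧ ∃ x : ∀ i, ℚ_[p] ⊗[ℚ] K i, ∀ i,
        Algebra.norm ℚ_[p] (x i) = (c i : ℚ_[p]) * s) :
    ∃ s : ℚ, s ≠ 0 ∧ ∃ x : ∀ i, K i, ∀ i, Algebra.norm ℚ (x i) = c i * s := by
  have hcz : ∀ i, CharZero (K i) := fun i => algebraRat.charZero (K i)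
  have hal : (inferInstance : ∀ i, Algebra ℚ (K i)) = fun i => DivisionRing.toRatAlgebra :=
    funext fun i => Subsingleton.elim _ _
  rename_i i1 i2 i3 i4 i5
  change i2 = _ at hal
  subst hal
  have hnf : ∀ i, NumberField (K i) := fun i => { to_charZero := hcz i, to_finiteDimensional := i3 i }
  obtain ⟨s0, hs0, x0, hx0⟩ := hreal
  have hp' : ∀ (q : ℕ) [Fact q.Prime], ∃ t : ℚ_[q]ˣ, ∀ i,
      MN.lm ℚ_[q] (Units.mk0 (c i) (hc i)) * t ∈ MN.NG ℚ_[q] (K i) := by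
    intro q _
    obtain ⟨s, hs, x, hx⟩ := hpadic q
    refine ⟨Units.mk0 s hs, fun i => MN.mem_NG_of _ _ (x i) _ ?_⟩
    rw [hx i]
    simp [MN.lm]
  choose t ht using hp'
  obtain ⟨s, hs⟩ := MN.core r K (fun i => IsCyclic.exists_generator) (fun i => Units.mk0 (c i) (hc i)) (Units.mk0 s0 hs0)
    (fun i => MN.mem_NG_of _ _ (x0 i) _ (by rw [hx0 i]; simp [MN.lm])) t ht
  choose y hy using hs
  refine ⟨s, s.ne_zero, fun i => (y i : K i), fun i => ?_⟩
  exact congrArg Units.val (hy i)
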